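/- Let p be a prime, e a positive integer, q = p^e, and n a positive integer. Then the number of irreducible complex characters χ of GL(n, F_q) whose degree χ(1) is not divisible by p equals q^n − q^{n−1}. -/

import Mathlib

open Matrix

def IsIrrChar (G : Type) [Group G] (f : G → ℂ) : Prop :=
  ∃ V : FDRep ℂ G, CategoryTheory.Simple V ∧ FDRep.character V = f

/-- `d` divides the algebraic number `z`, i.e. `z / d` is an algebraic integer. -/
def NatDvdAlg (d : ℕ) (z : ℂ) : Prop := IsIntegral ℤ (z / (d : ℂ))


noncomputable section

/-- bundled irreducible complex representations -/
structure IR (G : Type) [Group G] where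
  V : Type
  [ac : AddCommGroup V]
  [md : Module ℂ V]
  [fd : FiniteDimensional ℂ V]
  ρ : Representation ℂ G V
  irr : ρ.IsIrreducible

attribute [instance] IR.ac IR.md IR.fd IR.irr

namespace CT

variable {G : Type} [Group G]

def chr (S : IR G) : G → ℂ := S.ρ.character

lemma isUnit_card (G : Type) [Group G] [Finite G] : IsUnit ((Nat.card G : ℂ)) := by
  rw [isUnit_iff_ne_zero]; exact_mod_cast Nat.card_pos.ne'

/-- operator attached to a function -/
def op {V : Type} [AddCommGroup V] [Module ℂ V] [Fintype G] (ρ : Representation ℂ G V) (z : G → ℂ) :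
    V →ₗ[ℂ] V := ∑ g, z g • ρ g

lemma exists_irr_op_ne [Fintype G] (z : G → ℂ) : ∀ (n : ℕ) (V : Type) [AddCommGroup V] [Module ℂ V]
    [FiniteDimensional ℂ V] (ρ : Representation ℂ G V), Module.finrank ℂ V = n → op ρ z ≠ 0 →
    ∃ S : IR G, op S.ρ z ≠ 0 := by
  intro n
  induction n using Nat.strong_induction_on with
  | _ n ih =>
  intro V _ _ _ ρ hn hz
  by_contra hcon
  have hsub : ∀ W : Subrepresentation ρ, W ≠ ⊤ → ∀ v ∈ W.toSubmodule, op ρ z v = 0 := by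
    intro W hW v hv
    by_contra hne
    have hlt : Module.finrank ℂ W.toSubmodule < n := by
      rw [← hn]; apply Submodule.finrank_lt
      intro h
      exact hW (Subrepresentation.toSubmodule_injective h)
    refine hcon (ih _ hlt W.toSubmodule W.toRepresentation rfl ?_)
    intro h0
    have := congrArg Subtype.val (LinearMap.congr_fun h0 ⟨v, hv⟩)
    apply hne
    simpa [op, LinearMap.sum_apply, Subrepresentation.toRepresentation] using this
  refine hcon ⟨⟨V, ρ, ?_⟩, hz⟩
  have hnt : Nontrivial V := by
    by_contra h
    rw [not_nontrivial_iff_subsingleton] at h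
    exact hz (Subsingleton.elim _ _)
  have : Nontrivial (Subrepresentation ρ) := by
    refine ⟨⊥, ⊤, fun h => ?_⟩
    obtain ⟨v, hv⟩ := exists_ne (0 : V)
    have : v ∈ (⊥ : Subrepresentation ρ) := h ▸ (trivial : v ∈ (⊤ : Subrepresentation ρ))
    exact hv this
  refine { eq_bot_or_eq_top := fun W => ?_ }
  by_contra! hW
  have : NeZero (Nat.card G : ℂ) := ⟨(isUnit_card G).ne_zero⟩
  obtain ⟨W', hc⟩ := exists_isCompl W
  have hW' : W' ≠ ⊤ := by
    rintro rfl
    exact hW.1 (by simpa using hc.inf_eq_bot)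
  apply hz
  ext v
  have hv : v ∈ (W ⊔ W').toSubmodule := by rw [hc.sup_eq_top]; trivial
  rw [Subrepresentation.toSubmodule_sup, Submodule.mem_sup] at hv
  obtain ⟨a, ha, b, hb, rfl⟩ := hv
  simp [hsub W hW.2 a ha, hsub W' hW' b hb]

/-- faithfulness -/
lemma exists_op_ne [Fintype G] (z : G → ℂ) (hz : z ≠ 0) : ∃ S : IR G, op S.ρ z ≠ 0 := by
  refine exists_irr_op_ne z _ (MonoidAlgebra ℂ G) (Representation.ofMulAction ℂ G G) rfl fun h => hz ?_
  ext g
  classical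
  have := DFunLike.congr_fun (congrArg MonoidAlgebra.coeff (LinearMap.congr_fun h (MonoidAlgebra.single 1 1))) g
  simpa [op, LinearMap.sum_apply, Finsupp.single_apply] using this

lemma irrChar_iff [Finite G] (f : G → ℂ) : IsIrrChar G f ↔ ∃ S : IR G, chr S = f := by
  have := Fintype.ofFinite G
  have := invertibleOfNonzero (isUnit_card G).ne_zero
  have : NeZero (Nat.card G : ℂ) := ⟨(isUnit_card G).ne_zero⟩
  constructor
  · rintro ⟨V, hV, rfl⟩
    have hnt : Nontrivial V := by
      by_contra h
      rw [not_nontrivial_iff_subsingleton] at h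
      have h1 := (FDRep.simple_iff_char_is_norm_one V).1 hV
      have h0 : ∀ g, V.character g = 0 := fun g => by
        have : V.ρ g = 0 := LinearMap.ext fun v => Subsingleton.elim _ _
        rw [FDRep.character, this, map_zero]
      simp only [h0, mul_zero, Finset.sum_const_zero] at h1
      exact (isUnit_card G).ne_zero h1.symm
    refine ⟨⟨V, V.ρ, ?_⟩, rfl⟩
    have h1 := (FDRep.simple_iff_char_is_norm_one V).1 hV
    have h2 := Representation.card_inv_mul_sum_char_mul_char_eq_finrank (ρ := V.ρ) (σ := V.ρ)
    have h3 : ∑ g, Representation.character V.ρ g * Representation.character V.ρ g⁻¹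
      = (Nat.card G : ℂ) := h1
    rw [h3, inv_mul_cancel₀ (isUnit_card G).ne_zero] at h2
    have h4 : Module.finrank ℂ (Representation.IntertwiningMap V.ρ V.ρ) = 1 := by exact_mod_cast h2.symm
    have h1ne : (1 : Representation.IntertwiningMap (ρ := V.ρ) (σ := V.ρ)) ≠ 0 := by
      intro h
      obtain ⟨v, hv⟩ := exists_ne (0 : V)
      exact hv (DFunLike.congr_fun h v)
    have : Nontrivial (Subrepresentation V.ρ) := by
      refine ⟨⊥, ⊤, fun h => ?_⟩
      obtain ⟨v, hv⟩ := exists_ne (0 : V)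
      have : v ∈ (⊥ : Subrepresentation V.ρ) := h ▸ (trivial : v ∈ (⊤ : Subrepresentation V.ρ))
      exact hv this
    refine { eq_bot_or_eq_top := fun W => ?_ }
    obtain ⟨W', hc⟩ := exists_isCompl W
    have hc1 : W.toSubmodule ⊓ W'.toSubmodule = ⊥ := by
      rw [← Subrepresentation.toSubmodule_inf, hc.inf_eq_bot]; rfl
    have hc2 : W.toSubmodule ⊔ W'.toSubmodule = ⊤ := by
      rw [← Subrepresentation.toSubmodule_sup, hc.sup_eq_top]; rfl
    have hcc : IsCompl W.toSubmodule W'.toSubmodule :=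
      ⟨disjoint_iff.2 hc1, codisjoint_iff.2 hc2⟩
    have hpr1 : ∀ v ∈ W.toSubmodule, Submodule.projection _ _ hcc v = v := fun v hv => by
      simpa using Submodule.projection_apply_left hcc ⟨v, hv⟩
    have hpr2 : ∀ v ∈ W'.toSubmodule, Submodule.projection _ _ hcc v = 0 := fun v hv => by
      rw [Submodule.projection_apply_eq_zero_iff]; exact hv
    let P : Representation.IntertwiningMap V.ρ V.ρ := ⟨Submodule.projection _ _ hcc, fun g => by
      ext v
      have hv : v ∈ W.toSubmodule ⊔ W'.toSubmodule := by rw [hc2]; trivial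
      obtain ⟨a, ha, b, hb, rfl⟩ := Submodule.mem_sup.1 hv
      simp only [LinearMap.comp_apply, map_add]
      rw [hpr1 _ ha, hpr2 _ hb, hpr1 _ (W.apply_mem_toSubmodule g ha),
        hpr2 _ (W'.apply_mem_toSubmodule g hb), map_zero]⟩
    obtain ⟨c, hc'⟩ := (finrank_eq_one_iff_of_nonzero' _ h1ne).1 h4 P
    have hP : ∀ v, c • v = Submodule.projection _ _ hcc v := fun v => DFunLike.congr_fun hc' v
    by_cases hc0 : c = 0
    · left
      apply Subrepresentation.toSubmodule_injective
      apply (Submodule.eq_bot_iff _).2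
      intro v hv
      rw [← hpr1 v hv, ← hP, hc0, zero_smul]
    · right
      apply Subrepresentation.toSubmodule_injective
      apply Submodule.eq_top_iff'.2
      intro v
      have : Submodule.projection _ _ hcc v ∈ W.toSubmodule := by simp
      rw [← hP] at this
      exact (Submodule.smul_mem_iff _ hc0).1 this
  · rintro ⟨S, rfl⟩
    refine ⟨FDRep.of S.ρ, ?_, rfl⟩
    rw [FDRep.simple_iff_char_is_norm_one]
    have h2 := Representation.card_inv_mul_sum_char_mul_char_eq_finrank (ρ := S.ρ) (σ := S.ρ)
    rw [Representation.IsIrreducible.finrank_intertwiningMap_self, Nat.cast_one,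
      inv_mul_eq_one₀ (isUnit_card G).ne_zero] at h2
    exact h2.symm

end CT
end

noncomputable section
set_option linter.all false
namespace CT
open Representation
variable {G : Type} [Group G] [Fintype G]

def ip (f h : G → ℂ) : ℂ := (Nat.card G : ℂ)⁻¹ * ∑ g, f g * h g⁻¹

lemma card_ne (G : Type) [Group G] [Finite G] : (Nat.card G : ℂ) ≠ 0 := (isUnit_card G).ne_zero

lemma ip_comm (f h : G → ℂ) : ip f h = ip h f := by
  unfold ip
  congr 1
  rw [← Equiv.sum_comp (Equiv.inv G)]
  simp [mul_comm]

lemma ip_sum_left {ι : Type*} (s : Finset ι) (c : ι → ℂ) (f : ι → G → ℂ) (h : G → ℂ) :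
    ip (fun g => ∑ i ∈ s, c i * f i g) h = ∑ i ∈ s, c i * ip (f i) h := by
  unfold ip
  simp only [Finset.sum_mul, Finset.mul_sum]
  rw [Finset.sum_comm]
  refine Finset.sum_congr rfl fun i _ => Finset.sum_congr rfl fun g _ => by ring

lemma ip_sum_right {ι : Type*} (s : Finset ι) (c : ι → ℂ) (f : ι → G → ℂ) (h : G → ℂ) :
    ip h (fun g => ∑ i ∈ s, c i * f i g) = ∑ i ∈ s, c i * ip h (f i) := by
  rw [ip_comm, ip_sum_left]
  simp [ip_comm h]

lemma ip_sub_left (f f' h : G → ℂ) : ip (fun g => f g - f' g) h = ip f h - ip f' h := by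
  simp [ip, sub_mul, mul_sub]

lemma ip_sub_right (f f' h : G → ℂ) : ip h (fun g => f g - f' g) = ip h f - ip h f' := by
  simp [ip, mul_sub]

abbrev Irr (G : Type) [Group G] := {f : G → ℂ // IsIrrChar G f}

def rep (X : Irr G) : IR G := ((irrChar_iff X.1).1 X.2).choose

lemma chr_rep (X : Irr G) : chr (rep X) = X.1 := ((irrChar_iff X.1).1 X.2).choose_spec

def ofIR (S : IR G) : Irr G := ⟨chr S, (irrChar_iff _).2 ⟨S, rfl⟩⟩

lemma ip_self (S : IR G) : ip (chr S) (chr S) = 1 := by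
  have := invertibleOfNonzero (isUnit_card G).ne_zero
  have h2 := card_inv_mul_sum_char_mul_char_eq_finrank (ρ := S.ρ) (σ := S.ρ)
  rw [IsIrreducible.finrank_intertwiningMap_self, Nat.cast_one] at h2
  exact h2

open Classical in
lemma irr_ip (X Y : Irr G) : ip X.1 Y.1 = if X = Y then 1 else 0 := by
  have := invertibleOfNonzero (isUnit_card G).ne_zero
  split_ifs with h
  · subst h; rw [← chr_rep X, ip_self]
  · have h2 := char_orthonormal (rep X).ρ (rep Y).ρ
    rw [if_neg] at h2
    · rw [← chr_rep X, ← chr_rep Y]; exact h2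
    · rintro ⟨e⟩
      apply h
      apply Subtype.ext
      rw [← chr_rep X, ← chr_rep Y]; exact (char_iso e).symm

lemma chr_conj (S : IR G) (g h : G) : chr S (h * g * h⁻¹) = chr S g := char_conj _ _ _

lemma irr_conj (X : Irr G) (g h : G) : X.1 (h * g * h⁻¹) = X.1 g := by
  rw [← chr_rep X, chr_conj]

lemma chr_one_ne (S : IR G) : chr S 1 ≠ 0 := by
  have : Nontrivial S.V := by
    by_contra h
    rw [not_nontrivial_iff_subsingleton] at h
    have h1 := ip_self S
    have h0 : ∀ g, chr S g = 0 := fun g => by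
      have : S.ρ g = 0 := LinearMap.ext fun v => Subsingleton.elim _ _
      rw [chr, character, this, map_zero]
    simp [ip, h0] at h1
  rw [chr, char_one]
  exact_mod_cast (Module.finrank_pos (R := ℂ) (M := S.V)).ne'

lemma trace_op (S : IR G) (z : G → ℂ) : LinearMap.trace ℂ S.V (op S.ρ z) = ∑ g, z g * chr S g := by
  simp [op, chr, character]

lemma trace_op_mul (S : IR G) (z : G → ℂ) (y : G) :
    LinearMap.trace ℂ S.V (op S.ρ z * S.ρ y) = ∑ g, z g * chr S (g * y) := by
  simp [op, chr, character, Finset.sum_mul]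

lemma op_scalar (S : IR G) (z : G → ℂ) (hz : ∀ g h, z (h * g * h⁻¹) = z g) :
    op S.ρ z = ((∑ g, z g * chr S g) / chr S 1) • 1 := by
  have hc : ∀ h, op S.ρ z ∘ₗ S.ρ h = S.ρ h ∘ₗ op S.ρ z := by
    intro h
    change op S.ρ z * S.ρ h = S.ρ h * op S.ρ z
    simp only [op, Finset.sum_mul, Finset.mul_sum, smul_mul_assoc, mul_smul_comm, ← map_mul]
    rw [← Equiv.sum_comp (MulAut.conj h).toEquiv]
    refine Finset.sum_congr rfl fun g _ => ?_
    simp [hz]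
  obtain ⟨c, hc'⟩ := (IsIrreducible.algebraMap_intertwiningMap_bijective_of_isAlgClosed (ρ := S.ρ)).2
    ⟨op S.ρ z, hc⟩
  have h1 : op S.ρ z = c • 1 := by
    ext v
    exact (DFunLike.congr_fun hc' v).symm
  have h2 := trace_op S z
  rw [h1] at h2
  have h3 : LinearMap.trace ℂ S.V 1 = chr S 1 := by simp [chr, character]
  rw [map_smul, h3, smul_eq_mul] at h2
  rw [h1, ← h2, mul_div_cancel_right₀ _ (chr_one_ne S)]

lemma conv_irr (X : Irr G) (z : G → ℂ) (hz : ∀ g h, z (h * g * h⁻¹) = z g) (y : G) :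
    ∑ g, z g * X.1 (g * y) = ((∑ g, z g * X.1 g) / X.1 1) * X.1 y := by
  rw [← chr_rep X, ← trace_op_mul, op_scalar _ _ hz]
  simp [chr, character]

lemma complete (f : G → ℂ) (hf : ∀ g h, f (h * g * h⁻¹) = f g) (h0 : ∀ X : Irr G, ip f X.1 = 0) :
    f = 0 := by
  by_contra hne
  have : (fun g => f g⁻¹) ≠ 0 := fun h => hne (by ext g; simpa using congrFun h g⁻¹)
  obtain ⟨S, hS⟩ := exists_op_ne _ this
  apply hS
  rw [op_scalar S (fun g => f g⁻¹) (fun g h => by rw [← hf g⁻¹ h]; congr 1; group)]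
  have := h0 (ofIR S)
  rw [ip, mul_eq_zero_iff_left (inv_ne_zero (card_ne G)), ← Equiv.sum_comp (Equiv.inv G)] at this
  simp only [Equiv.inv_apply, inv_inv, ofIR] at this
  rw [this]; simp

instance : Finite (Irr G) := by
  classical
  have : LinearIndependent ℂ (fun X : Irr G => X.1) := by
    rw [linearIndependent_iff']
    intro s c hs Y hY
    have := congrArg (fun f => ip f Y.1) hs
    have h2 : (∑ i ∈ s, c i • i.1) = fun g => ∑ i ∈ s, c i * i.1 g := by ext; simp
    simp only [h2, ip_sum_left, irr_ip] at this
    simpa [ip, hY] using this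
  exact this.finite

instance : Fintype (Irr G) := Fintype.ofFinite _

lemma expand (f : G → ℂ) (hf : ∀ g h, f (h * g * h⁻¹) = f g) :
    f = fun g => ∑ X : Irr G, ip f X.1 * X.1 g := by
  classical
  have := complete (fun g => f g - ∑ X : Irr G, ip f X.1 * X.1 g)
    (fun g h => by simp only [hf, irr_conj]) (fun Y => by
      rw [ip_sub_left, ip_sum_left]
      simp [irr_ip])
  ext g
  exact sub_eq_zero.1 (congrFun this g)

lemma col_orth (j : G) : ∑ X : Irr G, X.1 j * X.1 j⁻¹ = Nat.card (Subgroup.centralizer {j}) := by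
  classical
  have h := expand (fun g => if IsConj g j then (1 : ℂ) else 0) (fun g h => by
    congr 1
    apply propext
    have : IsConj (h * g * h⁻¹) g := (isConj_iff.2 ⟨h, rfl⟩).symm
    exact ⟨fun h => this.symm.trans h, fun h => this.trans h⟩)
  have hj := congrFun h j
  simp only [IsConj.refl, if_true] at hj
  have hip : ∀ X : Irr G, ip (fun g => if IsConj g j then (1 : ℂ) else 0) X.1 =
      (Nat.card (Subgroup.centralizer {j}) : ℂ)⁻¹ * X.1 j⁻¹ := by
    intro X
    have h1 : ∀ g, (if IsConj g j then (1 : ℂ) else 0) * X.1 g⁻¹ =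
        if IsConj g j then X.1 j⁻¹ else 0 := by
      intro g
      split_ifs with hc
      · obtain ⟨c, rfl⟩ := isConj_iff.1 hc
        rw [one_mul, ← irr_conj X g⁻¹ c]; congr 1; group
      · simp
    rw [ip]
    simp only [h1]
    rw [← Finset.sum_filter, Finset.sum_const, nsmul_eq_mul, ← mul_assoc]
    congr 1
    have h2 : (Finset.univ.filter (fun g => IsConj g j)).card * Nat.card (Subgroup.centralizer {j})
        = Nat.card G := by
      have h3 := Nat.card_congr (MulAction.orbitProdStabilizerEquivGroup (ConjAct G) j)
      rw [Nat.card_prod, ← Subgroup.nat_card_centralizer_nat_card_stabilizer j] at h3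
      refine Eq.trans ?_ (h3.trans rfl)
      congr 1
      rw [← Fintype.card_subtype, ← Nat.card_eq_fintype_card]
      exact Nat.card_congr (Equiv.subtypeEquivRight fun g => ConjAct.mem_orbit_conjAct.symm)
    rw [← h2]; push_cast
    have := card_ne (Subgroup.centralizer {j})
    have : ((Finset.univ.filter (fun g => IsConj g j)).card : ℂ) ≠ 0 := by
      have : 0 < (Finset.univ.filter (fun g => IsConj g j)).card :=
        Finset.card_pos.2 ⟨j, by simpa using IsConj.refl j⟩
      exact_mod_cast this.ne'
    field_simp
  simp only [hip] at hj
  have hc := card_ne (Subgroup.centralizer {j})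
  have : ∀ X : Irr G, X.1 j * X.1 j⁻¹ = (Nat.card (Subgroup.centralizer {j}) : ℂ) *
    ((Nat.card (Subgroup.centralizer {j}) : ℂ)⁻¹ * X.1 j⁻¹ * X.1 j) := fun X => by field_simp
  simp only [this]
  rw [← Finset.mul_sum, ← hj, mul_one]

lemma avg_nat {V : Type} [AddCommGroup V] [Module ℂ V] [FiniteDimensional ℂ V]
    (ρ : Representation ℂ G V) :
    ∃ k : ℕ, (Nat.card G : ℂ)⁻¹ * ∑ g, ρ.character g = k := by
  have := invertibleOfNonzero (isUnit_card G).ne_zero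
  exact ⟨_, card_inv_mul_sum_char_eq_finrank ρ⟩

end CT
end

noncomputable section
set_option linter.all false
namespace CT
open Representation
variable {G : Type} [Group G] [Fintype G]

lemma avg_zero {V : Type} [AddCommGroup V] [Module ℂ V] [FiniteDimensional ℂ V]
    (ρ : Representation ℂ G V) (h : ∑ g, ρ.character g = 0) : ∑ g, ρ g = 0 := by
  have := invertibleOfNonzero (isUnit_card G).ne_zero
  have h2 := card_inv_mul_sum_char_eq_finrank ρ
  rw [h, mul_zero] at h2
  have h3 : Module.finrank ℂ (invariants ρ) = 0 := by exact_mod_cast h2.symm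
  rw [Submodule.finrank_eq_zero] at h3
  ext v
  have : (∑ g, ρ g) v ∈ invariants ρ := by
    intro x
    simp only [LinearMap.sum_apply, map_sum]
    exact Fintype.sum_equiv (Equiv.mulLeft x) _ _ fun g => by simp
  rw [h3] at this
  simpa using this

def twist {H V : Type} [Group H] [AddCommGroup V] [Module ℂ V] (ρ : Representation ℂ G V)
    (i : H →* G) (l : H →* ℂ) : Representation ℂ H V where
  toFun h := l h • ρ (i h)
  map_one' := by simp
  map_mul' x y := by rw [smul_mul_smul_comm, map_mul, map_mul, map_mul]

lemma twist_char {H V : Type} [Group H] [AddCommGroup V] [Module ℂ V] (ρ : Representation ℂ G V)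
    (i : H →* G) (l : H →* ℂ) (h : H) : (twist ρ i l).character h = l h * ρ.character (i h) := by
  simp [character, twist]

lemma irr_avg_zero {H : Type} [Group H] [Fintype H] (X : Irr G) (i : H →* G) (l : H →* ℂ)
    (h : ∑ x, l x * X.1 (i x) = 0) (g : G) : ∑ x, l x * X.1 (g * i x) = 0 := by
  have h1 := avg_zero (twist (rep X).ρ i l) (by
    simp only [twist_char]; rw [← h, ← chr_rep X]; rfl)
  have h2 := congrArg (fun T => LinearMap.trace ℂ _ ((rep X).ρ g * T)) h1
  simp only [mul_zero, map_zero, Finset.mul_sum, map_sum] at h2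
  rw [← h2]
  refine Finset.sum_congr rfl fun x _ => ?_
  rw [← chr_rep X]
  simp [twist, chr, character]

lemma irr_avg_nat {H : Type} [Group H] [Fintype H] (X : Irr G) (i : H →* G) (l : H →* ℂ) :
    ∃ k : ℕ, (Nat.card H : ℂ)⁻¹ * ∑ x, l x * X.1 (i x) = k := by
  obtain ⟨k, hk⟩ := avg_nat (twist (rep X).ρ i l)
  refine ⟨k, ?_⟩
  simp only [twist_char] at hk
  rw [← hk, ← chr_rep X]; rfl

lemma irr_avg3_nat {H G₁ G₂ : Type} [Group H] [Fintype H] [Group G₁] [Fintype G₁] [Group G₂]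
    [Fintype G₂] (X : Irr G) (Y : Irr G₁) (Z : Irr G₂) (i : H →* G) (j : H →* G₁) (k : H →* G₂) :
    ∃ n : ℕ, (Nat.card H : ℂ)⁻¹ * ∑ x, X.1 (i x) * Y.1 (j x)⁻¹ * Z.1 (k x)⁻¹ = n := by
  obtain ⟨n, hn⟩ := avg_nat (tprod (tprod (twist (rep X).ρ i 1) (twist (rep Y).ρ j 1).dual)
    (twist (rep Z).ρ k 1).dual)
  refine ⟨n, ?_⟩
  rw [← hn, ← chr_rep X, ← chr_rep Y, ← chr_rep Z]
  congr 1
  refine Finset.sum_congr rfl fun x _ => ?_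
  rw [char_tensor, char_tensor]
  simp [twist_char, char_dual, chr]

lemma irr_one (X : Irr G) : ∃ d : ℕ, X.1 1 = d ∧ d ≠ 0 := by
  have h : X.1 1 = (Module.finrank ℂ (rep X).V : ℂ) := by
    rw [← chr_rep X, chr, char_one]
  refine ⟨_, h, fun h0 => chr_one_ne (rep X) ?_⟩
  rw [chr_rep, h, h0, Nat.cast_zero]

lemma multiset_frob (p k : ℕ) (hp : p.Prime) (m : Multiset (integralClosure ℤ ℂ)) :
    ∃ r, m.sum ^ p ^ k = (m.map (· ^ p ^ k)).sum + p * r := by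
  induction m using Multiset.induction with
  | empty => exact ⟨0, by simp [hp.ne_zero]⟩
  | cons a m ih =>
    obtain ⟨r, hr⟩ := ih
    obtain ⟨s, hs⟩ := exists_add_pow_prime_pow_eq hp a m.sum k
    refine ⟨a * m.sum * s + r, ?_⟩
    rw [Multiset.sum_cons, hs, hr, Multiset.map_cons, Multiset.sum_cons]
    ring

lemma irr_congr (X : Irr G) (p k : ℕ) (hp : p.Prime) (u : G) (hu : u ^ p ^ k = 1) (a : ℤ)
    (ha : X.1 u = a) : IsIntegral ℤ ((X.1 1 - a) / p) := by
  set S := rep X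
  set f := S.ρ u
  have hs : f.charpoly.Splits := IsAlgClosed.splits _
  have htr : X.1 u = f.charpoly.roots.sum := by
    rw [← Module.End.trace_eq_sum_roots_charpoly_of_splits hs, ← chr_rep X]; rfl
  have hf : f ^ p ^ k = 1 := by rw [← map_pow, hu, map_one]
  have hroot : ∀ z ∈ f.charpoly.roots, z ^ p ^ k = 1 := by
    intro z hz
    have h1 := (Polynomial.mem_roots'.1 hz).2
    rw [← Module.End.hasEigenvalue_iff_isRoot_charpoly] at h1
    obtain ⟨v, hv⟩ := h1.exists_hasEigenvector
    have h2 := hv.pow_apply (p ^ k)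
    rw [hf] at h2
    have h3 : (z ^ p ^ k - 1) • v = 0 := by rw [sub_smul, ← h2]; simp
    exact sub_eq_zero.1 ((smul_eq_zero.1 h3).resolve_right hv.2)
  have hint : ∀ z ∈ f.charpoly.roots, IsIntegral ℤ z := fun z hz =>
    IsIntegral.of_pow (pow_pos hp.pos k) (by rw [hroot z hz]; exact isIntegral_one)
  obtain ⟨m, hm⟩ : ∃ m : Multiset (integralClosure ℤ ℂ), m.map (algebraMap _ ℂ) = f.charpoly.roots :=
    ⟨f.charpoly.roots.attach.map fun z => ⟨z.1, hint z.1 z.2⟩, by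
      rw [Multiset.map_map]; exact Multiset.attach_map_val _⟩
  obtain ⟨r, hr⟩ := multiset_frob p k hp m
  have h1 := congrArg (algebraMap (integralClosure ℤ ℂ) ℂ) hr
  rw [map_pow, map_add, map_mul, map_multiset_sum, map_multiset_sum, hm, ← htr, ha, Multiset.map_map,
    map_natCast] at h1
  have h2 : (m.map (algebraMap (integralClosure ℤ ℂ) ℂ ∘ (· ^ p ^ k))) = m.map fun _ => (1 : ℂ) := by
    apply Multiset.map_congr rfl
    intro z hz
    have : algebraMap _ ℂ z ∈ f.charpoly.roots := by rw [← hm]; exact Multiset.mem_map_of_mem _ hz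
    simpa using hroot _ this
  have h3 : X.1 1 = Multiset.card m := by
    have : Multiset.card m = Multiset.card f.charpoly.roots := by rw [← hm, Multiset.card_map]
    rw [this, ← hs.natDegree_eq_card_roots, LinearMap.charpoly_natDegree, ← chr_rep X, chr, char_one]
  rw [h2] at h1
  simp only [Multiset.map_const', Multiset.sum_replicate, nsmul_eq_mul, mul_one] at h1
  rw [← h3] at h1
  have hF : (p : ℤ) ∣ a ^ p ^ k - a := by
    have : Fact p.Prime := ⟨hp⟩
    rw [← ZMod.intCast_zmod_eq_zero_iff_dvd]
    push_cast
    rw [ZMod.pow_card_pow, sub_self]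
  obtain ⟨b, hb⟩ := hF
  have hb' : (a : ℂ) ^ p ^ k - a = p * b := by exact_mod_cast congrArg (Int.cast (R := ℂ)) hb
  have hp0 : (p : ℂ) ≠ 0 := by exact_mod_cast hp.ne_zero
  have : (X.1 1 - a) / p = (b : ℂ) - algebraMap _ ℂ r := by
    rw [div_eq_iff hp0]; linear_combination h1.symm + hb'
  rw [this]
  have hbI : IsIntegral ℤ (b : ℂ) := by simpa using isIntegral_algebraMap (R := ℤ) (A := ℂ) (x := b)
  exact hbI.sub r.2

lemma natDvd_iff (X : Irr G) (p k : ℕ) (hp : p.Prime) (u : G) (hu : u ^ p ^ k = 1) (a : ℤ)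
    (ha : X.1 u = a) : NatDvdAlg p (X.1 1) ↔ (p : ℤ) ∣ a := by
  have h := irr_congr X p k hp u hu a ha
  have hp0 : (p : ℂ) ≠ 0 := by exact_mod_cast hp.ne_zero
  have h1 : NatDvdAlg p (X.1 1) ↔ IsIntegral ℤ ((a : ℂ) / p) := by
    unfold NatDvdAlg
    constructor
    · intro h'
      have := h'.sub h
      rwa [← sub_div, sub_sub_cancel] at this
    · intro h'
      have := h'.add h
      rwa [← add_div, add_sub_cancel] at this
  rw [h1]
  constructor
  · intro h'
    have h2 : (a : ℂ) / p = algebraMap ℚ ℂ ((a : ℚ) / p) := by simp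
    rw [h2, isIntegral_algebraMap_iff (algebraMap ℚ ℂ).injective,
      IsIntegrallyClosed.isIntegral_iff] at h'
    obtain ⟨b, hb⟩ := h'
    refine ⟨b, ?_⟩
    have hp0 : (p : ℚ) ≠ 0 := by exact_mod_cast hp.ne_zero
    rw [eq_div_iff hp0] at hb
    have : (b : ℚ) * p = a := by simpa using hb
    have : b * p = a := by exact_mod_cast this
    rw [← this, mul_comm]
  · rintro ⟨b, rfl⟩
    have : (((p : ℤ) * b : ℤ) : ℂ) / p = b := by push_cast; field_simp
    rw [this]
    simpa using isIntegral_algebraMap (R := ℤ) (A := ℂ) (x := b)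

end CT
end

noncomputable section
set_option linter.all false
namespace CT
open Module
attribute [local instance] Classical.propDecidable
variable {F : Type} [Field F] [Fintype F]

instance glFin (n : ℕ) : Fintype (GL (Fin n) F) := Fintype.ofFinite _

section
variable {V W : Type} [AddCommGroup V] [Module F V] [Finite V] [AddCommGroup W] [Module F W] [Finite W]
instance finSub : Finite (Submodule F V) := Finite.of_injective (fun W => (W : Set V)) SetLike.coe_injective
instance finHom : Finite (V →ₗ[F] W) := Finite.of_injective (fun f => (f : V → W)) DFunLike.coe_injective
instance ftSub : Fintype (Submodule F V) := Fintype.ofFinite _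
instance ftHom : Fintype (V →ₗ[F] W) := Fintype.ofFinite _
instance finU : Finite (End F V)ˣ := Finite.of_injective (fun f => (f : End F V)) Units.val_injective
instance ftU : Fintype (End F V)ˣ := Fintype.ofFinite _
instance finQ (W : Submodule F V) : Finite (V ⧸ W) := Finite.of_surjective _ W.mkQ_surjective
instance fdV : FiniteDimensional F V := Module.Finite.of_finite
end

variable (F) in
structure CF where
  f : ∀ (V : Type) [AddCommGroup V] [Module F V] [Finite V], End F V → ℂ
  inv : ∀ {V W : Type} [AddCommGroup V] [Module F V] [Finite V] [AddCommGroup W] [Module F W]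
    [Finite W] (e : V ≃ₗ[F] W) (g : End F V) (h : End F W), (∀ x, e (g x) = h (e x)) → f V g = f W h

variable {V W A B D : Type} [AddCommGroup V] [Module F V] [Finite V] [AddCommGroup W] [Module F W]
  [Finite W] [AddCommGroup A] [Module F A] [Finite A] [AddCommGroup B] [Module F B] [Finite B]
  [AddCommGroup D] [Module F D] [Finite D]

def sub (α : CF F) (W : Submodule F V) (g : End F V) : ℂ :=
  if h : ∀ x ∈ W, g x ∈ W then α.f W (g.restrict h) else 0

def quo (α : CF F) (W : Submodule F V) (g : End F V) : ℂ :=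
  if h : ∀ x ∈ W, g x ∈ W then α.f (V ⧸ W) (W.mapQ W g h) else 0

lemma sub_zero {α : CF F} {W : Submodule F V} {g : End F V} (h : ¬ ∀ x ∈ W, g x ∈ W) : sub α W g = 0 :=
  dif_neg h

lemma sub_eq (α : CF F) {U : Submodule F V} {g : End F V} (i : W →ₗ[F] V) (hi : Function.Injective i)
    (hr : LinearMap.range i = U) (g' : End F W) (h : ∀ x, g (i x) = i (g' x)) :
    sub α U g = α.f W g' := by
  subst hr
  have hs : ∀ x ∈ LinearMap.range i, g x ∈ LinearMap.range i := by
    rintro _ ⟨x, rfl⟩; exact ⟨g' x, (h x).symm⟩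
  rw [sub, dif_pos hs]
  refine (α.inv (LinearEquiv.ofInjective i hi) _ _ fun x => ?_).symm
  apply Subtype.ext
  simp [h]

lemma quo_eq (α : CF F) {U : Submodule F V} {g : End F V} (p : V →ₗ[F] W) (hp : Function.Surjective p)
    (hr : LinearMap.ker p = U) (g' : End F W) (h : ∀ x, p (g x) = g' (p x)) :
    quo α U g = α.f W g' := by
  subst hr
  have hs : ∀ x ∈ LinearMap.ker p, g x ∈ LinearMap.ker p := by
    intro x hx; rw [LinearMap.mem_ker] at *; rw [h, hx, map_zero]
  rw [quo, dif_pos hs]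
  refine (α.inv (p.quotKerEquivOfSurjective hp) _ _ fun x => ?_)
  obtain ⟨x, rfl⟩ := Submodule.mkQ_surjective _ x
  simp [h, LinearMap.quotKerEquivOfSurjective, LinearMap.quotKerEquivRange]

lemma stable_map (e : V ≃ₗ[F] W) (g : End F V) (g' : End F W) (h : ∀ x, e (g x) = g' (e x))
    (U : Submodule F V) (h' : ∀ x ∈ U.map (e : V →ₗ[F] W), g' x ∈ U.map (e : V →ₗ[F] W)) :
    ∀ x ∈ U, g x ∈ U := by
  intro x hx
  obtain ⟨y, hy, hy'⟩ := h' (e x) ⟨x, hx, rfl⟩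
  have : y = g x := e.injective (by rw [h]; exact hy')
  exact this ▸ hy

lemma sub_map (α : CF F) (e : V ≃ₗ[F] W) (g : End F V) (g' : End F W) (h : ∀ x, e (g x) = g' (e x))
    (U : Submodule F V) : sub α (U.map (e : V →ₗ[F] W)) g' = sub α U g := by
  by_cases hs : ∀ x ∈ U, g x ∈ U
  · conv_rhs => rw [sub, dif_pos hs]
    refine sub_eq α ((e : V →ₗ[F] W) ∘ₗ U.subtype) (e.injective.comp Subtype.val_injective) ?_ _ ?_
    · rw [LinearMap.range_comp, Submodule.range_subtype]
    · intro x; simp [h]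
  · rw [sub_zero hs, sub_zero fun h' => hs (stable_map e g g' h U h')]

lemma quo_map (α : CF F) (e : V ≃ₗ[F] W) (g : End F V) (g' : End F W) (h : ∀ x, e (g x) = g' (e x))
    (U : Submodule F V) : quo α (U.map (e : V →ₗ[F] W)) g' = quo α U g := by
  by_cases hs : ∀ x ∈ U, g x ∈ U
  · conv_rhs => rw [quo, dif_pos hs]
    refine quo_eq α (U.mkQ ∘ₗ (e.symm : W →ₗ[F] V)) ?_ ?_ _ ?_
    · exact U.mkQ_surjective.comp e.symm.surjective
    · rw [LinearMap.ker_comp, Submodule.ker_mkQ, Submodule.map_equiv_eq_comap_symm]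
    · intro x
      obtain ⟨x, rfl⟩ := e.surjective x
      simp [← h]
  · rw [quo, quo, dif_neg hs, dif_neg fun h' => hs (stable_map e g g' h U h')]

def mapSub (e : V ≃ₗ[F] W) : Submodule F V ≃ Submodule F W := (Submodule.orderIsoMapComap e).toEquiv

lemma mapSub_apply (e : V ≃ₗ[F] W) (U : Submodule F V) : mapSub e U = U.map (e : V →ₗ[F] W) := rfl

/-- Hall product -/
def mulC (α X : CF F) : CF F where
  f V _ _ _ g := ∑ U : Submodule F V, sub α U g * quo X U g
  inv e g h hh := Fintype.sum_equiv (mapSub e) _ _ fun U => by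
    rw [mapSub_apply, sub_map α e g h hh, quo_map X e g h hh]

lemma mulC_f (α X : CF F) (g : End F V) : (mulC α X).f V g = ∑ U : Submodule F V, sub α U g * quo X U g := rfl

def bl (g : End F A) (ν : B →ₗ[F] A) (h : End F B) : End F (A × B) :=
  (g ∘ₗ LinearMap.fst F A B + ν ∘ₗ LinearMap.snd F A B).prod (h ∘ₗ LinearMap.snd F A B)

@[simp] lemma bl_apply (g : End F A) (ν : B →ₗ[F] A) (h : End F B) (x : A × B) :
    bl g ν h x = (g x.1 + ν x.2, h x.2) := rfl

lemma CF.congr_f (α : CF F) {g h : End F V} (e : ∀ x, g x = h x) : α.f V g = α.f V h :=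
  congrArg _ (LinearMap.ext e)

variable (A) in
def adj (ρ φ : CF F) : CF F where
  f B _ _ _ h := ((Nat.card (End F A)ˣ : ℂ) * (Nat.card (B →ₗ[F] A) : ℂ))⁻¹ *
    ∑ g : (End F A)ˣ, ∑ ν : B →ₗ[F] A, ρ.f A ((g⁻¹ : (End F A)ˣ) : End F A) * φ.f (A × B) (bl (g : End F A) ν h)
  inv {B B'} _ _ _ _ _ _ e h h' hh := by
    let E : (B →ₗ[F] A) ≃ (B' →ₗ[F] A) := (LinearEquiv.congrLeft A F e).toEquiv
    rw [Nat.card_congr E]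
    congr 1
    refine Finset.sum_congr rfl fun g _ => Fintype.sum_equiv E _ _ fun ν => ?_
    congr 1
    refine φ.inv ((LinearEquiv.refl F A).prodCongr e) _ _ fun x => ?_
    ext <;> simp [E, LinearEquiv.congrLeft, hh]

lemma adj_f (ρ φ : CF F) (h : End F B) : (adj A ρ φ).f B h =
   ((Nat.card (End F A)ˣ : ℂ) * (Nat.card (B →ₗ[F] A) : ℂ))⁻¹ *
    ∑ g : (End F A)ˣ, ∑ ν : B →ₗ[F] A, ρ.f A ((g⁻¹ : (End F A)ˣ) : End F A) * φ.f (A × B) (bl (g : End F A) ν h) := rfl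

/-- cuspidality -/
def Cusp (α : CF F) : Prop := ∀ (V : Type) [AddCommGroup V] [Module F V] [Finite V] (D : Submodule F V),
  D ≠ ⊥ → D ≠ ⊤ → ∀ g : End F V,
    ∑ ν : (V ⧸ D) →ₗ[F] D, α.f V (g * (1 + D.subtype ∘ₗ ν ∘ₗ D.mkQ)) = 0

lemma sum_surj {G H : Type} [AddGroup G] [AddGroup H] [Fintype G] [Fintype H] (φ : G →+ H)
    (hφ : Function.Surjective φ) (f : H → ℂ) : ∑ g, f (φ g) = (Nat.card φ.ker : ℂ) * ∑ h, f h := by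
  rw [← Finset.sum_fiberwise Finset.univ φ, Finset.mul_sum]
  refine Finset.sum_congr rfl fun h _ => ?_
  obtain ⟨g0, rfl⟩ := hφ h
  rw [Finset.sum_congr rfl (g := fun _ => f (φ g0)) (by intro x hx; rw [(Finset.mem_filter.1 hx).2]),
    Finset.sum_const, nsmul_eq_mul]
  congr 2
  rw [Nat.card_eq_fintype_card, ← Fintype.card_subtype]
  exact Fintype.card_congr ((Equiv.addLeft (-g0)).subtypeEquiv fun x => by
    simp only [AddMonoidHom.mem_ker, Equiv.coe_addLeft, map_add, map_neg, neg_add_eq_zero]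
    exact eq_comm)

lemma Cusp.sum {α : CF F} (hα : Cusp α) (i : D →ₗ[F] V) (p : V →ₗ[F] B) (hi : Function.Injective i)
    (hip : LinearMap.range i = LinearMap.ker p) (hD : Nontrivial D) (hp : p ≠ 0) (g : End F V) :
    ∑ ν : B →ₗ[F] D, α.f V (g * (1 + i ∘ₗ ν ∘ₗ p)) = 0 := by
  have h1 := hα V (LinearMap.range i) (by
      intro h; rw [LinearMap.range_eq_bot] at h
      obtain ⟨x, hx⟩ := exists_ne (0 : D)
      exact hx (hi (by simp [h]))) (by
      intro h; rw [hip, LinearMap.ker_eq_top] at h; exact hp h) g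
  let p' : (V ⧸ LinearMap.range i) →ₗ[F] B := (LinearMap.range i).liftQ p hip.le
  have hp' : Function.Injective p' := by
    rw [← LinearMap.ker_eq_bot, Submodule.ker_liftQ, ← hip, Submodule.mkQ_map_self]
  obtain ⟨r, hr⟩ := p'.exists_leftInverse_of_injective (LinearMap.ker_eq_bot.2 hp')
  let φ : (B →ₗ[F] D) →+ ((V ⧸ LinearMap.range i) →ₗ[F] LinearMap.range i) :=
    { toFun := fun ν => i.rangeRestrict ∘ₗ ν ∘ₗ p'
      map_zero' := by simp
      map_add' := by intros; ext; simp }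
  have hφ : Function.Surjective φ := by
    intro μ
    refine ⟨((LinearEquiv.ofInjective i hi).symm : _ →ₗ[F] D) ∘ₗ μ ∘ₗ r, ?_⟩
    ext x
    have : r (p' ((LinearMap.range i).mkQ x)) = (LinearMap.range i).mkQ x := LinearMap.congr_fun hr _
    have h2 : ∀ y, i ((LinearEquiv.ofInjective i hi).symm y) = y := fun y => by
      conv_rhs => rw [← (LinearEquiv.ofInjective i hi).apply_symm_apply y]
      rfl
    simp only [φ, AddMonoidHom.coe_mk, ZeroHom.coe_mk, LinearMap.comp_apply, this]
    exact h2 _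
  have h2 := sum_surj φ hφ fun μ => α.f V (g * (1 + (LinearMap.range i).subtype ∘ₗ μ ∘ₗ (LinearMap.range i).mkQ))
  rw [h1, mul_zero] at h2
  rw [← h2]
  rfl

end CT
end

noncomputable section
set_option linter.all false
namespace CT
open Module
attribute [local instance] Classical.propDecidable
variable {F : Type} [Field F] [Fintype F]
variable {V W A B D : Type} [AddCommGroup V] [Module F V] [Finite V] [AddCommGroup W] [Module F W]
  [Finite W] [AddCommGroup A] [Module F A] [Finite A] [AddCommGroup B] [Module F B] [Finite B]
  [AddCommGroup D] [Module F D] [Finite D]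

@[to_additive sum_zero_of_add]
lemma sum_zero_of {G K : Type} [Group G] [Fintype G] [Fintype K] [Nonempty K] (φ : K → G) (f : G → ℂ)
    (h : ∀ x, ∑ k, f (x * φ k) = 0) : ∑ x, f x = 0 := by
  have h1 : ∑ k : K, ∑ x, f (x * φ k) = 0 := by
    rw [Finset.sum_comm]; exact Finset.sum_eq_zero fun x _ => h x
  have h2 : ∀ k, ∑ x, f (x * φ k) = ∑ x, f x := fun k => Equiv.sum_comp (Equiv.mulRight (φ k)) f
  simp only [h2, Finset.sum_const, nsmul_eq_mul] at h1
  refine (mul_eq_zero.1 h1).resolve_left ?_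
  simp

lemma stable_mul {U : Submodule F V} {μ : End F V} (h2 : ∀ x, μ (μ x) = 0) (hU : ∀ x ∈ U, μ x ∈ U)
    (g : End F V) : (∀ x ∈ U, (g * (1 + μ)) x ∈ U) ↔ ∀ x ∈ U, g x ∈ U := by
  constructor
  · intro h x hx
    have := h (x - μ x) (U.sub_mem hx (hU x hx))
    simpa [h2] using this
  · intro h x hx
    exact h _ (by simpa using U.add_mem hx (hU x hx))

lemma quo_mul (X : CF F) {U : Submodule F V} {μ : End F V} (h2 : ∀ x, μ (μ x) = 0) (hU : ∀ x, μ x ∈ U)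
    (g : End F V) : quo X U (g * (1 + μ)) = quo X U g := by
  have hs := stable_mul h2 (fun x _ => hU x) g
  by_cases h : ∀ x ∈ U, g x ∈ U
  · rw [quo, quo, dif_pos h, dif_pos (hs.2 h)]
    refine X.congr_f fun x => ?_
    obtain ⟨x, rfl⟩ := U.mkQ_surjective x
    simpa using h _ (hU x)
  · rw [quo, quo, dif_neg h, dif_neg (fun h' => h (hs.1 h'))]

lemma sub_mul_ker (X : CF F) {U : Submodule F V} {μ : End F V} (hU : ∀ x ∈ U, μ x = 0)
    (g : End F V) : sub X U (g * (1 + μ)) = sub X U g := by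
  have hs : (∀ x ∈ U, (g * (1 + μ)) x ∈ U) ↔ ∀ x ∈ U, g x ∈ U :=
    forall₂_congr fun x hx => by simp [hU x hx]
  by_cases h : ∀ x ∈ U, g x ∈ U
  · rw [sub, sub, dif_pos h, dif_pos (hs.2 h)]
    refine X.congr_f fun x => Subtype.ext ?_
    simp [hU x x.2]
  · rw [sub, sub, dif_neg h, dif_neg (fun h' => h (hs.1 h'))]

/-- `sub` sums for a cuspidal function -/
lemma Cusp.sub_sum {α : CF F} (hα : Cusp α) (U : Submodule F V) (i : D →ₗ[F] V) (p : V →ₗ[F] B)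
    (hi : Function.Injective i) (hpi : ∀ x, p (i x) = 0) (hiU : ∀ x, i x ∈ U)
    (hU : ∀ x ∈ U, p x = 0 → ∃ y, i y = x) (hD : Nontrivial D) (hp : ∃ x ∈ U, p x ≠ 0)
    (g : End F V) : ∑ ν : B →ₗ[F] D, sub α U (g * (1 + i ∘ₗ ν ∘ₗ p)) = 0 := by
  have hs : ∀ ν : B →ₗ[F] D, (∀ x ∈ U, (g * (1 + i ∘ₗ ν ∘ₗ p)) x ∈ U) ↔ ∀ x ∈ U, g x ∈ U := fun ν =>
    stable_mul (by intro x; simp [hpi]) (fun x _ => hiU _) g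
  by_cases h : ∀ x ∈ U, g x ∈ U
  · have := hα.sum (i.codRestrict U hiU) (p ∘ₗ U.subtype) (fun x y hxy => hi (congrArg Subtype.val hxy))
      (by
        ext x
        constructor
        · rintro ⟨y, rfl⟩; simp [hpi]
        · intro hx
          obtain ⟨y, hy⟩ := hU x x.2 hx
          exact ⟨y, Subtype.ext hy⟩) hD
      (by
        obtain ⟨x, hx, hx'⟩ := hp
        exact fun h0 => hx' (LinearMap.congr_fun h0 ⟨x, hx⟩)) (g.restrict h)
    rw [← this]
    refine Finset.sum_congr rfl fun ν _ => ?_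
    rw [sub, dif_pos ((hs ν).2 h)]
    exact α.congr_f fun x => Subtype.ext (by simp)
  · exact Finset.sum_eq_zero fun ν _ => sub_zero fun h' => h ((hs ν).1 h')

def TT (ρ α X : CF F) (h : End F B) (U : Submodule F (A × B)) : ℂ :=
  ∑ g : (End F A)ˣ, ∑ ν : B →ₗ[F] A, ρ.f A ((g⁻¹ : (End F A)ˣ) : End F A) *
    (sub α U (bl (g : End F A) ν h) * quo X U (bl (g : End F A) ν h))

lemma TT_case1 (ρ X : CF F) {α : CF F} (hα : Cusp α) (h : End F B) (U : Submodule F (A × B))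
    (hD : U.comap (LinearMap.inl F A B) ≠ ⊥) (hU : ∃ x ∈ U, x.2 ≠ 0) : TT ρ α X h U = 0 := by
  set D := U.comap (LinearMap.inl F A B)
  refine Finset.sum_eq_zero fun g _ => ?_
  apply sum_zero_of_add (K := B →ₗ[F] D) fun ν' => (g : End F A) ∘ₗ D.subtype ∘ₗ ν'
  intro ν
  have hDn : Nontrivial D := Submodule.nontrivial_iff_ne_bot.2 hD
  have key := hα.sub_sum U (LinearMap.inl F A B ∘ₗ D.subtype) (LinearMap.snd F A B)
    (LinearMap.inl_injective.comp Subtype.val_injective) (by simp) (fun x => x.2)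
    (fun x hx hx2 => ⟨⟨x.1, by
      show (x.1, (0 : B)) ∈ U
      have : x.2 = 0 := hx2
      rw [← this]; exact hx⟩, by ext <;> simp; exact hx2.symm⟩) hDn hU (bl (g : End F A) ν h)
  have hb : ∀ ν' : B →ₗ[F] D, bl (g : End F A) (ν + (g : End F A) ∘ₗ D.subtype ∘ₗ ν') h =
      bl (g : End F A) ν h * (1 + (LinearMap.inl F A B ∘ₗ D.subtype) ∘ₗ ν' ∘ₗ LinearMap.snd F A B) := by
    intro ν'
    refine LinearMap.ext fun x => ?_
    ext <;> simp
    abel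
  simp only [hb]
  have hq : ∀ ν' : B →ₗ[F] D, quo X U (bl (g : End F A) ν h * (1 + (LinearMap.inl F A B ∘ₗ D.subtype) ∘ₗ ν' ∘ₗ LinearMap.snd F A B)) = quo X U (bl (g : End F A) ν h) := fun ν' =>
    quo_mul X (by intro x; simp) (fun x => (ν' x.2).2) _
  simp only [hq]
  rw [← Finset.mul_sum, ← Finset.sum_mul, key]
  simp

def unip (μ : End F V) (h : μ * μ = 0) : (End F V)ˣ where
  val := 1 + μ
  inv := 1 - μ
  val_inv := by rw [mul_sub, mul_one, add_mul, h]; simp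
  inv_val := by rw [mul_add, mul_one, sub_mul, h]; simp

lemma TT_case2 (α X : CF F) {ρ : CF F} (hρ : Cusp ρ) (h : End F B) (U : Submodule F (A × B))
    (hD : U.comap (LinearMap.inl F A B) ≠ ⊥) (hD' : U.comap (LinearMap.inl F A B) ≠ ⊤)
    (hU : ∀ x ∈ U, x.2 = 0) : TT ρ α X h U = 0 := by
  set D := U.comap (LinearMap.inl F A B)
  rw [TT, Finset.sum_comm]
  refine Finset.sum_eq_zero fun ν _ => ?_
  let m : ((A ⧸ D) →ₗ[F] D) → End F A := fun k => D.subtype ∘ₗ k ∘ₗ D.mkQ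
  have hm0 : ∀ k x, x ∈ D → m k x = 0 := fun k x hx => by
    simp [m, (Submodule.Quotient.mk_eq_zero D).2 hx]
  have hmD : ∀ k x, m k x ∈ D := fun k x => (k _).2
  have hm : ∀ k, m k * m k = 0 := fun k => LinearMap.ext fun x => hm0 k _ (hmD k x)
  apply sum_zero_of (K := (A ⧸ D) →ₗ[F] D) fun k => unip (m k) (hm k)
  intro g
  have hb : ∀ k, bl ((g * unip (m k) (hm k) : (End F A)ˣ) : End F A) ν h =
      bl (g : End F A) ν h * (1 + LinearMap.inl F A B ∘ₗ m k ∘ₗ LinearMap.fst F A B) := by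
    intro k
    refine LinearMap.ext fun x => ?_
    ext <;> simp [unip]
    try abel
  have hUD : ∀ x ∈ U, x.1 ∈ D := fun x hx => by
    show (x.1, (0 : B)) ∈ U
    rw [← hU x hx]; exact hx
  have hq : ∀ k, quo X U (bl ((g * unip (m k) (hm k) : (End F A)ˣ) : End F A) ν h) = quo X U (bl (g : End F A) ν h) := by
    intro k
    rw [hb]
    exact quo_mul X (fun x => by simp [hm0 k _ (hmD k x.1)]) (fun x => hmD k x.1) _
  have hs : ∀ k, sub α U (bl ((g * unip (m k) (hm k) : (End F A)ˣ) : End F A) ν h) = sub α U (bl (g : End F A) ν h) := by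
    intro k
    rw [hb]
    exact sub_mul_ker α (fun x hx => by simp [hm0 k _ (hUD x hx)]) _
  simp only [hq, hs]
  rw [← Finset.sum_mul]
  have key := hρ A D hD hD' ((g⁻¹ : (End F A)ˣ) : End F A)
  rw [← Equiv.sum_comp (Equiv.neg _)] at key
  have : ∑ k, ρ.f A (((g * unip (m k) (hm k))⁻¹ : (End F A)ˣ) : End F A) = 0 := by
    rw [← key]
    refine Finset.sum_congr rfl fun k _ => ?_
    refine ρ.inv (LinearMap.GeneralLinearGroup.toLinearEquiv g⁻¹) _ _ fun x => ?_
    simp [unip, m, sub_eq_add_neg]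
  rw [this, zero_mul]

lemma TT_case3 (ρ α X : CF F) (h : End F B) :
    TT ρ α X h (LinearMap.range (LinearMap.inl F A B)) = (Nat.card (B →ₗ[F] A) : ℂ) *
      ((∑ g : (End F A)ˣ, ρ.f A ((g⁻¹ : (End F A)ˣ) : End F A) * α.f A (g : End F A)) * X.f B h) := by
  rw [TT, Finset.sum_mul, Finset.mul_sum]
  refine Finset.sum_congr rfl fun g _ => ?_
  rw [Finset.sum_congr rfl (g := fun _ => ρ.f A ((g⁻¹ : (End F A)ˣ) : End F A) * (α.f A (g : End F A) * X.f B h))]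
  · simp [mul_assoc]
  · intro ν _
    rw [sub_eq α (LinearMap.inl F A B) LinearMap.inl_injective rfl (g : End F A) (by intro x; simp),
      quo_eq X (LinearMap.snd F A B) LinearMap.snd_surjective (LinearMap.range_inl F A B).symm h (by intro x; simp)]

def shear (s : B →ₗ[F] A) : (A × B) ≃ₗ[F] (A × B) :=
  LinearEquiv.ofLinear (bl 1 s 1) (bl 1 (-s) 1) (by refine LinearMap.ext fun x => ?_; ext <;> simp)
    (by refine LinearMap.ext fun x => ?_; ext <;> simp)

lemma TT_shear (ρ α X : CF F) (h : End F B) (U : Submodule F (A × B)) (s : B →ₗ[F] A) :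
    TT ρ α X h (U.map (shear s : (A × B) →ₗ[F] (A × B))) = TT ρ α X h U := by
  symm
  refine Finset.sum_congr rfl fun g _ => ?_
  refine Fintype.sum_equiv (Equiv.addRight (s ∘ₗ h - (g : End F A) ∘ₗ s)) _ _ fun ν => ?_
  have : ∀ x, shear s (bl (g : End F A) ν h x) = bl (g : End F A) (ν + (s ∘ₗ h - (g : End F A) ∘ₗ s)) h (shear s x) := by
    intro x
    ext <;> simp [shear]
    abel
  simp only [Equiv.coe_addRight]
  rw [sub_map α (shear s) _ _ this, quo_map X (shear s) _ _ this]

def gr (U : Submodule F B) (s : U →ₗ[F] A) : Submodule F (A × B) := LinearMap.range (s.prod U.subtype)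

lemma gr_eq (U : Submodule F B) (s : U →ₗ[F] A) :
    ∃ t : B →ₗ[F] A, gr U s = (gr U (0 : U →ₗ[F] A)).map (shear t : (A × B) →ₗ[F] (A × B)) := by
  obtain ⟨t, ht⟩ := LinearMap.exists_extend s
  refine ⟨t, ?_⟩
  rw [gr, gr, ← LinearMap.range_comp]
  congr 1
  refine LinearMap.ext fun x => ?_
  ext <;> simp [shear, ← ht]

lemma card_hom (U : Submodule F B) : (Nat.card (B →ₗ[F] A)) =
    Nat.card (U →ₗ[F] A) * Nat.card ((B ⧸ U) →ₗ[F] A) := by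
  rw [Module.natCard_eq_pow_finrank (K := F), Module.natCard_eq_pow_finrank (K := F) (V := U →ₗ[F] A),
    Module.natCard_eq_pow_finrank (K := F) (V := (B ⧸ U) →ₗ[F] A), ← pow_add]
  simp only [Module.finrank_linearMap]
  rw [← add_mul, add_comm, Submodule.finrank_quotient_add_finrank]

lemma sum_factor (U : Submodule F B) (f : (B →ₗ[F] A) → ℂ) (hf : ∀ ν, ¬ (∀ x ∈ U, ν x = 0) → f ν = 0) :
    ∑ ν, f ν = ∑ k : (B ⧸ U) →ₗ[F] A, f (k ∘ₗ U.mkQ) := by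
  symm
  refine Finset.sum_of_injOn (fun k => k ∘ₗ U.mkQ) ?_ (by simp) ?_ (by simp)
  · intro k _ k' _ hk
    exact LinearMap.ext fun x => by
      obtain ⟨x, rfl⟩ := U.mkQ_surjective x
      exact LinearMap.congr_fun hk x
  · intro ν _ hν
    refine hf ν fun h => hν ?_
    exact ⟨U.liftQ ν (fun x hx => h x hx), by simp, Submodule.liftQ_mkQ _ _ _⟩

lemma TT_gr0 (ρ α X : CF F) (h : End F B) (U : Submodule F B) :
    TT ρ α X h (gr U (0 : U →ₗ[F] A)) = (Nat.card (End F A)ˣ : ℂ) * (Nat.card ((B ⧸ U) →ₗ[F] A) : ℂ) *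
      (sub α U h * quo (adj A ρ X) U h) := by
  have hmem : ∀ x : A × B, x ∈ gr U (0 : U →ₗ[F] A) ↔ x.1 = 0 ∧ x.2 ∈ U := by
    intro x
    constructor
    · rintro ⟨y, rfl⟩; simp
    · rintro ⟨h1, h2⟩; exact ⟨⟨x.2, h2⟩, by ext <;> simp [h1]⟩
  by_cases hs : ∀ x ∈ U, h x ∈ U
  · have hc : ((Nat.card (End F A)ˣ : ℂ) * (Nat.card ((B ⧸ U) →ₗ[F] A) : ℂ)) ≠ 0 := by
      simp [Nat.card_pos.ne']
    rw [quo, dif_pos hs, adj_f, mul_left_comm, mul_inv_cancel_left₀ hc, TT, Finset.mul_sum]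
    refine Finset.sum_congr rfl fun g _ => ?_
    rw [sum_factor U, Finset.mul_sum]
    · refine Finset.sum_congr rfl fun k _ => ?_
      rw [show sub α U h = α.f U (h.restrict hs) from dif_pos hs, mul_left_comm]
      congr 1
      · refine sub_eq α ((0 : U →ₗ[F] A).prod U.subtype) ?_ rfl _ ?_
        · intro x y hxy; exact Subtype.ext (congrArg Prod.snd hxy)
        · intro x
          ext <;> simp [(Submodule.Quotient.mk_eq_zero U).2 x.2]
      · congr 1
        refine quo_eq X (LinearMap.prodMap LinearMap.id U.mkQ) ?_ ?_ _ ?_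
        · rintro ⟨x, y⟩
          obtain ⟨y, rfl⟩ := U.mkQ_surjective y
          exact ⟨(x, y), rfl⟩
        · ext x; rw [hmem]; simp
        · intro x; ext <;> simp
    · intro ν hν
      rw [sub_zero]
      · simp
      · intro h'
        refine hν fun x hx => ?_
        have := h' (0, x) ((hmem _).2 ⟨rfl, hx⟩)
        rw [hmem] at this
        simpa using this.1
  · rw [sub_zero hs, zero_mul, mul_zero]
    refine Finset.sum_eq_zero fun g _ => Finset.sum_eq_zero fun ν _ => ?_
    rw [sub_zero]
    · simp
    · intro h'
      refine hs fun x hx => ?_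
      have := h' (0, x) ((hmem _).2 ⟨rfl, hx⟩)
      rw [hmem] at this
      exact this.2

lemma sum_gr (T : Submodule F (A × B) → ℂ) : ∑ U, (if U.comap (LinearMap.inl F A B) = ⊥ then T U else 0) =
    ∑ U : Submodule F B, ∑ s : U →ₗ[F] A, T (gr U s) := by
  rw [← Finset.sum_filter, Finset.sum_sigma']
  symm
  refine Finset.sum_bij (fun x _ => gr x.1 x.2) ?_ ?_ ?_ (fun _ _ => rfl)
  · rintro ⟨U, s⟩ _
    simp only [Finset.mem_filter, Finset.mem_univ, true_and, eq_bot_iff]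
    rintro x ⟨y, hy⟩
    have h2 : (y : B) = 0 := congrArg Prod.snd hy
    have h1 : s y = x := congrArg Prod.fst hy
    have : y = 0 := Subtype.ext h2
    rw [Submodule.mem_bot, ← h1, this, map_zero]
  · rintro ⟨U, s⟩ _ ⟨U', s'⟩ _ hh
    simp only at hh
    have hU : ∀ (U : Submodule F B) (s : U →ₗ[F] A), (gr U s).map (LinearMap.snd F A B) = U := by
      intro U s
      rw [gr, ← LinearMap.range_comp]
      conv_rhs => rw [← Submodule.range_subtype U]
      rfl
    obtain rfl : U = U' := by rw [← hU U s, hh, hU]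
    congr 1
    refine LinearMap.ext fun x => ?_
    have : (s x, (x : B)) ∈ gr U s' := hh ▸ ⟨x, rfl⟩
    obtain ⟨y, hy⟩ := this
    have h2 : y = x := Subtype.ext (congrArg Prod.snd hy)
    rw [← h2]
    have h1 : s' y = s x := congrArg Prod.fst hy
    rw [h1, h2]
  · intro U hU
    simp only [Finset.mem_filter, Finset.mem_univ, true_and] at hU
    let p : U →ₗ[F] B := LinearMap.snd F A B ∘ₗ U.subtype
    have hp : Function.Injective p := by
      rw [← LinearMap.ker_eq_bot, eq_bot_iff]
      rintro ⟨⟨x, y⟩, hx⟩ hy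
      have hy : y = 0 := hy
      subst hy
      have : x ∈ U.comap (LinearMap.inl F A B) := hx
      rw [hU, Submodule.mem_bot] at this
      subst this
      rfl
    let e := LinearEquiv.ofInjective p hp
    refine ⟨⟨LinearMap.range p, LinearMap.fst F A B ∘ₗ U.subtype ∘ₗ (e.symm : _ →ₗ[F] U)⟩, by simp, ?_⟩
    have : ∀ y : LinearMap.range p, p (e.symm y) = y := fun y => by
      conv_rhs => rw [← e.apply_symm_apply y]
      rfl
    ext x
    constructor
    · rintro ⟨y, rfl⟩
      have h1 : ((LinearMap.fst F A B ∘ₗ U.subtype ∘ₗ (e.symm : _ →ₗ[F] U)).prod (LinearMap.range p).subtype) y = (e.symm y : U) :=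
        Prod.ext rfl (this y).symm
      rw [h1]; exact (e.symm y).2
    · intro hx
      refine ⟨e ⟨x, hx⟩, ?_⟩
      ext
      · simp
      · rfl

theorem adj_mul [Nontrivial A] {ρ α : CF F} (hρ : Cusp ρ) (hα : Cusp α) (X : CF F) (h : End F B) :
    (adj A ρ (mulC α X)).f B h =
      ((Nat.card (End F A)ˣ : ℂ)⁻¹ * ∑ g : (End F A)ˣ, ρ.f A ((g⁻¹ : (End F A)ˣ) : End F A) * α.f A (g : End F A)) * X.f B h
       + (mulC α (adj A ρ X)).f B h := by
  have hG : (Nat.card (End F A)ˣ : ℂ) ≠ 0 := by simp [Nat.card_pos.ne']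
  have hH : (Nat.card (B →ₗ[F] A) : ℂ) ≠ 0 := by simp [Nat.card_pos.ne']
  have h1 : ∑ g : (End F A)ˣ, ∑ ν : B →ₗ[F] A, ρ.f A ((g⁻¹ : (End F A)ˣ) : End F A) *
      (mulC α X).f (A × B) (bl (g : End F A) ν h) = ∑ U : Submodule F (A × B), TT ρ α X h U := by
    simp only [TT]
    rw [Finset.sum_comm (s := (Finset.univ : Finset (Submodule F (A × B))))]
    refine Finset.sum_congr rfl fun g _ => ?_
    rw [Finset.sum_comm (s := (Finset.univ : Finset (Submodule F (A × B))))]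
    refine Finset.sum_congr rfl fun ν _ => ?_
    rw [mulC_f, Finset.mul_sum]
  set I := LinearMap.range (LinearMap.inl F A B)
  have hI : I.comap (LinearMap.inl F A B) ≠ ⊥ := by
    obtain ⟨x, hx⟩ := exists_ne (0 : A)
    intro h0
    have : x ∈ I.comap (LinearMap.inl F A B) := ⟨x, rfl⟩
    rw [h0] at this
    exact hx this
  have h2 : ∀ U, TT ρ α X h U = (if U = I then TT ρ α X h U else 0) +
      if U.comap (LinearMap.inl F A B) = ⊥ then TT ρ α X h U else 0 := by
    intro U
    by_cases hU : U = I
    · subst hU; rw [if_pos rfl, if_neg hI, add_zero]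
    rw [if_neg hU, zero_add]
    split_ifs with hb
    · rfl
    by_cases hs : ∃ x ∈ U, x.2 ≠ 0
    · exact TT_case1 ρ X hα h U hb hs
    push Not at hs
    refine TT_case2 α X hρ h U hb (fun ht => hU ?_) hs
    ext x
    constructor
    · intro hx; exact ⟨x.1, Prod.ext rfl (hs x hx).symm⟩
    · rintro ⟨y, rfl⟩
      have : y ∈ U.comap (LinearMap.inl F A B) := ht ▸ Submodule.mem_top
      exact this
  rw [adj_f, h1, Finset.sum_congr rfl fun U _ => h2 U, Finset.sum_add_distrib, Finset.sum_ite_eq' , if_pos (Finset.mem_univ _),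
    sum_gr, TT_case3, mul_add]
  congr 1
  · field_simp
  · rw [mulC_f, Finset.mul_sum]
    refine Finset.sum_congr rfl fun U _ => ?_
    have h3 : ∀ s : U →ₗ[F] A, TT ρ α X h (gr U s) = TT ρ α X h (gr U (0 : U →ₗ[F] A)) := by
      intro s
      obtain ⟨t, ht⟩ := gr_eq U s
      rw [ht, TT_shear]
    simp only [h3]
    rw [Finset.sum_const, nsmul_eq_mul, TT_gr0, Finset.card_univ, ← Nat.card_eq_fintype_card, card_hom U]
    have hH1 : (Nat.card (U →ₗ[F] A) : ℂ) ≠ 0 := by simp [Nat.card_pos.ne']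
    have hH2 : (Nat.card ((B ⧸ U) →ₗ[F] A) : ℂ) ≠ 0 := by simp [Nat.card_pos.ne']
    push_cast
    field_simp

end CT
end

noncomputable section
set_option linter.all false
namespace CT
open Module
attribute [local instance] Classical.propDecidable
variable {F : Type} [Field F] [Fintype F]
variable {V W A B D : Type} [AddCommGroup V] [Module F V] [Finite V] [AddCommGroup W] [Module F W]
  [Finite W] [AddCommGroup A] [Module F A] [Finite A] [AddCommGroup B] [Module F B] [Finite B]
  [AddCommGroup D] [Module F D] [Finite D]

def glE {n : ℕ} (e : (Fin n → F) ≃ₗ[F] V) : GL (Fin n) F ≃* (End F V)ˣ :=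
  (Matrix.GeneralLinearGroup.toLin : GL (Fin n) F ≃* _).trans (LinearMap.GeneralLinearGroup.congrLinearEquiv e)

lemma glE_apply {n : ℕ} (e : (Fin n → F) ≃ₗ[F] V) (M : GL (Fin n) F) (x : Fin n → F) :
    e (M.1 *ᵥ x) = (glE e M : End F V) (e x) := by
  simp [glE, Matrix.GeneralLinearGroup.coe_toLin]

def res (n : ℕ) (φ : CF F) (M : GL (Fin n) F) : ℂ := φ.f (Fin n → F) M.1.mulVecLin

lemma res_eq {n : ℕ} (φ : CF F) (e : (Fin n → F) ≃ₗ[F] V) (M : GL (Fin n) F) (g : End F V)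
    (h : ∀ x, e (M.1 *ᵥ x) = g (e x)) : res n φ M = φ.f V g := φ.inv e _ _ h

lemma res_class (n : ℕ) (φ : CF F) (g h : GL (Fin n) F) : res n φ (h * g * h⁻¹) = res n φ g := by
  symm
  refine φ.inv (LinearMap.GeneralLinearGroup.toLinearEquiv (Matrix.GeneralLinearGroup.toLin h)) _ _ fun x => ?_
  show h.1 *ᵥ (g.1 *ᵥ x) = (h * g * h⁻¹).1 *ᵥ (h.1 *ᵥ x)
  rw [Matrix.mulVec_mulVec, Matrix.mulVec_mulVec, ← Units.val_mul, ← Units.val_mul, inv_mul_cancel_right]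

def IsM {n : ℕ} (V : Type) [AddCommGroup V] [Module F V] (g : End F V) (M : GL (Fin n) F) : Prop :=
  ∃ e : (Fin n → F) ≃ₗ[F] V, ∀ x, e (M.1 *ᵥ x) = g (e x)

lemma IsM.conj {n : ℕ} {g : End F V} {M N : GL (Fin n) F} (h : IsM V g M) (h' : IsM V g N) :
    ∃ k, N = k * M * k⁻¹ := by
  obtain ⟨e, he⟩ := h
  obtain ⟨e', he'⟩ := h'
  let k : GL (Fin n) F := Matrix.GeneralLinearGroup.toLin.symm
    (LinearMap.GeneralLinearGroup.ofLinearEquiv (e.trans e'.symm))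
  have hk : ∀ x, k.1 *ᵥ x = e'.symm (e x) := by
    intro x
    have : Matrix.GeneralLinearGroup.toLin k = LinearMap.GeneralLinearGroup.ofLinearEquiv (e.trans e'.symm) :=
      MulEquiv.apply_symm_apply _ _
    have h2 := congrArg (fun g : (End F (Fin n → F))ˣ => (g : End F (Fin n → F)) x) this
    exact h2
  refine ⟨k, ?_⟩
  rw [eq_mul_inv_iff_mul_eq]
  apply Units.ext
  apply Matrix.mulVec_injective
  funext x
  rw [Units.val_mul, Units.val_mul, ← Matrix.mulVec_mulVec, ← Matrix.mulVec_mulVec, hk, hk]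
  apply e'.injective
  rw [he', e'.apply_symm_apply, e'.apply_symm_apply, he]

def chz {n : ℕ} (c : GL (Fin n) F → ℂ) (P : GL (Fin n) F → Prop) : ℂ :=
  if h : (∀ g h, c (h * g * h⁻¹) = c g) ∧ ∃ M : GL (Fin n) F, P M then c h.2.choose else 0

def ofC (n : ℕ) (c : GL (Fin n) F → ℂ) : CF F where
  f V _ _ _ g := chz c (IsM V g)
  inv {V W} _ _ _ _ _ _ e g g' hh := by
    have : ∀ M : GL (Fin n) F, IsM V g M ↔ IsM W g' M := by
      intro M
      constructor
      · rintro ⟨a, ha⟩; exact ⟨a.trans e, fun x => by simp [ha, hh]⟩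
      · rintro ⟨a, ha⟩; exact ⟨a.trans e.symm, fun x => by apply e.injective; simp [ha, hh]⟩
    exact congrArg _ (funext fun M => propext (this M))

lemma ofC_f {n : ℕ} {c : GL (Fin n) F → ℂ} (hc : ∀ g h, c (h * g * h⁻¹) = c g) {g : End F V} {M : GL (Fin n) F}
    (h : IsM V g M) : (ofC n c).f V g = c M := by
  have : (∀ g h, c (h * g * h⁻¹) = c g) ∧ ∃ M : GL (Fin n) F, IsM V g M := ⟨hc, M, h⟩
  show dite _ _ _ = _
  rw [dif_pos this]
  obtain ⟨k, hk⟩ := h.conj this.2.choose_spec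
  rw [hk, hc]

lemma ofC_zero {n : ℕ} {c : GL (Fin n) F → ℂ} {g : End F V} (h : ∀ M : GL (Fin n) F, ¬ IsM V g M) :
    (ofC n c).f V g = 0 := dif_neg fun h' => h _ h'.2.choose_spec

lemma res_ofC {n : ℕ} {c : GL (Fin n) F → ℂ} (hc : ∀ g h, c (h * g * h⁻¹) = c g) : res n (ofC n c) = c :=
  funext fun M => ofC_f hc ⟨LinearEquiv.refl _ _, fun x => rfl⟩

lemma ofC_glE {n : ℕ} {c : GL (Fin n) F → ℂ} (hc : ∀ g h, c (h * g * h⁻¹) = c g) (e : (Fin n → F) ≃ₗ[F] V)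
    (g : (End F V)ˣ) : (ofC n c).f V (g : End F V) = c ((glE e).symm g) :=
  ofC_f hc ⟨e, fun x => by rw [glE_apply, MulEquiv.apply_symm_apply]⟩

def Deg (α : CF F) (m : ℕ) : Prop := ∀ (V : Type) [AddCommGroup V] [Module F V] [Finite V] (g : End F V),
  finrank F V ≠ m → α.f V g = 0

lemma ofC_deg {n : ℕ} {c : GL (Fin n) F → ℂ} : Deg (ofC n c) n := fun V _ _ _ g h =>
  ofC_zero fun M => by rintro ⟨e, _⟩; exact h (by rw [← e.finrank_eq]; simp)

lemma ofC_nu {n : ℕ} {c : GL (Fin n) F → ℂ} (g : End F V) (hg : ¬ IsUnit g) : (ofC n c).f V g = 0 :=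
  ofC_zero fun M => by
    rintro ⟨e, he⟩
    refine hg ?_
    have : g = (glE e M : End F V) := LinearMap.ext fun x => by
      obtain ⟨x, rfl⟩ := e.surjective x
      rw [← he, glE_apply]
    rw [this]; exact Units.isUnit _

def IP (n : ℕ) (φ ψ : CF F) : ℂ := ip (res n φ) (res n ψ)

lemma IP_eq {n : ℕ} (φ ψ : CF F) (h : finrank F V = n) : IP n φ ψ =
    (Nat.card (End F V)ˣ : ℂ)⁻¹ * ∑ g : (End F V)ˣ, φ.f V (g : End F V) * ψ.f V ((g⁻¹ : (End F V)ˣ) : End F V) := by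
  let e : (Fin n → F) ≃ₗ[F] V := LinearEquiv.ofFinrankEq _ _ (by rw [h]; simp)
  rw [IP, ip, Nat.card_congr (glE e).toEquiv]
  congr 1
  refine Fintype.sum_equiv (glE e).toEquiv _ _ fun g => ?_
  rw [res_eq φ e g _ (glE_apply e g), res_eq ψ e g⁻¹ _ (glE_apply e g⁻¹), map_inv]
  rfl

@[ext] structure Par (A B F : Type) [Field F] [AddCommGroup A] [Module F A] [AddCommGroup B] [Module F B] where
  a : (End F A)ˣ
  v : B →ₗ[F] A
  d : (End F B)ˣ

def parE : Par A B F ≃ (End F A)ˣ × (B →ₗ[F] A) × (End F B)ˣ where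
  toFun x := (x.a, x.v, x.d)
  invFun x := ⟨x.1, x.2.1, x.2.2⟩
  left_inv _ := rfl
  right_inv _ := rfl

instance : Finite (Par A B F) := Finite.of_equiv _ parE.symm
instance : Fintype (Par A B F) := Fintype.ofFinite _

instance : Group (Par A B F) where
  mul x y := ⟨x.a * y.a, (x.a : End F A) ∘ₗ y.v + x.v ∘ₗ (y.d : End F B), x.d * y.d⟩
  one := ⟨1, 0, 1⟩
  inv x := ⟨x.a⁻¹, -(((x.a⁻¹ : (End F A)ˣ) : End F A) ∘ₗ x.v ∘ₗ ((x.d⁻¹ : (End F B)ˣ) : End F B)), x.d⁻¹⟩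
  mul_assoc x y z := by
    refine Par.ext (mul_assoc _ _ _) ?_ (mul_assoc _ _ _)
    refine LinearMap.ext fun t => ?_
    show (x.a.1 * y.a.1) (z.v t) + (x.a.1 (y.v (z.d.1 t)) + x.v (y.d.1 (z.d.1 t))) =
      x.a.1 (y.a.1 (z.v t) + y.v (z.d.1 t)) + x.v ((y.d.1 * z.d.1) t)
    simp [add_assoc]
  one_mul x := by
    refine Par.ext (one_mul _) ?_ (one_mul _)
    refine LinearMap.ext fun t => ?_
    show x.v t + 0 = _
    simp
  mul_one x := by
    refine Par.ext (mul_one _) ?_ (mul_one _)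
    refine LinearMap.ext fun t => ?_
    show x.a.1 0 + x.v t = _
    simp
  inv_mul_cancel x := by
    refine Par.ext (inv_mul_cancel _) ?_ (inv_mul_cancel _)
    refine LinearMap.ext fun t => ?_
    show (x.a⁻¹).1 (x.v t) + -((x.a⁻¹).1 (x.v ((x.d⁻¹).1 (x.d.1 t)))) = 0
    rw [← Module.End.mul_apply (x.d⁻¹).1, ← Units.val_mul, inv_mul_cancel]
    simp

def Par.ha : Par A B F →* (End F A)ˣ := ⟨⟨Par.a, rfl⟩, fun _ _ => rfl⟩
def Par.hd : Par A B F →* (End F B)ˣ := ⟨⟨Par.d, rfl⟩, fun _ _ => rfl⟩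
def Par.gl : Par A B F →* (End F (A × B))ˣ := MonoidHom.toHomUnits
  { toFun := fun x => bl (x.a : End F A) x.v (x.d : End F B)
    map_one' := LinearMap.ext fun t => by
      show (t.1 + 0, t.2) = t
      simp
    map_mul' := fun x y => LinearMap.ext fun t => by
      show ((x.a.1 * y.a.1) t.1 + (x.a.1 (y.v t.2) + x.v (y.d.1 t.2)), (x.d.1 * y.d.1) t.2) =
        (x.a.1 (y.a.1 t.1 + y.v t.2) + x.v (y.d.1 t.2), x.d.1 (y.d.1 t.2))
      simp [add_assoc] }

lemma Par.gl_val (x : Par A B F) : (Par.gl x : End F (A × B)) = bl (x.a : End F A) x.v (x.d : End F B) := rfl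

lemma Par.gl_inj : Function.Injective (Par.gl : Par A B F → _) := by
  intro x y h
  have h1 : ∀ t, bl x.a.1 x.v x.d.1 t = bl y.a.1 y.v y.d.1 t := fun t =>
    LinearMap.congr_fun (congrArg Units.val h) t
  refine Par.ext (Units.ext (LinearMap.ext fun t => ?_)) (LinearMap.ext fun t => ?_) (Units.ext (LinearMap.ext fun t => ?_))
  · simpa using congrArg Prod.fst (h1 (t, 0))
  · simpa using congrArg Prod.fst (h1 (0, t))
  · simpa using congrArg Prod.snd (h1 (0, t))

lemma Par.mem_range (g : (End F (A × B))ˣ)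
    (h : ∀ x ∈ LinearMap.range (LinearMap.inl F A B), g.1 x ∈ LinearMap.range (LinearMap.inl F A B)) :
    ∃ x, Par.gl x = g := by
  have h' : ∀ t : A, (g.1 (t, 0)).2 = 0 := fun t => by
    obtain ⟨y, hy⟩ := h (t, 0) ⟨t, rfl⟩
    rw [← hy]; rfl
  have hg : Function.Injective g.1 := (LinearMap.GeneralLinearGroup.toLinearEquiv g).injective
  have hg' : Function.Surjective g.1 := (LinearMap.GeneralLinearGroup.toLinearEquiv g).surjective
  have ha : IsUnit (LinearMap.fst F A B ∘ₗ g.1 ∘ₗ LinearMap.inl F A B : End F A) := by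
    rw [LinearMap.isUnit_iff_ker_eq_bot, eq_bot_iff]
    intro t ht
    have ht : (g.1 (t, 0)).1 = 0 := ht
    have : g.1 (t, 0) = 0 := Prod.ext ht (h' t)
    have := hg (this.trans (map_zero _).symm)
    simpa using congrArg Prod.fst this
  have hsplit : ∀ t : A × B, g.1 t = g.1 (t.1, 0) + g.1 (0, t.2) := fun t => by
    rw [← map_add]; congr 1; simp
  have hd : IsUnit (LinearMap.snd F A B ∘ₗ g.1 ∘ₗ LinearMap.inr F A B : End F B) := by
    rw [LinearMap.isUnit_iff_range_eq_top, eq_top_iff]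
    intro t _
    obtain ⟨y, hy⟩ := hg' (0, t)
    refine ⟨y.2, ?_⟩
    have := congrArg Prod.snd hy
    rw [hsplit, Prod.snd_add, h', zero_add] at this
    exact this
  refine ⟨⟨ha.unit, LinearMap.fst F A B ∘ₗ g.1 ∘ₗ LinearMap.inr F A B, hd.unit⟩, Units.ext (LinearMap.ext fun t => ?_)⟩
  rw [Par.gl_val, hsplit t]
  refine Prod.ext rfl ?_
  rw [Prod.snd_add, h', zero_add]
  rfl

lemma stable_inv (g : (End F V)ˣ) (U : Submodule F V) (h : ∀ x ∈ U, g.1 x ∈ U) : U.map g.1 = U := by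
  apply Submodule.eq_of_le_of_finrank_eq
  · rintro _ ⟨x, hx, rfl⟩; exact h x hx
  · exact LinearEquiv.finrank_map_eq (LinearMap.GeneralLinearGroup.toLinearEquiv g) U

lemma exists_map (U : Submodule F (A × B)) (h : finrank F U = finrank F A) :
    ∃ x : (End F (A × B))ˣ, (LinearMap.range (LinearMap.inl F A B)).map x.1 = U := by
  obtain ⟨C, hC⟩ := U.exists_isCompl
  have h2 : finrank F B = finrank F C := by
    have := Submodule.finrank_add_eq_of_isCompl hC
    rw [Module.finrank_prod] at this
    omega
  let e := ((LinearEquiv.ofFinrankEq A U h.symm).prodCongr (LinearEquiv.ofFinrankEq B C h2)).trans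
    (Submodule.prodEquivOfIsCompl U C hC)
  refine ⟨LinearMap.GeneralLinearGroup.ofLinearEquiv e, ?_⟩
  apply Submodule.eq_of_le_of_finrank_eq
  · rintro _ ⟨_, ⟨y, rfl⟩, rfl⟩
    show e (y, 0) ∈ U
    simp [e]
  · rw [h]
    refine (LinearEquiv.finrank_map_eq e _).trans ?_
    exact LinearMap.finrank_range_of_inj LinearMap.inl_injective

theorem ip_par (φ ρ Y : CF F) (hρ : Deg ρ (finrank F A)) :
    (Nat.card (End F (A × B))ˣ : ℂ)⁻¹ * ∑ g : (End F (A × B))ˣ, φ.f _ (g : End F (A × B)) *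
        (mulC ρ Y).f _ ((g⁻¹ : (End F (A × B))ˣ) : End F (A × B)) =
    (Nat.card (Par A B F) : ℂ)⁻¹ * ∑ x : Par A B F, φ.f _ (Par.gl x : End F (A × B)) *
      ρ.f A ((x.a⁻¹ : (End F A)ˣ) : End F A) * Y.f B ((x.d⁻¹ : (End F B)ˣ) : End F B) := by
  set G := (End F (A × B))ˣ
  set A0 := LinearMap.range (LinearMap.inl F A B)
  let T : Submodule F (A × B) → ℂ := fun U => ∑ g : G, φ.f _ (g : End F (A × B)) *
    (sub ρ U ((g⁻¹ : G) : End F (A × B)) * quo Y U ((g⁻¹ : G) : End F (A × B)))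
  have h1 : ∑ g : G, φ.f _ (g : End F (A × B)) * (mulC ρ Y).f _ ((g⁻¹ : G) : End F (A × B)) = ∑ U, T U := by
    simp only [T]
    rw [Finset.sum_comm]
    refine Finset.sum_congr rfl fun g _ => ?_
    rw [mulC_f, Finset.mul_sum]
  have hT : ∀ (x : G) U, T (U.map x.1) = T U := by
    intro x U
    symm
    refine Fintype.sum_equiv (MulAut.conj x).toEquiv _ _ fun g => ?_
    have hx : ∀ (g : G) t, (LinearMap.GeneralLinearGroup.toLinearEquiv x) (g.1 t) =
        (x * g * x⁻¹).1 ((LinearMap.GeneralLinearGroup.toLinearEquiv x) t) := by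
      intro g t
      show x.1 (g.1 t) = (x * g * x⁻¹).1 (x.1 t)
      rw [← Module.End.mul_apply, ← Module.End.mul_apply, ← Units.val_mul, ← Units.val_mul, inv_mul_cancel_right]
    have e1 : ((MulAut.conj x) g : G) = x * g * x⁻¹ := rfl
    have e2 : (x * g * x⁻¹)⁻¹ = x * g⁻¹ * x⁻¹ := conj_inv
    show _ = φ.f _ ((MulAut.conj x g : G) : End F (A × B)) * (sub ρ (U.map x.1) (((MulAut.conj x g)⁻¹ : G) : End F (A × B)) * quo Y (U.map x.1) (((MulAut.conj x g)⁻¹ : G) : End F (A × B)))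
    rw [e1, e2, φ.inv _ _ _ (hx g)]
    congr 1
    have hs := sub_map ρ (LinearMap.GeneralLinearGroup.toLinearEquiv x) _ _ (hx g⁻¹) U
    have hq := quo_map Y (LinearMap.GeneralLinearGroup.toLinearEquiv x) _ _ (hx g⁻¹) U
    rw [← hs, ← hq]
    rfl
  have hT0 : T A0 = ∑ x : Par A B F, φ.f _ (Par.gl x : End F (A × B)) *
      ρ.f A ((x.a⁻¹ : (End F A)ˣ) : End F A) * Y.f B ((x.d⁻¹ : (End F B)ˣ) : End F B) := by
    symm
    refine Finset.sum_of_injOn Par.gl Par.gl_inj.injOn (by simp) ?_ ?_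
    · intro g _ hg
      rw [sub_zero]
      · simp
      · intro h
        obtain ⟨x, hx⟩ := Par.mem_range g⁻¹ h
        exact hg ⟨x⁻¹, by simp, by rw [map_inv, hx, inv_inv]⟩
    · intro x _
      rw [mul_assoc, ← map_inv]
      congr 1
      rw [Par.gl_val]
      rw [sub_eq ρ (LinearMap.inl F A B) LinearMap.inl_injective rfl _ (fun t => by simp; rfl),
        quo_eq Y (LinearMap.snd F A B) LinearMap.snd_surjective (LinearMap.range_inl F A B).symm _ (fun t => rfl)]
      rfl
  have hst : ∀ x : G, A0.map x.1 = A0 ↔ ∃ y, Par.gl y = x := by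
    intro x
    constructor
    · intro h
      exact Par.mem_range x fun t ht => h.le ⟨t, ht, rfl⟩
    · rintro ⟨y, rfl⟩
      refine stable_inv _ _ ?_
      rintro _ ⟨t, rfl⟩
      exact ⟨y.a.1 t, by rw [Par.gl_val]; simp⟩
  have hcard : ∀ U : Submodule F (A × B), finrank F U = finrank F A →
      ((Finset.univ.filter fun x : G => A0.map x.1 = U).card) = Nat.card (Par A B F) := by
    intro U hU
    obtain ⟨y, hy⟩ := exists_map U hU
    rw [Nat.card_eq_fintype_card, ← Finset.card_univ]
    symm
    refine Finset.card_bij (fun z _ => y * Par.gl z) ?_ ?_ ?_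
    · intro z _
      simp only [Finset.mem_filter, Finset.mem_univ, true_and]
      rw [Units.val_mul, show y.1 * (Par.gl z).1 = y.1 ∘ₗ (Par.gl z).1 from rfl, Submodule.map_comp, (hst _).2 ⟨z, rfl⟩]; exact hy
    · intro z _ z' _ h
      exact Par.gl_inj (mul_left_cancel h)
    · intro x hx
      simp only [Finset.mem_filter, Finset.mem_univ, true_and] at hx
      obtain ⟨z, hz⟩ := (hst (y⁻¹ * x)).1 (by
        rw [Units.val_mul, show (y⁻¹).1 * x.1 = (y⁻¹).1 ∘ₗ x.1 from rfl, Submodule.map_comp, hx, ← hy, ← Submodule.map_comp,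
          show (y⁻¹).1 ∘ₗ y.1 = (y⁻¹ * y : G).1 from rfl, inv_mul_cancel]
        exact Submodule.map_id _)
      exact ⟨z, by simp, by rw [hz, mul_inv_cancel_left]⟩
  have hTd : ∀ U : Submodule F (A × B), finrank F U ≠ finrank F A → T U = 0 := by
    intro U hU
    refine Finset.sum_eq_zero fun g _ => ?_
    rw [show sub ρ U ((g⁻¹ : G) : End F (A × B)) = 0 from ?_]
    · simp
    · rw [sub]; split_ifs
      · exact hρ _ _ hU
      · rfl
  have h2 : ∑ x : G, T (A0.map x.1) = ∑ U, (Nat.card (Par A B F) : ℂ) * T U := by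
    rw [← Finset.sum_fiberwise Finset.univ (fun x : G => A0.map x.1)]
    refine Finset.sum_congr rfl fun U _ => ?_
    rw [Finset.sum_congr rfl (g := fun _ => T U) (by intro x hx; rw [(Finset.mem_filter.1 hx).2]), Finset.sum_const, nsmul_eq_mul]
    by_cases hU : finrank F U = finrank F A
    · rw [hcard U hU]
    · rw [hTd U hU]; simp
  simp only [hT] at h2
  rw [Finset.sum_const, nsmul_eq_mul, Finset.card_univ, ← Nat.card_eq_fintype_card, ← Finset.mul_sum] at h2
  have hG : (Nat.card G : ℂ) ≠ 0 := by simp [Nat.card_pos.ne']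
  have hP : (Nat.card (Par A B F) : ℂ) ≠ 0 := by simp [Nat.card_pos.ne']
  rw [h1, ← hT0]
  field_simp
  exact (mul_comm _ _).trans h2.symm

theorem adjoint (φ ρ Y : CF F) (hρ : Deg ρ (finrank F A)) :
    IP (finrank F A + finrank F B) φ (mulC ρ Y) = IP (finrank F B) (adj A ρ φ) Y := by
  rw [IP_eq (V := A × B) φ (mulC ρ Y) (Module.finrank_prod), ip_par φ ρ Y hρ, IP_eq (V := B) _ _ rfl]
  have hc : Nat.card (Par A B F) = Nat.card (End F A)ˣ * (Nat.card (B →ₗ[F] A) * Nat.card (End F B)ˣ) := by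
    rw [Nat.card_congr parE, Nat.card_prod, Nat.card_prod]
  rw [hc]
  have h1 : ∑ x : Par A B F, φ.f _ (Par.gl x : End F (A × B)) *
      ρ.f A ((x.a⁻¹ : (End F A)ˣ) : End F A) * Y.f B ((x.d⁻¹ : (End F B)ˣ) : End F B) =
      ∑ h : (End F B)ˣ, (∑ g : (End F A)ˣ, ∑ ν : B →ₗ[F] A, ρ.f A ((g⁻¹ : (End F A)ˣ) : End F A) * φ.f (A × B) (bl (g : End F A) ν (h : End F B))) * Y.f B ((h⁻¹ : (End F B)ˣ) : End F B) := by
    rw [← Equiv.sum_comp parE.symm, Fintype.sum_prod_type]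
    simp only [Fintype.sum_prod_type, Finset.sum_mul]
    rw [Finset.sum_comm (γ := (End F B)ˣ)]
    refine Finset.sum_congr rfl fun g _ => ?_
    rw [Finset.sum_comm]
    refine Finset.sum_congr rfl fun h _ => Finset.sum_congr rfl fun ν _ => ?_
    rw [Par.gl_val]
    simp only [parE, Equiv.coe_fn_symm_mk]
    ring
  rw [h1, Finset.mul_sum, Finset.mul_sum]
  refine Finset.sum_congr rfl fun h _ => ?_
  rw [adj_f]
  push_cast
  rw [mul_inv, mul_inv, mul_inv]
  ring

theorem IP_nat {n m b : ℕ} (h : n = m + b) (χ : Irr (GL (Fin n) F)) (ρ : Irr (GL (Fin m) F)) (β : Irr (GL (Fin b) F)) :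
    ∃ k : ℕ, IP n (ofC n χ.1) (mulC (ofC m ρ.1) (ofC b β.1)) = k := by
  let A := Fin m → F
  let B := Fin b → F
  have hn : finrank F (A × B) = n := by rw [Module.finrank_prod]; simp [A, B, h]
  let e : (Fin n → F) ≃ₗ[F] (A × B) := LinearEquiv.ofFinrankEq _ _ (by rw [hn]; simp)
  obtain ⟨k, hk⟩ := irr_avg3_nat χ ρ β ((glE e).symm.toMonoidHom.comp (Par.gl : Par A B F →* _))
    ((glE (LinearEquiv.refl F A)).symm.toMonoidHom.comp Par.ha) ((glE (LinearEquiv.refl F B)).symm.toMonoidHom.comp Par.hd)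
  refine ⟨k, ?_⟩
  rw [← hk, IP_eq (V := A × B) _ _ hn, ip_par _ _ _ (by simpa [A] using ofC_deg)]
  congr 1
  refine Finset.sum_congr rfl fun x _ => ?_
  rw [ofC_glE (irr_conj χ) e, ofC_glE (irr_conj ρ) (LinearEquiv.refl F A), ofC_glE (irr_conj β) (LinearEquiv.refl F B)]
  rw [map_inv, map_inv]
  rfl

end CT
end

noncomputable section
set_option linter.all false
namespace CT
open Module
attribute [local instance] Classical.propDecidable
variable {F : Type} [Field F] [Fintype F]
variable {V A B : Type} [AddCommGroup V] [Module F V] [Finite V]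
  [AddCommGroup A] [Module F A] [Finite A] [AddCommGroup B] [Module F B] [Finite B]

variable (F) in
structure Cu where
  m : ℕ
  χ : Irr (GL (Fin m) F)
  pos : 0 < m
  cusp : Cusp (ofC m χ.1)

def Cu.cf (ρ : Cu F) : CF F := ofC ρ.m ρ.χ.1

def oneC : CF F where
  f V _ _ _ g := if finrank F V = 0 then 1 else 0
  inv e g h _ := by rw [e.finrank_eq]

def R : List (Cu F) → CF F
  | [] => oneC
  | ρ :: l => mulC ρ.cf (R l)

def dg : List (Cu F) → ℕ
  | [] => 0
  | ρ :: l => ρ.m + dg l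

def dels (ρ : Cu F) : List (Cu F) → List (List (Cu F))
  | [] => []
  | α :: l => (if α = ρ then [l] else []) ++ (dels ρ l).map (α :: ·)

lemma sum_list {ι κ : Type} [Fintype ι] (a : ι → ℂ) (b : κ → ι → ℂ) (L : List κ) :
    ∑ i, a i * (L.map fun k => b k i).sum = (L.map fun k => ∑ i, a i * b k i).sum := by
  induction L with
  | nil => simp
  | cons k L ih => simp [mul_add, Finset.sum_add_distrib, ih]

lemma quo_list (X : CF F) {κ : Type} (Y : κ → CF F) (L : List κ)
    (h : ∀ (V : Type) [AddCommGroup V] [Module F V] [Finite V] (g : End F V), X.f V g = (L.map fun k => (Y k).f V g).sum)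
    (U : Submodule F V) (g : End F V) : quo X U g = (L.map fun k => quo (Y k) U g).sum := by
  by_cases hs : ∀ x ∈ U, g x ∈ U
  · simp only [quo, dif_pos hs, h]
  · simp [quo, dif_neg hs]

lemma finrank_fin (n : ℕ) : finrank F (Fin n → F) = n := by simp

lemma pair (ρ α : Cu F) : (Nat.card (End F (Fin ρ.m → F))ˣ : ℂ)⁻¹ * ∑ g : (End F (Fin ρ.m → F))ˣ,
    ρ.cf.f _ ((g⁻¹ : (End F (Fin ρ.m → F))ˣ) : End F (Fin ρ.m → F)) * α.cf.f _ (g : End F (Fin ρ.m → F)) =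
      if α = ρ then 1 else 0 := by
  by_cases hm : α.m = ρ.m
  · have h1 := IP_eq (V := Fin ρ.m → F) α.cf ρ.cf (finrank_fin _)
    simp only [mul_comm (ρ.cf.f _ _)]
    rw [← h1]
    obtain ⟨m, χ, p, c⟩ := ρ
    obtain ⟨m', χ', p', c'⟩ := α
    simp only at hm
    subst hm
    rw [IP, Cu.cf, Cu.cf, res_ofC (irr_conj _), res_ofC (irr_conj _), irr_ip]
    simp
  · rw [if_neg (fun h : α = ρ => hm (by rw [h])), Finset.sum_eq_zero, mul_zero]
    intro g _
    rw [Cu.cf, Cu.cf, ofC_deg (n := α.m) _ _ (by rw [finrank_fin]; exact fun h => hm h.symm), mul_zero]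

lemma finrank_pos_prod (ρ : Cu F) : finrank F ((Fin ρ.m → F) × B) ≠ 0 := by
  rw [Module.finrank_prod, finrank_fin]
  have := ρ.pos
  omega

theorem adj_R (ρ : Cu F) (l : List (Cu F)) : ∀ (B : Type) [AddCommGroup B] [Module F B] [Finite B] (h : End F B),
    (adj (Fin ρ.m → F) ρ.cf (R l)).f B h = ((dels ρ l).map fun l' => (R l').f B h).sum := by
  induction l with
  | nil =>
    intro B _ _ _ h
    rw [adj_f]
    simp [R, oneC, dels, -finrank_prod, finrank_pos_prod]
  | cons α l ih =>
    intro B _ _ _ h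
    have : Nontrivial (Fin ρ.m → F) := by
      have : Nonempty (Fin ρ.m) := ⟨⟨0, ρ.pos⟩⟩
      infer_instance
    rw [R, adj_mul (ρ := ρ.cf) (α := α.cf) ρ.cusp α.cusp, pair, mulC_f]
    have h1 : ∑ U : Submodule F B, sub α.cf U h * quo (adj (Fin ρ.m → F) ρ.cf (R l)) U h =
        ((dels ρ l).map fun l' => (R (α :: l')).f B h).sum := by
      simp only [quo_list _ _ _ ih]
      rw [sum_list]
      rfl
    rw [h1, dels]
    by_cases he : α = ρ
    · simp [he, Function.comp_def]
    · simp [he, Function.comp_def]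

def mm : List (Cu F) → Multiset (Cu F) → ℂ
  | [], s => if s = 0 then 1 else 0
  | ρ :: l, s => (s.count ρ : ℂ) * mm l (s.erase ρ)

lemma dels_spec (ρ : Cu F) (l : List (Cu F)) :
    (dels ρ l).map (fun l' : List (Cu F) => Multiset.ofList l') =
      List.replicate ((l : Multiset (Cu F)).count ρ) ((l : Multiset (Cu F)).erase ρ) := by
  induction l with
  | nil => simp [dels]
  | cons α l ih =>
    have h1 : ∀ L : List (List (Cu F)), (L.map (α :: ·)).map (fun l' : List (Cu F) => Multiset.ofList l') =
        (L.map (fun l' : List (Cu F) => Multiset.ofList l')).map (α ::ₘ ·) := by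
      intro L; simp
    rw [dels, List.map_append, h1, ih, List.map_replicate]
    by_cases he : α = ρ
    · subst he
      simp only [if_true]
      rw [← Multiset.cons_coe, Multiset.count_cons_self, Multiset.erase_cons_head, List.replicate_succ]
      simp only [List.map_cons, List.map_nil, List.singleton_append]
      congr 1
      by_cases hc : α ∈ l
      · rw [Multiset.cons_erase (by simpa using hc)]
      · rw [Multiset.count_eq_zero_of_notMem (by simpa using hc)]; rfl
    · simp only [if_neg he]
      rw [← Multiset.cons_coe, Multiset.count_cons_of_ne (Ne.symm he), Multiset.erase_cons_tail _ he]
      rfl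

lemma R_zero (l : List (Cu F)) (g : End F (Fin 0 → F)) : (R l).f (Fin 0 → F) g = if (l : Multiset (Cu F)) = 0 then 1 else 0 := by
  cases l with
  | nil => simp [R, oneC]
  | cons α l =>
    rw [R, mulC_f, if_neg (by simp)]
    refine Finset.sum_eq_zero fun U _ => ?_
    rw [sub]
    have h0 : finrank F U = 0 := by
      have := Submodule.finrank_le U
      rw [finrank_fin] at this
      omega
    split_ifs
    · rw [Cu.cf, ofC_deg _ _ (by rw [h0]; exact α.pos.ne), zero_mul]
    · simp

instance ss0 : Subsingleton (GL (Fin 0) F) := ⟨fun a b => Units.ext (Subsingleton.elim _ _)⟩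

lemma ip_triv {G : Type} [Group G] [Fintype G] [Subsingleton G] (f h : G → ℂ) : ip f h = f 1 * h 1 := by
  have : Unique G := ⟨⟨1⟩, fun _ => Subsingleton.elim _ _⟩
  rw [ip, Nat.card_unique, Fintype.sum_unique]
  have : (default : G) = 1 := Subsingleton.elim _ _
  simp [this]

lemma IP_triv (φ ψ : CF F) : IP 0 φ ψ = res 0 φ 1 * res 0 ψ 1 := ip_triv _ _

lemma IP_list (n : ℕ) (X Z : CF F) {κ : Type} (Y : κ → CF F) (L : List κ)
    (h : ∀ (V : Type) [AddCommGroup V] [Module F V] [Finite V] (g : End F V), X.f V g = (L.map fun k => (Y k).f V g).sum) :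
    IP n X Z = (L.map fun k => IP n (Y k) Z).sum := by
  have h1 : ∀ M, res n X M = (L.map fun k => res n (Y k) M).sum := fun M => h _ _
  simp only [IP, ip, h1]
  have := sum_list (fun g : GL (Fin n) F => res n Z g⁻¹) (fun k g => res n (Y k) g) L
  simp only [mul_comm (res n Z _)] at this
  rw [this, ← List.sum_map_mul_left]

theorem IP_R (l' : List (Cu F)) : ∀ l : List (Cu F), IP (dg l') (R l) (R l') = mm l' (l : Multiset (Cu F)) := by
  induction l' with
  | nil =>
    intro l
    show IP 0 _ _ = _
    rw [IP_triv, res, res, R_zero, R_zero]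
    simp [mm]
  | cons ρ l' ih =>
    intro l
    have h1 := adjoint (A := Fin ρ.m → F) (B := Fin (dg l') → F) (R l) ρ.cf (R l') (by
      rw [finrank_fin]; exact ofC_deg)
    rw [finrank_fin, finrank_fin] at h1
    rw [dg, R, h1, IP_list _ _ _ _ _ (adj_R ρ l)]
    simp only [ih]
    have h2 : (dels ρ l).map (fun k : List (Cu F) => mm l' (Multiset.ofList k)) =
      ((dels ρ l).map (fun k : List (Cu F) => Multiset.ofList k)).map (mm l') := by simp
    rw [h2, dels_spec, List.map_replicate, List.sum_replicate, nsmul_eq_mul]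
    rfl

lemma mm_ne (l : List (Cu F)) : ∀ s, mm l s ≠ 0 → s = (l : Multiset (Cu F)) := by
  induction l with
  | nil => intro s h; simpa [mm] using h
  | cons ρ l ih =>
    intro s h
    rw [mm] at h
    have h1 := ih _ (right_ne_zero_of_mul h)
    have h2 : ρ ∈ s := by
      by_contra hc
      exact left_ne_zero_of_mul h (by rw [Multiset.count_eq_zero_of_notMem hc]; simp)
    rw [← Multiset.cons_coe, ← h1, Multiset.cons_erase h2]

lemma ip_expand {G : Type} [Group G] [Fintype G] (f h : G → ℂ) (hh : ∀ g k, h (k * g * k⁻¹) = h g) :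
    ip f h = ∑ X : Irr G, ip h X.1 * ip f X.1 := by
  conv_lhs => rw [expand h hh]
  rw [ip_sum_right]

lemma mul_expand (ρ : Cu F) (l : List (Cu F)) (χ : Irr (GL (Fin (dg (ρ :: l))) F)) :
    ip (res _ (R (ρ :: l))) χ.1 = ∑ β : Irr (GL (Fin (dg l)) F), ip (res _ (R l)) β.1 *
      IP (dg (ρ :: l)) (ofC _ χ.1) (mulC ρ.cf (ofC _ β.1)) := by
  have key : ∀ Y : CF F, IP (dg (ρ :: l)) (ofC _ χ.1) (mulC ρ.cf Y) =
      ip (res (dg l) (adj (Fin ρ.m → F) ρ.cf (ofC _ χ.1))) (res (dg l) Y) := fun Y => by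
    have h1 := adjoint (A := Fin ρ.m → F) (B := Fin (dg l) → F) (ofC _ χ.1) ρ.cf Y (by
      rw [finrank_fin]; exact ofC_deg)
    rw [finrank_fin, finrank_fin] at h1
    exact h1
  have h1 : ip (res _ (R (ρ :: l))) χ.1 = IP (dg (ρ :: l)) (ofC _ χ.1) (mulC ρ.cf (R l)) := by
    rw [IP, res_ofC (irr_conj χ), ip_comm]
    rfl
  rw [h1, key, ip_expand _ _ (res_class _ _)]
  refine Finset.sum_congr rfl fun β _ => ?_
  have h2 := key (ofC _ β.1)
  rw [res_ofC (irr_conj β)] at h2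
  rw [← h2]

theorem mul_nat (l : List (Cu F)) : ∀ χ : Irr (GL (Fin (dg l)) F), ∃ k : ℕ, ip (res _ (R l)) χ.1 = k := by
  induction l with
  | nil =>
    intro χ
    change Irr (GL (Fin 0) F) at χ
    obtain ⟨d, hd, _⟩ := irr_one χ
    refine ⟨d, ?_⟩
    show ip (res 0 (R [])) χ.1 = _
    rw [ip_triv, res, R_zero, hd]
    simp
  | cons ρ l ih =>
    intro χ
    choose k hk using ih
    choose c hc using fun β => IP_nat (n := dg (ρ :: l)) rfl χ ρ.χ β
    refine ⟨∑ β, k β * c β, ?_⟩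
    rw [mul_expand]
    push_cast
    refine Finset.sum_congr rfl fun β _ => ?_
    rw [hk, ← hc]
    rfl

/-- multiplicity -/
def mu (n : ℕ) (l : List (Cu F)) (χ : Irr (GL (Fin n) F)) : ℂ := ip (res n (R l)) χ.1

lemma mu_nat {n : ℕ} {l : List (Cu F)} (h : dg l = n) (χ : Irr (GL (Fin n) F)) : ∃ k : ℕ, mu n l χ = k := by
  subst h; exact mul_nat l χ

lemma IP_mu {n : ℕ} (l l' : List (Cu F)) : IP n (R l) (R l') = ∑ χ : Irr (GL (Fin n) F), mu n l χ * mu n l' χ := by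
  rw [IP, ip_expand _ _ (res_class _ _)]
  exact Finset.sum_congr rfl fun χ _ => mul_comm _ _

lemma disj {n : ℕ} {l l' : List (Cu F)} (h : dg l = n) (h' : dg l' = n)
    (hne : (l : Multiset (Cu F)) ≠ l') (χ : Irr (GL (Fin n) F)) : mu n l χ = 0 ∨ mu n l' χ = 0 := by
  have h0 : IP n (R l) (R l') = 0 := by
    subst h'
    rw [IP_R]
    by_contra hc
    exact hne (mm_ne _ _ hc)
  choose k hk using mu_nat h
  choose k' hk' using mu_nat h'
  rw [IP_mu] at h0
  simp only [hk, hk'] at h0 ⊢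
  have h1 : ∑ χ, k χ * k' χ = 0 := by exact_mod_cast h0
  rw [Finset.sum_eq_zero_iff] at h1
  have := h1 χ (Finset.mem_univ _)
  rcases Nat.mul_eq_zero.1 this with h | h <;> simp [h]

lemma perm_mu {n : ℕ} {l l' : List (Cu F)} (h : dg l = n) (h' : dg l' = n)
    (he : (l : Multiset (Cu F)) = l') (χ : Irr (GL (Fin n) F)) : mu n l χ = mu n l' χ := by
  choose k hk using mu_nat h
  choose k' hk' using mu_nat h'
  have a1 : IP n (R l) (R l) = mm l l := by subst h; exact IP_R l l
  have a2 : IP n (R l') (R l) = mm l l := by rw [he]; subst h; exact IP_R l l'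
  have a3 : IP n (R l) (R l') = mm l' l' := by rw [← he]; subst h'; rw [← IP_R]
  have a4 : IP n (R l') (R l') = mm l' l' := by subst h'; exact IP_R l' l'
  have a5 : IP n (R l') (R l) = IP n (R l) (R l') := ip_comm _ _
  have h0 : IP n (R l) (R l) - IP n (R l') (R l) - IP n (R l) (R l') + IP n (R l') (R l') = 0 := by
    rw [a1, a4, ← a2, ← a3, a5]; ring
  simp only [IP_mu, ← Finset.sum_sub_distrib, ← Finset.sum_add_distrib, hk, hk'] at h0
  have h1 : ∑ χ, ((k χ : ℤ) - k' χ) ^ 2 = 0 := by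
    have : ((∑ χ, ((k χ : ℤ) - k' χ) ^ 2 : ℤ) : ℂ) = 0 := by
      rw [← h0]; push_cast
      exact Finset.sum_congr rfl fun χ _ => by ring
    exact_mod_cast this
  rw [Finset.sum_eq_zero_iff_of_nonneg (fun _ _ => sq_nonneg _)] at h1
  have := h1 χ (Finset.mem_univ _)
  have h2 : (k χ : ℤ) = k' χ := by
    have := pow_eq_zero_iff (two_ne_zero) |>.1 this
    omega
  rw [hk, hk']
  exact_mod_cast h2

end CT
end

noncomputable section
set_option linter.all false
namespace CT
open Module
attribute [local instance] Classical.propDecidable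
variable {F : Type} [Field F] [Fintype F]
variable {V A B D C : Type} [AddCommGroup V] [Module F V] [Finite V]
  [AddCommGroup A] [Module F A] [Finite A] [AddCommGroup B] [Module F B] [Finite B]
  [AddCommGroup D] [Module F D] [Finite D] [AddCommGroup C] [Module F C] [Finite C]

lemma not_unit_mul {R : Type} [Ring R] {g u : R} (hu : IsUnit u) (hg : ¬ IsUnit g) : ¬ IsUnit (g * u) := by
  obtain ⟨u, rfl⟩ := hu
  rwa [Units.isUnit_mul_units]

def uhom (i : D →ₗ[F] V) (p : V →ₗ[F] C) (hpi : ∀ x, p (i x) = 0) :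
    Multiplicative (C →ₗ[F] D) →* (End F V)ˣ := MonoidHom.toHomUnits
  { toFun := fun ν => 1 + i ∘ₗ (Multiplicative.toAdd ν) ∘ₗ p
    map_one' := by refine LinearMap.ext fun x => ?_; simp
    map_mul' := fun μ ν => by
      refine LinearMap.ext fun x => ?_
      simp [hpi]
      abel }

lemma uhom_val (i : D →ₗ[F] V) (p : V →ₗ[F] C) (hpi : ∀ x, p (i x) = 0) (ν : C →ₗ[F] D) :
  (uhom i p hpi (Multiplicative.ofAdd ν) : End F V) = 1 + i ∘ₗ ν ∘ₗ p := rfl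

lemma kill1 {n : ℕ} (χ : Irr (GL (Fin n) F)) (hV : finrank F V = n) (i : D →ₗ[F] V) (p : V →ₗ[F] C) (hpi : ∀ x, p (i x) = 0)
    (h : ∑ ν : C →ₗ[F] D, (ofC n χ.1).f V (1 + i ∘ₗ ν ∘ₗ p) = 0) (g : End F V) :
    ∑ ν : C →ₗ[F] D, (ofC n χ.1).f V (g * (1 + i ∘ₗ ν ∘ₗ p)) = 0 := by
  by_cases hg : IsUnit g
  · obtain ⟨g, rfl⟩ := hg
    let e : (Fin n → F) ≃ₗ[F] V := LinearEquiv.ofFinrankEq _ _ (by rw [hV]; simp)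
    let I : Multiplicative (C →ₗ[F] D) →* GL (Fin n) F := ((glE e).symm.toMonoidHom).comp (uhom i p hpi)
    have key : ∀ (g : (End F V)ˣ) (ν : C →ₗ[F] D), (ofC n χ.1).f V (g * (1 + i ∘ₗ ν ∘ₗ p)) =
        χ.1 ((glE e).symm g * I (Multiplicative.ofAdd ν)) := fun g ν => by
      rw [← uhom_val i p hpi, ← Units.val_mul, ofC_glE (irr_conj χ) e, map_mul]
      rfl
    simp only [key]
    have := irr_avg_zero χ I 1 (by
      rw [← h]
      refine (Fintype.sum_equiv Multiplicative.ofAdd _ _ fun ν => ?_).symm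
      have := key 1 ν
      rw [Units.val_one, one_mul, map_one, one_mul] at this
      rw [this]; simp) ((glE e).symm g)
    rw [← this]
    exact Fintype.sum_equiv Multiplicative.ofAdd _ _ fun ν => by simp
  · refine Finset.sum_eq_zero fun ν _ => ofC_nu _ (not_unit_mul ?_ hg)
    rw [← uhom_val i p hpi]
    exact Units.isUnit _

def PP (n : ℕ) (χ : Irr (GL (Fin n) F)) (a : ℕ) : Prop :=
  ∑ ν : (Fin (n - a) → F) →ₗ[F] (Fin a → F), (ofC n χ.1).f _ (bl 1 ν 1) ≠ 0

lemma kill {n a : ℕ} (χ : Irr (GL (Fin n) F)) (hV : finrank F V = n) (hD : finrank F D = a) (hP : ¬ PP n χ a)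
    (i : D →ₗ[F] V) (p : V →ₗ[F] C) (hi : Function.Injective i) (hp : Function.Surjective p)
    (hr : LinearMap.range i = LinearMap.ker p) (g : End F V) :
    ∑ ν : C →ₗ[F] D, (ofC n χ.1).f V (g * (1 + i ∘ₗ ν ∘ₗ p)) = 0 := by
  have hpi : ∀ x, p (i x) = 0 := fun x => by
    rw [← LinearMap.mem_ker, ← hr]; exact ⟨x, rfl⟩
  refine kill1 χ hV i p hpi ?_ g
  rw [PP, not_not] at hP
  rw [← hP]
  have hC : finrank F C = n - a := by
    have := p.finrank_range_add_finrank_ker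
    rw [← hr, LinearMap.finrank_range_of_inj hi, LinearMap.range_eq_top.2 hp, finrank_top] at this
    omega
  let eD : D ≃ₗ[F] (Fin a → F) := LinearEquiv.ofFinrankEq _ _ (by rw [hD]; simp)
  let eC : C ≃ₗ[F] (Fin (n - a) → F) := LinearEquiv.ofFinrankEq _ _ (by rw [hC]; simp)
  obtain ⟨r, hr'⟩ := LinearMap.exists_leftInverse_of_injective i (LinearMap.ker_eq_bot.2 hi)
  have hri : ∀ x, r (i x) = x := fun x => LinearMap.congr_fun hr' x
  let e : V ≃ₗ[F] (Fin a → F) × (Fin (n - a) → F) := LinearEquiv.ofBijective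
    ((eD.toLinearMap ∘ₗ r).prod (eC.toLinearMap ∘ₗ p)) ⟨by
      rw [← LinearMap.ker_eq_bot, LinearMap.ker_eq_bot']
      intro x hx
      have h1 : eD (r x) = 0 := congrArg Prod.fst hx
      have h2 : eC (p x) = 0 := congrArg Prod.snd hx
      have h3 : x ∈ LinearMap.range i := by
        rw [hr, LinearMap.mem_ker]; simpa using h2
      obtain ⟨y, rfl⟩ := h3
      rw [hri] at h1
      have : y = 0 := by simpa using h1
      rw [this, map_zero], fun ⟨y, z⟩ => by
      obtain ⟨t, ht⟩ := hp (eC.symm z)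
      refine ⟨i (eD.symm y) + t - i (r t), ?_⟩
      ext <;> simp [hri, hpi, ht]⟩
  refine Fintype.sum_equiv (LinearEquiv.arrowCongr eC eD).toEquiv _ _ fun ν => ?_
  refine CF.inv _ e _ _ fun x => ?_
  have he : ∀ y, e y = (eD (r y), eC (p y)) := fun y => rfl
  simp only [he]
  ext <;> simp [hri, hpi, LinearEquiv.arrowCongr_apply]

variable (B) in
def dl (φ : CF F) : CF F where
  f V _ _ _ g := ∑ ν : B →ₗ[F] V, φ.f (V × B) (bl g ν 1)
  inv {V V'} _ _ _ _ _ _ e h h' hh := by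
    refine Fintype.sum_equiv (LinearEquiv.arrowCongr (LinearEquiv.refl F B) e).toEquiv _ _ fun ν => ?_
    refine φ.inv (e.prodCongr (LinearEquiv.refl F B)) _ _ fun x => ?_
    ext <;> simp [hh]

lemma dl_f (φ : CF F) (g : End F V) : (dl B φ).f V g = ∑ ν : B →ₗ[F] V, φ.f (V × B) (bl g ν 1) := rfl

lemma dl_cusp {n a d : ℕ} (χ : Irr (GL (Fin n) F)) (hV : finrank F (V × B) = n) (U : Submodule F V)
    (hP : ¬ PP n χ (finrank F U)) (g : End F V) :
    ∑ μ : (V ⧸ U) →ₗ[F] U, (dl B (ofC n χ.1)).f V (g * (1 + U.subtype ∘ₗ μ ∘ₗ U.mkQ)) = 0 := by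
  have hk := fun ν : B →ₗ[F] V => kill (V := V × B) (D := U) (C := (V ⧸ U) × B) χ hV rfl hP
    (LinearMap.inl F V B ∘ₗ U.subtype) (U.mkQ.prodMap LinearMap.id)
    (LinearMap.inl_injective.comp Subtype.val_injective)
    (U.mkQ_surjective.prodMap Function.surjective_id) (by
      ext ⟨x, y⟩
      simp only [LinearMap.mem_range, LinearMap.mem_ker]
      constructor
      · rintro ⟨t, ht⟩
        simp at ht
        simp [← ht.1, ← ht.2]
      · intro h
        simp at h
        exact ⟨⟨x, h.1⟩, by simp [h.2]⟩) (bl g ν 1)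
  have h1 : ∑ ν : B →ₗ[F] V, ∑ κ : B →ₗ[F] U, ∑ μ : (V ⧸ U) →ₗ[F] U,
     (ofC n χ.1).f (V × B) (bl (g * (1 + U.subtype ∘ₗ μ ∘ₗ U.mkQ)) (ν + g ∘ₗ U.subtype ∘ₗ κ) 1) = 0 := by
    refine Finset.sum_eq_zero fun ν _ => ?_
    rw [← hk ν, ← Fintype.sum_prod_type']
    refine Fintype.sum_equiv ((Equiv.prodComm _ _).trans (LinearMap.coprodEquiv F).toEquiv) _ _ fun x => ?_
    refine CF.congr_f _ fun t => ?_
    ext <;> simp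
    abel
  rw [Finset.sum_comm] at h1
  have h2 : ∀ κ : B →ₗ[F] U, ∑ ν : B →ₗ[F] V, ∑ μ : (V ⧸ U) →ₗ[F] U,
     (ofC n χ.1).f (V × B) (bl (g * (1 + U.subtype ∘ₗ μ ∘ₗ U.mkQ)) (ν + g ∘ₗ U.subtype ∘ₗ κ) 1) =
      ∑ μ : (V ⧸ U) →ₗ[F] U, (dl B (ofC n χ.1)).f V (g * (1 + U.subtype ∘ₗ μ ∘ₗ U.mkQ)) := fun κ => by
    rw [Finset.sum_comm]
    refine Finset.sum_congr rfl fun μ _ => ?_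
    rw [dl_f]
    exact Fintype.sum_equiv (Equiv.addRight (g ∘ₗ U.subtype ∘ₗ κ)) _ _ fun ν => rfl
  simp only [h2, Finset.sum_const, nsmul_eq_mul] at h1
  exact (mul_eq_zero.1 h1).resolve_left (by simp)

lemma mul_irr {G : Type} [Group G] [Fintype G] (X : Irr G) (f : G → ℂ) (hf : ∀ g h, f (h * g * h⁻¹) = f g) (h0 : ip f X.1 ≠ 0) :
    ∃ c : ℂ, ∀ y, X.1 y = c * ∑ x, X.1 x⁻¹ * f (x * y) := by
  have h1 : ∀ y, ∑ x, X.1 x⁻¹ * f (x * y) = ((∑ g, f g⁻¹ * X.1 g) / X.1 1) * X.1 y := fun y => by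
    rw [← conv_irr X (fun g => f g⁻¹) (fun g h => by
      rw [← hf g⁻¹ h]; congr 1; group)]
    refine Fintype.sum_equiv ((Equiv.inv G).trans (Equiv.mulRight y⁻¹)) _ _ fun x => ?_
    simp only [Equiv.trans_apply, Equiv.inv_apply, Equiv.coe_mulRight]
    rw [mul_comm, inv_mul_cancel_right, ← hf (x * y) y]
    congr 2
    group
  have h2 : (∑ g, f g⁻¹ * X.1 g) / X.1 1 ≠ 0 := by
    obtain ⟨d, hd, hd0⟩ := irr_one X
    refine div_ne_zero (fun h => h0 ?_) (by rw [hd]; exact_mod_cast hd0)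
    rw [ip, ← Equiv.sum_comp (Equiv.inv G)]
    simp only [Equiv.inv_apply, inv_inv]
    rw [h, mul_zero]
  exact ⟨_⁻¹, fun y => by rw [h1, ← mul_assoc, inv_mul_cancel₀ h2, one_mul]⟩

lemma cusp_of {n a : ℕ} (χ : Irr (GL (Fin n) F)) (han : a ≤ n) (hmin : ∀ d, 0 < d → d < a → ¬ PP n χ d)
    (α : Irr (GL (Fin a) F)) (h : ip (res a (dl (Fin (n - a) → F) (ofC n χ.1))) α.1 ≠ 0) : Cusp (ofC a α.1) := by
  intro V _ _ _ D hD hD' g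
  by_cases hV : finrank F V = a
  swap
  · exact Finset.sum_eq_zero fun ν _ => ofC_deg _ _ hV
  have hpi : ∀ x, D.mkQ (D.subtype x) = 0 := by simp
  by_cases hg : IsUnit g
  swap
  · refine Finset.sum_eq_zero fun ν _ => ofC_nu _ (not_unit_mul ?_ hg)
    rw [← uhom_val D.subtype D.mkQ hpi]
    exact Units.isUnit _
  obtain ⟨g, rfl⟩ := hg
  obtain ⟨c, hc⟩ := mul_irr α _ (res_class _ _) h
  let e : (Fin a → F) ≃ₗ[F] V := LinearEquiv.ofFinrankEq _ _ (by rw [hV]; simp)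
  have key : ∀ ν : (V ⧸ D) →ₗ[F] D, (ofC a α.1).f V (g * (1 + D.subtype ∘ₗ ν ∘ₗ D.mkQ)) =
      c * ∑ x : GL (Fin a) F, α.1 x⁻¹ * (dl (Fin (n - a) → F) (ofC n χ.1)).f V (((glE e x).1 * g.1) * (1 + D.subtype ∘ₗ ν ∘ₗ D.mkQ)) := fun ν => by
    rw [← uhom_val D.subtype D.mkQ hpi, ← Units.val_mul, ofC_glE (irr_conj α) e, hc]
    congr 1
    refine Finset.sum_congr rfl fun x _ => ?_
    congr 1
    refine res_eq _ e _ _ fun t => ?_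
    rw [glE_apply]
    simp [mul_assoc]
  simp only [key]
  rw [← Finset.mul_sum, Finset.sum_comm, Finset.sum_eq_zero, mul_zero]
  intro x _
  rw [← Finset.mul_sum, dl_cusp (a := a) (d := a), mul_zero]
  · rw [finrank_prod, hV]; simp; omega
  · apply hmin
    · rw [Nat.pos_iff_ne_zero]; exact fun h => hD (Submodule.finrank_eq_zero.1 h)
    · rw [← hV]; exact Submodule.finrank_lt hD'

lemma PP_top {n : ℕ} (χ : Irr (GL (Fin n) F)) : PP n χ n := by
  have hss : Subsingleton (Fin (n - n) → F) := by rw [Nat.sub_self]; infer_instance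
  have hu : Unique ((Fin (n - n) → F) →ₗ[F] (Fin n → F)) := ⟨⟨0⟩, fun f => LinearMap.ext fun x => by
    rw [Subsingleton.elim x 0]; simp⟩
  rw [PP, Fintype.sum_unique]
  have : finrank F ((Fin n → F) × (Fin (n - n) → F)) = n := by simp
  let e : (Fin n → F) ≃ₗ[F] (Fin n → F) × (Fin (n - n) → F) := LinearEquiv.ofFinrankEq _ _ (by rw [this]; simp)
  have := res_eq (ofC n χ.1) e 1 (bl 1 hu.default 1) (fun x => by
    ext
    · simp [Subsingleton.elim (e x).2 0]
    · simp)
  rw [res_ofC (irr_conj χ)] at this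
  obtain ⟨d, hd, h0⟩ := irr_one χ
  refine ne_of_eq_of_ne this.symm ?_
  rw [hd]; exact_mod_cast h0

lemma exists_pair {n : ℕ} (hn : 0 < n) (χ : Irr (GL (Fin n) F)) : ∃ ρ : Cu F, ∃ b, ∃ h : ρ.m + b = n, ∃ β : Irr (GL (Fin b) F),
    IP n (ofC n χ.1) (mulC ρ.cf (ofC b β.1)) ≠ 0 := by
  have hex : ∃ a, 0 < a ∧ PP n χ a := ⟨n, hn, PP_top χ⟩
  let a := Nat.find hex
  have ha : 0 < a ∧ PP n χ a := Nat.find_spec hex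
  have han : a ≤ n := Nat.find_min' hex ⟨hn, PP_top χ⟩
  have hmin : ∀ d, 0 < d → d < a → ¬ PP n χ d := fun d h0 h1 h2 => Nat.find_min hex h1 ⟨h0, h2⟩
  have h1 : ∃ α : Irr (GL (Fin a) F), ip (res a (dl (Fin (n - a) → F) (ofC n χ.1))) α.1 ≠ 0 := by
    by_contra hc
    push Not at hc
    have := congrFun (complete _ (res_class _ _) hc) 1
    apply ha.2
    rw [Pi.zero_apply] at this
    rw [← this]
    show _ = ∑ ν, _
    refine Finset.sum_congr rfl fun ν _ => CF.congr_f _ fun t => ?_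
    simp
  obtain ⟨α, hα⟩ := h1
  let ρ : Cu F := ⟨a, α, ha.1, cusp_of χ han hmin α hα⟩
  refine ⟨ρ, n - a, by show a + (n - a) = n; omega, ?_⟩
  have h2 : res (n - a) (adj (Fin a → F) ρ.cf (ofC n χ.1)) 1 ≠ 0 := by
    have h3 := IP_eq (V := Fin a → F) (dl (Fin (n - a) → F) (ofC n χ.1)) ρ.cf (finrank_fin a)
    have h4 : IP a (dl (Fin (n - a) → F) (ofC n χ.1)) ρ.cf ≠ 0 := by
      rw [IP, Cu.cf, res_ofC (irr_conj _)]; exact hα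
    rw [h3] at h4
    have h5 := right_ne_zero_of_mul h4
    rw [res, adj_f]
    refine mul_ne_zero (inv_ne_zero (mul_ne_zero (left_ne_zero_of_mul h4 |> fun h => by simpa using h) (by simp))) ?_
    intro h6
    apply h5
    rw [← h6]
    refine Finset.sum_congr rfl fun g _ => ?_
    rw [dl_f, Finset.sum_mul]
    refine Finset.sum_congr rfl fun ν _ => ?_
    rw [mul_comm]
    congr 1
    refine CF.congr_f _ fun t => ?_
    simp
  by_contra hc
  push Not at hc
  apply h2
  have := complete _ (res_class (n - a) (adj (Fin a → F) ρ.cf (ofC n χ.1))) (fun β => by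
    have h3 := hc β
    have h7 := adjoint (A := Fin a → F) (B := Fin (n - a) → F) (ofC n χ.1) ρ.cf (ofC (n - a) β.1) (by
      rw [finrank_fin]; exact ofC_deg)
    rw [finrank_fin, finrank_fin, Nat.add_sub_cancel' han, h3, IP, res_ofC (irr_conj β)] at h7
    exact h7.symm)
  rw [this]; rfl

theorem occurs (n : ℕ) : ∀ χ : Irr (GL (Fin n) F), ∃ l : List (Cu F), dg l = n ∧ mu n l χ ≠ 0 := by
  induction n using Nat.strong_induction_on with
  | _ n ih =>
    intro χ
    rcases Nat.eq_zero_or_pos n with rfl | hn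
    · refine ⟨[], rfl, ?_⟩
      obtain ⟨d, hd, h0⟩ := irr_one χ
      rw [mu, ip_triv, res, R_zero, hd]
      simpa using h0
    · obtain ⟨ρ, b, hb, β, hβ⟩ := exists_pair hn χ
      obtain ⟨l, hl, hm⟩ := ih b (by have := ρ.pos; omega) β
      subst hl
      have : dg (ρ :: l) = n := hb
      subst this
      refine ⟨ρ :: l, rfl, ?_⟩
      choose k hk using mul_nat l
      choose c hc using fun β => IP_nat (n := dg (ρ :: l)) rfl χ ρ.χ β
      rw [mu, mul_expand]
      have h1 : ∀ β : Irr (GL (Fin (dg l)) F), ip (res _ (R l)) β.1 * IP (dg (ρ :: l)) (ofC _ χ.1) (mulC ρ.cf (ofC _ β.1)) = ((k β * c β : ℕ) : ℂ) := fun β => by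
        rw [hk]; push_cast; rw [← hc]; rfl
      rw [Finset.sum_congr rfl fun β _ => h1 β]
      intro h0
      have h2 : ∑ β, k β * c β = 0 := by exact_mod_cast h0
      rw [Finset.sum_eq_zero_iff] at h2
      have h3 := h1 β
      rw [h2 β (Finset.mem_univ _)] at h3
      exact mul_ne_zero hm hβ (by simpa [mu] using h3)

end CT
end

noncomputable section
set_option linter.all false
namespace CT
open Module
attribute [local instance] Classical.propDecidable
variable {F : Type} [Field F] [Fintype F]

lemma irr_int {G : Type} [Group G] [Fintype G] (X : Irr G) (u : G) : IsIntegral ℤ (X.1 u) := by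
  set f := (rep X).ρ u
  have hs : f.charpoly.Splits := IsAlgClosed.splits _
  have htr : X.1 u = f.charpoly.roots.sum := by
    rw [← Module.End.trace_eq_sum_roots_charpoly_of_splits hs, ← chr_rep X]; rfl
  have hf : f ^ orderOf u = 1 := by rw [← map_pow, pow_orderOf_eq_one, map_one]
  rw [htr]
  refine IsIntegral.multiset_sum fun z hz => ?_
  have h1 := (Polynomial.mem_roots'.1 hz).2
  rw [← Module.End.hasEigenvalue_iff_isRoot_charpoly] at h1
  obtain ⟨v, hv⟩ := h1.exists_hasEigenvector
  have h2 := hv.pow_apply (orderOf u)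
  rw [hf] at h2
  have h3 : (z ^ orderOf u - 1) • v = 0 := by rw [sub_smul, ← h2]; simp
  have h4 := sub_eq_zero.1 ((smul_eq_zero.1 h3).resolve_right hv.2)
  exact IsIntegral.of_pow (orderOf_pos u) (by rw [h4]; exact isIntegral_one)

lemma int_of_rat (z : ℂ) (hz : IsIntegral ℤ z) (r : ℚ) (h : z = r) : ∃ a : ℤ, z = a := by
  have h1 : IsIntegral ℤ r := by
    rw [h] at hz
    exact (isIntegral_algHom_iff (algebraMap ℚ ℂ).toIntAlgHom (algebraMap ℚ ℂ).injective).1 hz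
  obtain ⟨a, ha⟩ := IsIntegrallyClosed.isIntegral_iff.1 h1
  exact ⟨a, by rw [h, ← ha]; simp⟩

def IsUp {n : ℕ} (M : Matrix (Fin n) (Fin n) F) : Prop := ∀ i j, j ≤ i → M i j = if i = j then 1 else 0

lemma IsUp.low {n : ℕ} {M : Matrix (Fin n) (Fin n) F} (h : IsUp M) {i j : Fin n} (hij : j < i) : M i j = 0 := by
  rw [h i j hij.le, if_neg hij.ne']
lemma IsUp.diag {n : ℕ} {M : Matrix (Fin n) (Fin n) F} (h : IsUp M) (i : Fin n) : M i i = 1 := by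
  rw [h i i le_rfl, if_pos rfl]
lemma IsUp.sub {n : ℕ} {M : Matrix (Fin n) (Fin n) F} (h : IsUp M) {i j : Fin n} (hij : j ≤ i) : (M - 1) i j = 0 := by
  rw [Matrix.sub_apply, h i j hij, Matrix.one_apply, sub_self]
lemma IsUp.sub' {n : ℕ} {M : Matrix (Fin n) (Fin n) F} {i j : Fin n} (hij : i ≠ j) : (M - 1) i j = M i j := by
  rw [Matrix.sub_apply, Matrix.one_apply_ne hij, _root_.sub_zero]

lemma IsUp.mul_eq {n : ℕ} (M N : Matrix (Fin n) (Fin n) F) : M * N = (M - 1) * (N - 1) + M + N - 1 := by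
  noncomm_ring

lemma IsUp.pr {n : ℕ} {M N : Matrix (Fin n) (Fin n) F} (h : IsUp M) (h' : IsUp N) {i j : Fin n}
    (hij : j.val ≤ i.val + 1) : (M * N) i j = M i j + N i j - (1 : Matrix (Fin n) (Fin n) F) i j := by
  rw [IsUp.mul_eq M N, Matrix.sub_apply, Matrix.add_apply, Matrix.add_apply, Matrix.mul_apply,
    Finset.sum_eq_zero, zero_add]
  intro k _
  by_cases hk : k ≤ i
  · rw [h.sub hk, zero_mul]
  · rw [h'.sub (i := k) (j := j) (by rw [not_le] at hk; rw [Fin.lt_def] at hk; rw [Fin.le_def]; omega), mul_zero]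

lemma IsUp.mul {n : ℕ} {M N : Matrix (Fin n) (Fin n) F} (h : IsUp M) (h' : IsUp N) : IsUp (M * N) := by
  intro i j hij
  rw [h.pr h' (by rw [Fin.le_def] at hij; omega), h i j hij, h' i j hij, Matrix.one_apply]
  ring

lemma IsUp.one {n : ℕ} : IsUp (1 : Matrix (Fin n) (Fin n) F) := fun i j _ => Matrix.one_apply

lemma IsUp.det {n : ℕ} {M : Matrix (Fin n) (Fin n) F} (h : IsUp M) : M.det = 1 := by
  rw [Matrix.det_of_isUpperTriangular (M := M) (fun i j hij => h.low hij)]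
  exact Finset.prod_eq_one fun i _ => h.diag i

variable (F) in
def UU (n : ℕ) : Subgroup (GL (Fin n) F) :=
  { carrier := {g | IsUp g.1}
    mul_mem' := fun h h' => IsUp.mul h h'
    one_mem' := IsUp.one
    inv_mem' := fun {x} hx => by
      let S : Submonoid (GL (Fin n) F) := ⟨⟨{g | IsUp g.1}, fun h h' => IsUp.mul h h'⟩, IsUp.one⟩
      have h1 : x ^ (orderOf x - 1) ∈ S := S.pow_mem hx _
      have h2 : x ^ (orderOf x - 1) = x⁻¹ := by
        rw [eq_inv_iff_mul_eq_one, ← pow_succ, Nat.sub_add_cancel (orderOf_pos x), pow_orderOf_eq_one]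
      rw [h2] at h1
      exact h1 }

lemma mem_UU {n : ℕ} {g : GL (Fin n) F} : g ∈ UU F n ↔ IsUp g.1 := Iff.rfl

instance (n : ℕ) : Fintype (UU F n) := Fintype.ofFinite _

def mkU {n : ℕ} (M : Matrix (Fin n) (Fin n) F) (h : IsUp M) : GL (Fin n) F :=
  Matrix.GeneralLinearGroup.mkOfDetNeZero M (by rw [h.det]; exact one_ne_zero)

lemma mkU_val {n : ℕ} (M : Matrix (Fin n) (Fin n) F) (h : IsUp M) : (mkU M h).1 = M := rfl
lemma mkU_mem {n : ℕ} (M : Matrix (Fin n) (Fin n) F) (h : IsUp M) : mkU M h ∈ UU F n := h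

variable (F) in
def JM (n : ℕ) : Matrix (Fin n) (Fin n) F :=
  Matrix.of fun i j => (if i = j then 1 else 0) + (if j.val = i.val + 1 then 1 else 0)

lemma JM_up (n : ℕ) : IsUp (JM F n) := fun i j h => by
  simp only [JM, Matrix.of_apply]
  have h1 : ¬ (j.val = i.val + 1) := by rw [Fin.le_def] at h; omega
  rw [if_neg h1, add_zero]

def JJ (n : ℕ) : GL (Fin n) F := mkU (JM F n) (JM_up n)

lemma JJ_mem (n : ℕ) : (JJ n : GL (Fin n) F) ∈ UU F n := JM_up n

def sd {m : ℕ} (M : Matrix (Fin (m+1)) (Fin (m+1)) F) (i : Fin m) : F := M i.castSucc i.succ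

lemma sd_mul {m : ℕ} {u v : GL (Fin (m+1)) F} (hu : u ∈ UU F _) (hv : v ∈ UU F _) (i : Fin m) :
    sd (u * v).1 i = sd u.1 i + sd v.1 i := by
  rw [sd, Units.val_mul, IsUp.pr hu hv (by simp), Matrix.one_apply_ne (by
    intro h; have := congrArg Fin.val h; simp at this), _root_.sub_zero]
  rfl

lemma sd_one {m : ℕ} (i : Fin m) : sd (1 : Matrix (Fin (m+1)) (Fin (m+1)) F) i = 0 := by
  rw [sd, Matrix.one_apply_ne (by intro h; have := congrArg Fin.val h; simp at this)]

lemma sd_inv {m : ℕ} {u : GL (Fin (m+1)) F} (hu : u ∈ UU F _) (i : Fin m) : sd (u⁻¹).1 i = - sd u.1 i := by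
  have := sd_mul hu (inv_mem hu) i
  rw [mul_inv_cancel, Units.val_one, sd_one] at this
  linear_combination -this

lemma sd_JJ {m : ℕ} (i : Fin m) : sd (JJ (m+1) : GL (Fin (m+1)) F).1 i = 1 := by
  show JM F (m+1) _ _ = 1
  simp only [JM, Matrix.of_apply]
  rw [if_neg (by intro h; have := congrArg Fin.val h; simp at this), if_pos (by simp), zero_add]

lemma mul_JM {m : ℕ} (y : Matrix (Fin (m+1)) (Fin (m+1)) F) (i : Fin (m+1)) :
    (y * JM F (m+1)) i 0 = y i 0 ∧ ∀ t : Fin m, (y * JM F (m+1)) i t.succ = y i t.succ + y i t.castSucc := by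
  have h : ∀ j, (y * JM F (m+1)) i j = y i j + ∑ k : Fin (m+1), if j.val = k.val + 1 then y i k else 0 := by
    intro j
    simp only [Matrix.mul_apply, JM, Matrix.of_apply, mul_add, Finset.sum_add_distrib]
    simp
  constructor
  · rw [h]; simp
  · intro t
    rw [h]
    congr 1
    rw [Finset.sum_eq_single t.castSucc]
    · simp
    · intro b _ hb
      rw [if_neg]
      intro h1
      apply hb
      ext; simp at h1 ⊢; omega
    · simp

lemma JM_mul {m : ℕ} (y : Matrix (Fin (m+1)) (Fin (m+1)) F) (j : Fin (m+1)) :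
    (JM F (m+1) * y) (Fin.last m) j = y (Fin.last m) j ∧
      ∀ t : Fin m, (JM F (m+1) * y) t.castSucc j = y t.castSucc j + y t.succ j := by
  have h : ∀ i, (JM F (m+1) * y) i j = y i j + ∑ k : Fin (m+1), if k.val = i.val + 1 then y k j else 0 := by
    intro i
    simp only [Matrix.mul_apply, JM, Matrix.of_apply, add_mul, Finset.sum_add_distrib]
    simp
  constructor
  · rw [h, Finset.sum_eq_zero, add_zero]
    intro k _
    rw [if_neg]; simp; omega
  · intro t
    rw [h]
    congr 1
    rw [Finset.sum_eq_single t.succ]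
    · simp
    · intro b _ hb
      rw [if_neg]
      intro h1
      apply hb
      ext; simp at h1 ⊢; omega
    · simp

theorem reg_conj {m : ℕ} {u : GL (Fin (m+1)) F} (hu : u ∈ UU F _) (h : ∀ i, sd u.1 i ≠ 0) :
    ∃ y, u = y * JJ (m+1) * y⁻¹ := by
  let N : Matrix (Fin (m+1)) (Fin (m+1)) F := u.1 - 1
  have hN0 : ∀ i j, j ≤ i → N i j = 0 := fun i j h => IsUp.sub hu h
  have hN1 : ∀ i j, i ≠ j → N i j = u.1 i j := fun i j h => IsUp.sub' h
  let v : ℕ → Fin (m+1) → F := fun k => N ^ k *ᵥ Pi.single (Fin.last m) 1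
  have vs : ∀ k i, v (k+1) i = ∑ j, N i j * v k j := fun k i => by
    show (N ^ (k+1) *ᵥ _) i = (N *ᵥ (N ^ k *ᵥ _)) i
    rw [Matrix.mulVec_mulVec, ← pow_succ']
  have c1 : ∀ k (i : Fin (m+1)), m < i.val + k → v k i = 0 := by
    intro k
    induction k with
    | zero => intro i hi; omega
    | succ k ih =>
      intro i hi
      rw [vs]
      refine Finset.sum_eq_zero fun j _ => ?_
      by_cases hj : j ≤ i
      · rw [hN0 _ _ hj, zero_mul]
      · rw [ih j (by rw [not_le, Fin.lt_def] at hj; omega), mul_zero]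
  have c2 : ∀ k (i : Fin (m+1)), i.val + k = m → v k i ≠ 0 := by
    intro k
    induction k with
    | zero =>
      intro i hi
      have : i = Fin.last m := by ext; simpa using hi
      simp [v, this]
    | succ k ih =>
      intro i hi
      have hlt : i.val + 1 < m + 1 := by omega
      rw [vs, Finset.sum_eq_single ⟨i.val + 1, hlt⟩]
      · refine mul_ne_zero ?_ (ih _ (by simp; omega))
        rw [hN1 _ _ (by intro h; have := congrArg Fin.val h; simp at this)]
        exact h ⟨i.val, by omega⟩
      · intro j _ hj
        by_cases hj' : j ≤ i
        · rw [hN0 _ _ hj', zero_mul]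
        · rw [c1 k j (by
            rw [not_le, Fin.lt_def] at hj'
            have : j.val ≠ i.val + 1 := fun h => hj (by ext; exact h)
            omega), mul_zero]
      · simp
  let y : Matrix (Fin (m+1)) (Fin (m+1)) F := Matrix.of fun i j => v (m - j.val) i
  have hy : y.det ≠ 0 := by
    rw [Matrix.det_of_isUpperTriangular (M := y) (fun i j hij => c1 _ i (by
      have := i.2; have := j.2; change j.val < i.val at hij; omega))]
    exact Finset.prod_ne_zero_iff.2 fun i _ => c2 _ i (by have := i.2; omega)
  let Y : GL (Fin (m+1)) F := Matrix.GeneralLinearGroup.mkOfDetNeZero y hy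
  refine ⟨Y, eq_mul_inv_of_mul_eq (Units.ext ?_)⟩
  show u.1 * y = y * JM F (m+1)
  have hu1 : u.1 = 1 + N := by simp [N]
  rw [hu1, add_mul, one_mul]
  ext i j
  have hN : (N * y) i j = v (m - j.val + 1) i := by rw [vs]; rfl
  rw [Matrix.add_apply, hN]
  induction j using Fin.cases with
  | zero => rw [(mul_JM y i).1, c1 _ i (by simp; omega), add_zero]
  | succ t =>
    rw [(mul_JM y i).2 t]
    congr 1
    show v _ i = v _ i
    congr 1
    have := t.2
    simp
    omega

lemma irr_reg {m : ℕ} {f : GL (Fin (m+1)) F → ℂ} (hf : ∀ g h, f (h * g * h⁻¹) = f g) {u : GL (Fin (m+1)) F}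
    (hu : u ∈ UU F _) (h : ∀ i, sd u.1 i ≠ 0) : f u = f (JJ (m+1)) := by
  obtain ⟨y, hy⟩ := reg_conj hu h
  rw [hy, hf]

lemma J_inv {m : ℕ} {f : GL (Fin (m+1)) F → ℂ} (hf : ∀ g h, f (h * g * h⁻¹) = f g) :
    f (JJ (m+1))⁻¹ = f (JJ (m+1)) :=
  irr_reg hf (inv_mem (JJ_mem _)) fun i => by rw [sd_inv (JJ_mem _), sd_JJ]; simp

lemma J_pow (p k n : ℕ) (hp : p.Prime) [CharP F p] (hk : n ≤ p ^ k) : (JJ n : GL (Fin n) F) ^ p ^ k = 1 := by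
  have := Fact.mk hp
  apply Units.ext
  rw [Units.val_pow_eq_pow_val, Units.val_one]
  rcases Nat.eq_zero_or_pos n with rfl | hn
  · exact Subsingleton.elim _ _
  have : Nonempty (Fin n) := ⟨⟨0, hn⟩⟩
  have h1 : (JJ n : GL (Fin n) F).1 = 1 + (JM F n - 1) := by rw [add_sub_cancel]; rfl
  have h2 : ∀ k (i j : Fin n), j.val < i.val + k → ((JM F n - 1 : Matrix (Fin n) (Fin n) F) ^ k) i j = 0 := by
    intro k
    induction k with
    | zero => intro i j h; rw [pow_zero, Matrix.one_apply_ne]; rintro rfl; omega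
    | succ k ih =>
      intro i j h
      rw [pow_succ', Matrix.mul_apply]
      refine Finset.sum_eq_zero fun t _ => ?_
      by_cases ht : t ≤ i
      · rw [(JM_up n).sub ht, zero_mul]
      · rw [ih t j (by rw [not_le, Fin.lt_def] at ht; omega), mul_zero]
  have h3 : (JM F n - 1 : Matrix (Fin n) (Fin n) F) ^ p ^ k = 0 := by
    ext i j; exact h2 _ i j (by have := j.2; omega)
  rw [h1, add_pow_char_pow_of_commute p k (Commute.one_left _), h3, one_pow, add_zero]

lemma card_cent (m : ℕ) : Nat.card (Subgroup.centralizer {(JJ (m+1) : GL (Fin (m+1)) F)}) ≤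
    Fintype.card F ^ m * (Fintype.card F - 1) := by
  have hc : ∀ y : Subgroup.centralizer {(JJ (m+1) : GL (Fin (m+1)) F)}, y.1.1 * JM F (m+1) = JM F (m+1) * y.1.1 := fun y =>
    congrArg Units.val (Subgroup.mem_centralizer_singleton_iff.1 y.2)
  have t1 : ∀ (y : Subgroup.centralizer {(JJ (m+1) : GL (Fin (m+1)) F)}) (i j : Fin m),
      y.1.1 i.castSucc j.castSucc = y.1.1 i.succ j.succ := fun y i j => by
    have h1 := congrFun (congrFun (hc y) i.castSucc) j.succ
    rw [(mul_JM _ _).2, (JM_mul _ _).2] at h1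
    exact add_left_cancel h1
  have t2 : ∀ (y : Subgroup.centralizer {(JJ (m+1) : GL (Fin (m+1)) F)}) (j : Fin m),
      y.1.1 (Fin.last m) j.castSucc = 0 := fun y j => by
    have h1 := congrFun (congrFun (hc y) (Fin.last m)) j.succ
    rw [(mul_JM _ _).2, (JM_mul _ _).1] at h1
    simpa using h1
  have t3 : ∀ (y : Subgroup.centralizer {(JJ (m+1) : GL (Fin (m+1)) F)}), y.1.1 (Fin.last m) (Fin.last m) ≠ 0 := fun y h => by
    have h1 : y.1.1.det = 0 := Matrix.det_eq_zero_of_row_eq_zero (Fin.last m) fun j => by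
      induction j using Fin.lastCases with
      | last => exact h
      | cast j => exact t2 y j
    have := (Matrix.isUnit_iff_isUnit_det _).1 y.1.isUnit
    rw [h1] at this
    simp at this
  let f : Subgroup.centralizer {(JJ (m+1) : GL (Fin (m+1)) F)} → (Fin m → F) × Fˣ := fun y =>
    (fun i => y.1.1 i.castSucc (Fin.last m), Units.mk0 _ (t3 y))
  have hf : Function.Injective f := by
    intro y y' h
    have hl : ∀ i, y.1.1 i (Fin.last m) = y'.1.1 i (Fin.last m) := by
      intro i
      induction i using Fin.lastCases with
      | last => exact congrArg Units.val (congrArg Prod.snd h)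
      | cast i => exact congrFun (congrArg Prod.fst h) i
    apply Subtype.ext
    apply Units.ext
    ext i j
    revert i
    induction j using Fin.reverseInduction with
    | last => exact hl
    | cast j ih =>
      intro i
      induction i using Fin.lastCases with
      | last => rw [t2, t2]
      | cast i => rw [t1, t1, ih]
  refine (Nat.card_le_card_of_injective f hf).trans ?_
  rw [Nat.card_prod, Nat.card_fun, Nat.card_eq_fintype_card, Nat.card_eq_fintype_card, Nat.card_eq_fintype_card,
    Fintype.card_units, Fintype.card_fin]

end CT
end

noncomputable section
set_option linter.all false
namespace CT
open Module
attribute [local instance] Classical.propDecidable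
variable {F : Type} [Field F] [Fintype F]

def tr1 {n : ℕ} (M : Matrix (Fin n) (Fin n) F) : F := ∑ i, ∑ j, if j.val = i.val + 1 then M i j else 0

lemma tr1_mul {n : ℕ} {u v : Matrix (Fin n) (Fin n) F} (hu : IsUp u) (hv : IsUp v) : tr1 (u * v) = tr1 u + tr1 v := by
  simp only [tr1, ← Finset.sum_add_distrib]
  refine Finset.sum_congr rfl fun i _ => Finset.sum_congr rfl fun j _ => ?_
  split_ifs with h
  · rw [hu.pr hv h.le, Matrix.one_apply_ne (by rintro rfl; omega), _root_.sub_zero]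
  · simp

lemma tr1_one {n : ℕ} : tr1 (1 : Matrix (Fin n) (Fin n) F) = 0 := by
  refine Finset.sum_eq_zero fun i _ => Finset.sum_eq_zero fun j _ => ?_
  split_ifs with h
  · rw [Matrix.one_apply_ne (by rintro rfl; omega)]
  · rfl

lemma tr1_succ {m : ℕ} (M : Matrix (Fin (m+1)) (Fin (m+1)) F) : tr1 M = ∑ i, sd M i := by
  rw [tr1, Fin.sum_univ_castSucc]
  have h0 : ∑ j : Fin (m+1), (if j.val = (Fin.last m).val + 1 then M (Fin.last m) j else 0) = 0 :=
    Finset.sum_eq_zero fun j _ => if_neg (by simp; omega)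
  rw [h0, add_zero]
  refine Finset.sum_congr rfl fun i _ => ?_
  rw [Finset.sum_eq_single i.succ]
  · simp [sd]
  · intro b _ hb
    rw [if_neg]
    intro h; apply hb; ext; simpa using h
  · simp

def wt (ψ : AddChar F ℂ) (n : ℕ) : UU F n →* ℂ where
  toFun u := ψ (tr1 u.1.1)
  map_one' := by
    show ψ (tr1 1) = 1
    rw [tr1_one, AddChar.map_zero_eq_one]
  map_mul' u v := by
    show ψ (tr1 (u.1.1 * v.1.1)) = _
    rw [tr1_mul u.2 v.2, AddChar.map_add_eq_mul]

lemma wt_apply (ψ : AddChar F ℂ) (n : ℕ) (u : UU F n) : wt ψ n u = ψ (tr1 u.1.1) := rfl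

def dlt (ψ : AddChar F ℂ) (n : ℕ) (f : GL (Fin n) F → ℂ) : ℂ :=
  (Nat.card (UU F n) : ℂ)⁻¹ * ∑ u : UU F n, wt ψ n u * f u

def wh (ψ : AddChar F ℂ) {m : ℕ} (a : Fin m → F) : UU F (m+1) →* ℂ where
  toFun u := ψ (∑ i, a i * sd u.1.1 i)
  map_one' := by
    show ψ (∑ i, a i * sd 1 i) = 1
    simp [sd_one]
  map_mul' u v := by
    show ψ (∑ i, a i * sd (u.1 * v.1).1 i) = _
    simp only [sd_mul u.2 v.2, mul_add, Finset.sum_add_distrib, AddChar.map_add_eq_mul]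

lemma wh_apply (ψ : AddChar F ℂ) {m : ℕ} (a : Fin m → F) (u : UU F (m+1)) : wh ψ a u = ψ (∑ i, a i * sd u.1.1 i) := rfl

lemma wh_one (ψ : AddChar F ℂ) {m : ℕ} (u : UU F (m+1)) : wh ψ (fun _ => 1) u = wt ψ _ u := by
  rw [wh_apply, wt_apply, tr1_succ]; simp

def cc (t : F) : ℚ := (if t = 0 then 1 else 0) - (Fintype.card F : ℚ)⁻¹

lemma ind (ψ : AddChar F ℂ) (hψ : ψ.IsPrimitive) {m : ℕ} (x : Fin m → F) :
    (if ∀ i, x i ≠ 0 then 1 else 0 : ℂ) = ∑ a : Fin m → F, ((∏ i, cc (a i) : ℚ) : ℂ) * ψ (∑ i, a i * x i) := by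
  have hq : (Fintype.card F : ℂ) ≠ 0 := by simp
  have h1 : ∀ y : F, ∑ t, (cc t : ℂ) * ψ (t * y) = if y ≠ 0 then 1 else 0 := fun y => by
    have h2 := AddChar.sum_mulShift (R := F) y hψ
    have hcc : ∀ t : F, (cc t : ℂ) = (if t = 0 then 1 else 0) - (Fintype.card F : ℂ)⁻¹ := fun t => by
      unfold cc; split_ifs <;> push_cast <;> rfl
    simp only [hcc, sub_mul, Finset.sum_sub_distrib, ← Finset.mul_sum, h2, ite_mul, one_mul, zero_mul]
    rw [Finset.sum_ite_eq']
    by_cases hy : y = 0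
    · simp [hy, hq]
    · simp [hy]
  have h3 := Finset.prod_univ_sum (fun _ : Fin m => (Finset.univ : Finset F)) (fun i t => (cc t : ℂ) * ψ (t * x i))
  rw [Fintype.piFinset_univ] at h3
  have h4 : ∀ a : Fin m → F, ψ (∑ i, a i * x i) = ∏ i, ψ (a i * x i) := fun a => by
    induction (Finset.univ : Finset (Fin m)) using Finset.induction_on with
    | empty => simp
    | insert b s hb ih => rw [Finset.sum_insert hb, Finset.prod_insert hb, AddChar.map_add_eq_mul, ih]
  simp only [h4]
  push_cast
  simp only [← Finset.prod_mul_distrib]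
  rw [← h3]
  simp only [h1]
  by_cases hx : ∀ i, x i ≠ 0
  · simp [hx]
  · rw [if_neg hx]
    push Not at hx
    obtain ⟨i, hi⟩ := hx
    exact (Finset.prod_eq_zero (Finset.mem_univ i) (by simp [hi])).symm

lemma reg_sum (ψ : AddChar F ℂ) (hψ : ψ.IsPrimitive) {m : ℕ} {f : GL (Fin (m+1)) F → ℂ} (hf : ∀ g h, f (h * g * h⁻¹) = f g) :
    ∃ r : ℕ, r ≠ 0 ∧ (r : ℂ) * f (JJ (m+1)) = ∑ a : Fin m → F, ((∏ i, cc (a i) : ℚ) : ℂ) * ∑ u : UU F (m+1), wh ψ a u * f u := by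
  let S := Finset.univ.filter fun u : UU F (m+1) => ∀ i, sd u.1.1 i ≠ 0
  refine ⟨S.card, ?_, ?_⟩
  · rw [Finset.card_ne_zero]
    exact ⟨⟨JJ (m+1), JJ_mem _⟩, by simp [S, sd_JJ]⟩
  · simp only [Finset.mul_sum]
    rw [Finset.sum_comm]
    simp only [wh_apply, ← mul_assoc, ← Finset.sum_mul, ← ind ψ hψ]
    rw [Finset.sum_congr rfl (g := fun u : UU F (m+1) => if ∀ i, sd u.1.1 i ≠ 0 then f (JJ (m+1)) else 0), ← Finset.sum_filter, Finset.sum_const, nsmul_eq_mul]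
    intro u _
    split_ifs with h
    · rw [irr_reg hf u.2 h, one_mul]
    · simp

lemma U_ne (n : ℕ) : (Nat.card (UU F n) : ℂ) ≠ 0 := card_ne _

lemma wh_nat {m : ℕ} (χ : Irr (GL (Fin (m+1)) F)) (ψ : AddChar F ℂ) (a : Fin m → F) : ∃ k : ℕ,
    ∑ u : UU F (m+1), wh ψ a u * χ.1 u = ((Nat.card (UU F (m+1)) * k : ℕ) : ℂ) := by
  obtain ⟨k, hk⟩ := irr_avg_nat χ (UU F (m+1)).subtype (wh ψ a)
  refine ⟨k, ?_⟩
  rw [inv_mul_eq_iff_eq_mul₀ (U_ne _)] at hk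
  push_cast
  rw [← hk]; rfl

lemma dlt_nat {n : ℕ} (χ : Irr (GL (Fin n) F)) (ψ : AddChar F ℂ) : ∃ k : ℕ, dlt ψ n χ.1 = k :=
  irr_avg_nat χ (UU F n).subtype (wt ψ n)

theorem eps_int (ψ : AddChar F ℂ) (hψ : ψ.IsPrimitive) {m : ℕ} (χ : Irr (GL (Fin (m+1)) F)) :
    ∃ a : ℤ, χ.1 (JJ (m+1)) = a := by
  obtain ⟨r, hr, h⟩ := reg_sum ψ hψ (irr_conj χ)
  choose k hk using wh_nat χ ψ
  simp only [hk] at h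
  refine int_of_rat _ (irr_int χ _) ((r : ℚ)⁻¹ * ∑ a : Fin m → F, (∏ i, cc (a i)) * ((Nat.card (UU F (m+1)) * k a : ℕ) : ℚ)) ?_
  have hr' : (r : ℂ) ≠ 0 := by exact_mod_cast hr
  rw [← mul_right_inj' hr', h]
  push_cast
  rw [← mul_assoc, mul_inv_cancel₀ hr', one_mul]

lemma cusp_van {m : ℕ} (χ : Irr (GL (Fin (m+1)) F)) (hc : Cusp (ofC (m+1) χ.1)) (ψ : AddChar F ℂ) (a : Fin m → F) (i : Fin m)
    (ha : a i = 0) : ∑ u : UU F (m+1), wh ψ a u * χ.1 u = 0 := by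
  let D : Submodule F (Fin (m+1) → F) :=
    { carrier := {x | ∀ j : Fin (m+1), i.val < j.val → x j = 0}
      add_mem' := fun {x y} hx hy j hj => by rw [Pi.add_apply, hx j hj, hy j hj, add_zero]
      zero_mem' := fun j _ => rfl
      smul_mem' := fun c x hx j hj => by rw [Pi.smul_apply, hx j hj, smul_zero] }
  have hD0 : D ≠ ⊥ := by
    rw [Submodule.ne_bot_iff]
    refine ⟨Pi.single 0 1, fun j hj => Pi.single_eq_of_ne (by rintro rfl; simp at hj) _, fun h => ?_⟩
    have := congrFun h 0
    simp at this
  have hD1 : D ≠ ⊤ := by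
    intro h
    have h1 : (Pi.single (Fin.last m) 1 : (Fin (m+1) → F)) ∈ D := by rw [h]; trivial
    have := h1 (Fin.last m) (by simp)
    simp at this
  let E : (((Fin (m+1) → F) ⧸ D) →ₗ[F] D) → End F (Fin (m+1) → F) := fun k => 1 + D.subtype ∘ₗ k ∘ₗ D.mkQ
  have e1 : ∀ k (r c : Fin (m+1)), i.val < r.val → LinearMap.toMatrix' (E k) r c = if r = c then 1 else 0 := by
    intro k r c h
    rw [LinearMap.toMatrix'_apply]
    have h1 := (k (D.mkQ (Pi.single c 1))).2 r h
    simp only [E, LinearMap.add_apply, End.one_apply, LinearMap.comp_apply, Submodule.subtype_apply, Pi.add_apply]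
    rw [h1, Pi.single_apply, add_zero]
  have e2 : ∀ k (r c : Fin (m+1)), c.val ≤ i.val → LinearMap.toMatrix' (E k) r c = if r = c then 1 else 0 := by
    intro k r c h
    rw [LinearMap.toMatrix'_apply]
    have h1 : D.mkQ (Pi.single c 1 : (Fin (m+1) → F)) = 0 := by
      rw [Submodule.mkQ_apply, Submodule.Quotient.mk_eq_zero]
      exact fun j hj => Pi.single_eq_of_ne (by rintro rfl; omega) _
    simp only [E, LinearMap.add_apply, End.one_apply, LinearMap.comp_apply, Pi.add_apply]
    rw [h1, map_zero, map_zero, Pi.single_apply, Pi.zero_apply, add_zero]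
  have eU : ∀ k, IsUp (LinearMap.toMatrix' (E k)) := fun k r c h => by
    by_cases h1 : i.val < r.val
    · exact e1 k r c h1
    · exact e2 k r c (by rw [Fin.le_def] at h; omega)
  let φ : (((Fin (m+1) → F) ⧸ D) →ₗ[F] D) → UU F (m+1) := fun k => ⟨mkU _ (eU k), mkU_mem _ _⟩
  apply sum_zero_of φ
  intro x
  have hw : ∀ k, wh ψ a (φ k) = 1 := fun k => by
    rw [wh_apply, Finset.sum_eq_zero, AddChar.map_zero_eq_one]
    intro j _
    by_cases hj : j = i
    · rw [hj, ha, zero_mul]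
    · have : sd (φ k).1.1 j = 0 := by
        show LinearMap.toMatrix' (E k) j.castSucc j.succ = 0
        have hne : j.castSucc ≠ j.succ := by intro h; have := congrArg Fin.val h; simp at this
        have hv : j.val ≠ i.val := fun h => hj (Fin.ext h)
        by_cases h1 : i.val < j.val
        · rw [e1 k _ _ (by simpa using h1), if_neg hne]
        · rw [e2 k _ _ (by simp; omega), if_neg hne]
      rw [this, mul_zero]
  have hx : ∀ k, χ.1 ((x * φ k : UU F (m+1)) : GL (Fin (m+1)) F) = (ofC (m+1) χ.1).f (Fin (m+1) → F) (x.1.1.mulVecLin * E k) := fun k => by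
    have := congrFun (res_ofC (irr_conj χ)) (x.1 * (φ k).1)
    rw [← Subgroup.coe_mul] at this
    rw [← this, res]
    congr 1
    show (x.1.1 * LinearMap.toMatrix' (E k)).mulVecLin = _
    rw [Matrix.mulVecLin_mul, ← Matrix.toLin'_apply' (LinearMap.toMatrix' (E k)), Matrix.toLin'_toMatrix']
    rfl
  simp only [map_mul, hw, mul_one, hx, ← Finset.mul_sum]
  rw [hc (Fin (m+1) → F) D hD0 hD1, mul_zero]

theorem eps_cusp (ψ : AddChar F ℂ) (hψ : ψ.IsPrimitive) {m : ℕ} (χ : Irr (GL (Fin (m+1)) F)) (hc : Cusp (ofC (m+1) χ.1))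
    (h0 : dlt ψ (m+1) χ.1 ≠ 0) : χ.1 (JJ (m+1)) ≠ 0 := by
  obtain ⟨r, hr, h⟩ := reg_sum ψ hψ (irr_conj χ)
  choose k hk using wh_nat χ ψ
  intro h1
  rw [h1, mul_zero] at h
  have hz : ∀ a : Fin m → F, ((∏ i, cc (a i) : ℚ) : ℂ) * ∑ u : UU F (m+1), wh ψ a u * χ.1 u =
      (-(Fintype.card F : ℂ)⁻¹) ^ m * ((Nat.card (UU F (m+1)) * k a : ℕ) : ℂ) := fun a => by
    rw [← hk]
    by_cases ha : ∃ i, a i = 0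
    · obtain ⟨i, hi⟩ := ha
      rw [cusp_van χ hc ψ a i hi, mul_zero, mul_zero]
    · push Not at ha
      congr 1
      simp [cc, ha]
  simp only [hz] at h
  rw [← Finset.mul_sum] at h
  have h2 := (mul_eq_zero.1 h.symm).resolve_left (pow_ne_zero _ (by simp))
  have h3 : ∑ a : Fin m → F, Nat.card (UU F (m+1)) * k a = 0 := by exact_mod_cast h2
  rw [Finset.sum_eq_zero_iff] at h3
  have h4 := hk fun _ => 1
  rw [h3 _ (Finset.mem_univ _)] at h4
  simp only [wh_one] at h4
  exact h0 (by rw [dlt, h4]; simp)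

end CT
end

noncomputable section
set_option linter.all false
namespace CT
open Module
attribute [local instance] Classical.propDecidable
variable {F : Type} [Field F] [Fintype F]

def sh {n : ℕ} (x : Fin n → F) (i : ℕ) : F := if h : i < n then x ⟨i, h⟩ else 0

lemma sh_val {n : ℕ} (x : Fin n → F) (i : Fin n) : sh x i.val = x i := dif_pos i.2

lemma sum_sh {n : ℕ} (x : Fin n → F) (c : ℕ) : (∑ k : Fin n, if k.val = c then x k else 0) = sh x c := by
  by_cases h : c < n
  · rw [sh, dif_pos h, Finset.sum_eq_single ⟨c, h⟩]
    · simp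
    · intro b _ hb; rw [if_neg]; intro h1; exact hb (Fin.ext h1)
    · simp
  · rw [sh, dif_neg h]
    exact Finset.sum_eq_zero fun k _ => if_neg (by omega)

lemma JM_mulVec {n : ℕ} (x : Fin n → F) (j : Fin n) : (JM F n *ᵥ x) j = x j + sh x (j.val + 1) := by
  rw [← sum_sh, Matrix.mulVec, dotProduct]
  simp only [JM, Matrix.of_apply, add_mul, Finset.sum_add_distrib, ite_mul, one_mul, zero_mul]
  simp

def NN (n : ℕ) : End F (Fin n → F) := (JM F n).mulVecLin - 1

lemma NN_sh {n : ℕ} (x : Fin n → F) (i : ℕ) : sh (NN n x) i = sh x (i+1) := by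
  by_cases h : i < n
  · rw [sh, dif_pos h]
    show (JM F n *ᵥ x) _ - x _ = _
    rw [JM_mulVec, add_sub_cancel_left]
  · rw [sh, dif_neg h, sh, dif_neg (by omega)]

lemma NN_pow {n : ℕ} (k : ℕ) : ∀ (x : Fin n → F) (i : ℕ), sh ((NN n ^ k) x) i = sh x (i+k) := by
  induction k with
  | zero => intro x i; simp
  | succ k ih => intro x i; rw [pow_succ, Module.End.mul_apply, ih, NN_sh, add_assoc]

lemma NN_nil (n : ℕ) : (NN n : End F (Fin n → F)) ^ n = 0 := by
  refine LinearMap.ext fun x => funext fun i => ?_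
  rw [← sh_val ((NN n ^ n) x), NN_pow, sh, dif_neg (by omega)]; rfl

def inlF (a b : ℕ) : (Fin a → F) →ₗ[F] (Fin (a+b) → F) where
  toFun x := Fin.addCases x (fun _ => 0)
  map_add' x y := by ext j; refine Fin.addCases (fun i => ?_) (fun i => ?_) j <;> simp
  map_smul' c x := by ext j; refine Fin.addCases (fun i => ?_) (fun i => ?_) j <;> simp

def sndF (a b : ℕ) : (Fin (a+b) → F) →ₗ[F] (Fin b → F) where
  toFun x j := x (Fin.natAdd a j)
  map_add' x y := rfl
  map_smul' c x := rfl

@[simp] lemma inlF_l {a b : ℕ} (x : Fin a → F) (i : Fin a) : inlF a b x (Fin.castAdd b i) = x i := by simp [inlF]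
@[simp] lemma inlF_r {a b : ℕ} (x : Fin a → F) (i : Fin b) : inlF a b x (Fin.natAdd a i) = 0 := by simp [inlF]
@[simp] lemma sndF_a {a b : ℕ} (x : Fin (a+b) → F) (i : Fin b) : sndF a b x i = x (Fin.natAdd a i) := rfl

lemma inlF_inj (a b : ℕ) : Function.Injective (inlF a b : (Fin a → F) →ₗ[F] (Fin (a+b) → F)) := fun x y h =>
  funext fun i => by rw [← inlF_l (b := b) x i, h, inlF_l]

lemma sndF_surj (a b : ℕ) : Function.Surjective (sndF a b : (Fin (a+b) → F) →ₗ[F] _) := fun y =>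
  ⟨Fin.addCases (fun _ => 0) y, by ext i; simp⟩

lemma ker_sndF (a b : ℕ) : LinearMap.range (inlF a b : (Fin a → F) →ₗ[F] _) = LinearMap.ker (sndF a b) := by
  ext x
  rw [LinearMap.mem_ker]
  constructor
  · rintro ⟨y, rfl⟩; ext i; simp
  · intro h
    refine ⟨fun i => x (Fin.castAdd b i), ?_⟩
    ext j
    refine Fin.addCases (fun i => ?_) (fun i => ?_) j
    · simp
    · rw [inlF_r]; exact (congrFun h i).symm

lemma finrank_rg (a b : ℕ) : finrank F (LinearMap.range (inlF a b : (Fin a → F) →ₗ[F] _)) = a := by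
  rw [LinearMap.finrank_range_of_inj (inlF_inj a b), finrank_fin]

lemma J_stable {a b : ℕ} (W : Submodule F (Fin (a+b) → F)) (hW : finrank F W = a)
    (h : ∀ x ∈ W, (JM F (a+b)).mulVecLin x ∈ W) : W = LinearMap.range (inlF a b) := by
  refine Submodule.eq_of_le_of_finrank_eq ?_ (by rw [hW, finrank_rg])
  have hN : ∀ x ∈ W, NN (a+b) x ∈ W := fun x hx => W.sub_mem (h x hx) hx
  have h1 : IsNilpotent ((NN (a+b)).restrict hN) := Module.End.isNilpotent.restrict hN ⟨_, NN_nil _⟩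
  have h2 := LinearMap.aeval_self_charpoly ((NN (a+b)).restrict hN)
  rw [(LinearMap.charpoly_eq_X_pow_iff _).2 fun m => ?_, map_pow, Polynomial.aeval_X, hW] at h2
  · intro x hx
    rw [ker_sndF, LinearMap.mem_ker]
    have h3 := congrArg Subtype.val (LinearMap.congr_fun h2 ⟨x, hx⟩)
    rw [Module.End.pow_restrict] at h3
    change (NN (a+b) ^ a) x = 0 at h3
    ext j
    have := NN_pow a x j.val
    rw [h3] at this
    rw [sndF_a, ← sh_val x]
    show sh x (a + j.val) = 0
    rw [add_comm a j.val, ← this]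
    simp [sh]
  · obtain ⟨k, hk⟩ := h1
    exact ⟨k, by rw [hk]; rfl⟩

lemma sh_inl {a b : ℕ} (x : Fin a → F) (i : ℕ) : sh (inlF a b x) i = sh x i := by
  by_cases h : i < a
  · rw [sh, dif_pos (by omega), sh, dif_pos h, ← inlF_l (b := b) x]; rfl
  · conv_rhs => rw [sh, dif_neg h]
    by_cases h' : i < a + b
    · have h1 : i - a < b := by omega
      rw [sh, dif_pos h']
      refine Eq.trans (congrArg _ ?_) (inlF_r (a := a) x ⟨i - a, h1⟩)
      ext; simp; omega
    · rw [sh, dif_neg h']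

lemma sh_snd {a b : ℕ} (x : Fin (a+b) → F) (i : ℕ) : sh (sndF a b x) i = sh x (a+i) := by
  by_cases h : i < b
  · rw [sh, dif_pos h, sh, dif_pos (by omega)]; rfl
  · rw [sh, dif_neg h, sh, dif_neg (by omega)]

lemma ext_sh {n : ℕ} {x y : Fin n → F} (h : ∀ i, sh x i = sh y i) : x = y := funext fun i => by
  rw [← sh_val x, h, sh_val]

theorem eps_mul (α X : CF F) {a b n : ℕ} (hα : Deg α a) (hn : n = a + b) :
    res n (mulC α X) (JJ n) = res a α (JJ a) * res b X (JJ b) := by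
  subst hn
  have hJ : ∀ (n : ℕ) (x : Fin n → F) i, sh ((JM F n).mulVecLin x) i = sh x i + sh x (i+1) := fun n x i => by
    rw [← NN_sh]
    by_cases h : i < n
    · simp only [sh, dif_pos h]; simp [NN]
    · simp only [sh, dif_neg h]; simp
  show ∑ U : Submodule F (Fin (a+b) → F), sub α U (JM F (a+b)).mulVecLin * quo X U (JM F (a+b)).mulVecLin = _
  rw [Finset.sum_eq_single (LinearMap.range (inlF a b))]
  · congr 1
    · refine sub_eq α (inlF a b) (inlF_inj a b) rfl _ fun x => ext_sh fun i => ?_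
      rw [hJ, sh_inl, sh_inl, sh_inl]
      exact (hJ _ _ _).symm
    · refine quo_eq X (sndF a b) (sndF_surj a b) (ker_sndF a b).symm _ fun x => ext_sh fun i => ?_
      rw [sh_snd, hJ]
      refine Eq.trans ?_ (hJ _ _ _).symm
      rw [sh_snd, sh_snd, add_assoc]
  · intro W _ hW
    by_cases hs : ∀ x ∈ W, (JM F (a+b)).mulVecLin x ∈ W
    · rw [sub, dif_pos hs, hα _ _ fun h => hW (J_stable W h hs), zero_mul]
    · rw [sub_zero hs, zero_mul]
  · simp

lemma eps_R (ψ : AddChar F ℂ) (hψ : ψ.IsPrimitive) (l : List (Cu F)) (h : ∀ ρ ∈ l, dlt ψ ρ.m ρ.χ.1 ≠ 0) :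
    ∀ n, dg l = n → res n (R l) (JJ n) ≠ 0 := by
  induction l with
  | nil =>
    rintro n rfl
    show (oneC : CF F).f (Fin 0 → F) _ ≠ 0
    simp [oneC]
  | cons ρ l ih =>
    intro n hn
    rw [R, eps_mul ρ.cf (R l) ofC_deg (hn ▸ rfl : n = ρ.m + dg l)]
    refine mul_ne_zero ?_ (ih (fun σ hσ => h σ (List.mem_cons_of_mem _ hσ)) _ rfl)
    have h0 := h ρ List.mem_cons_self
    rw [Cu.cf, res_ofC (irr_conj _)]
    obtain ⟨m, χ, pos, cusp⟩ := ρ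
    obtain _ | m := m
    · simp at pos
    exact eps_cusp ψ hψ χ cusp h0

end CT
end

noncomputable section
set_option linter.all false
namespace CT
open Module
attribute [local instance] Classical.propDecidable
variable {F : Type} [Field F] [Fintype F]

variable (F) in
def EE (n k : ℕ) : Submodule F (Fin n → F) where
  carrier := {x | ∀ j : Fin n, k ≤ j.val → x j = 0}
  add_mem' {x y} hx hy j hj := by rw [Pi.add_apply, hx j hj, hy j hj, add_zero]
  zero_mem' j _ := rfl
  smul_mem' c x hx j hj := by rw [Pi.smul_apply, hx j hj, smul_zero]

lemma mem_EE {n k : ℕ} {x : Fin n → F} : x ∈ EE F n k ↔ ∀ j : Fin n, k ≤ j.val → x j = 0 := Iff.rfl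

def TW (ψ : AddChar F ℂ) (α X : CF F) {n : ℕ} (W : Submodule F (Fin n → F)) : ℂ :=
  ∑ u : UU F n, wt ψ n u * (sub α W u.1.1.mulVecLin * quo X W u.1.1.mulVecLin)

lemma T_bad (ψ : AddChar F ℂ) (hψ : ψ.IsPrimitive) (α X : CF F) {n : ℕ} (W : Submodule F (Fin n → F)) (i j : Fin n)
    (hij : j.val = i.val + 1) (w : Fin n → F) (hw : w ∈ W) (hwE : w ∈ EE F n (i.val+1)) (hwi : w i = 1)
    (hW : ∀ x ∈ W, x ∈ EE F n (i.val+2) → x j = 0) : TW ψ α X W = 0 := by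
  have hne : (Pi.single j 1 : Fin n → F) ∉ W ⊔ EE F n (i.val+1) := by
    intro h
    obtain ⟨x, hx, y, hy, hxy⟩ := Submodule.mem_sup.1 h
    have hx' : x = Pi.single j 1 - y := by rw [← hxy]; simp
    have h1 := hW x hx fun k hk => by
      rw [hx', Pi.sub_apply, hy k (by omega), Pi.single_eq_of_ne (by rintro rfl; omega), _root_.sub_zero]
    rw [hx', Pi.sub_apply, hy j (by omega), Pi.single_eq_same, _root_.sub_zero] at h1
    exact one_ne_zero h1
  obtain ⟨l0, hl0, hker⟩ := Submodule.exists_le_ker_of_notMem hne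
  let l : (Fin n → F) →ₗ[F] F := (l0 (Pi.single j 1))⁻¹ • l0
  have lj : l (Pi.single j 1) = 1 := by simp [l, hl0]
  have lW : ∀ x ∈ W, l x = 0 := fun x hx => by
    have := hker (Submodule.mem_sup_left hx); rw [LinearMap.mem_ker] at this; simp [l, this]
  have lE : ∀ x ∈ EE F n (i.val+1), l x = 0 := fun x hx => by
    have := hker (Submodule.mem_sup_right hx); rw [LinearMap.mem_ker] at this; simp [l, this]
  let μ : F → End F (Fin n → F) := fun c => (c • l).smulRight w
  have hμ : ∀ c x, μ c x = (c * l x) • w := fun c x => rfl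
  have hM : ∀ c r t, LinearMap.toMatrix' (1 + μ c) r t = (if r = t then 1 else 0) + c * l (Pi.single t 1) * w r := fun c r t => by
    rw [LinearMap.toMatrix'_apply, LinearMap.add_apply, hμ, Pi.add_apply, Pi.smul_apply, End.one_apply, Pi.single_apply, smul_eq_mul]
  have hz : ∀ r t : Fin n, (i.val < r.val ∨ t.val ≤ i.val) → l (Pi.single t 1) * w r = 0 := by
    rintro r t (h | h)
    · rw [hwE r h, mul_zero]
    · rw [lE _ (fun k hk => Pi.single_eq_of_ne (by rintro rfl; omega) _), zero_mul]
  have eU : ∀ c, IsUp (LinearMap.toMatrix' (1 + μ c)) := fun c r t h => by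
    rw [hM, mul_assoc, hz r t (by rw [Fin.le_def] at h; omega), mul_zero, add_zero]
  let φ : F → UU F n := fun c => ⟨mkU _ (eU c), mkU_mem _ _⟩
  have hwt : ∀ c, wt ψ n (φ c) = ψ c := fun c => by
    rw [wt_apply]
    congr 1
    show tr1 (LinearMap.toMatrix' (1 + μ c)) = c
    rw [tr1, Finset.sum_eq_single i, Finset.sum_eq_single j]
    · rw [if_pos hij, hM, if_neg (by rintro rfl; omega), lj, hwi]; ring
    · intro t _ ht
      rw [if_neg]; intro h; exact ht (Fin.ext (by omega))
    · simp
    · intro r _ hr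
      refine Finset.sum_eq_zero fun t _ => ?_
      split_ifs with h
      · rw [hM, if_neg (by rintro rfl; omega), mul_assoc, hz r t (by have : r.val ≠ i.val := fun h => hr (Fin.ext h); omega), mul_zero, add_zero]
      · rfl
    · simp
  have hmul : ∀ (x : UU F n) c, (x * φ c).1.1.mulVecLin = x.1.1.mulVecLin * (1 + μ c) := fun x c => by
    show (x.1.1 * LinearMap.toMatrix' (1 + μ c)).mulVecLin = _
    rw [Matrix.mulVecLin_mul, ← Matrix.toLin'_apply' (LinearMap.toMatrix' (1 + μ c)), Matrix.toLin'_toMatrix']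
    rfl
  apply sum_zero_of φ
  intro x
  have hψ1 : ψ ≠ 1 := by
    have := hψ (a := 1) one_ne_zero
    rwa [AddChar.mulShift_one] at this
  have h2 : ∀ c t, μ c (μ c t) = 0 := fun c t => by
    rw [hμ, hμ, map_smul, lW w hw, smul_zero, mul_zero, zero_smul]
  have hs : ∀ c, sub α W (x * φ c).1.1.mulVecLin = sub α W x.1.1.mulVecLin := fun c => by
    rw [hmul]
    exact sub_mul_ker α (fun t ht => by rw [hμ, lW t ht, mul_zero, zero_smul]) _
  have hq : ∀ c, quo X W (x * φ c).1.1.mulVecLin = quo X W x.1.1.mulVecLin := fun c => by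
    rw [hmul]
    exact quo_mul X (h2 c) (fun t => W.smul_mem _ hw) _
  simp only [hs, hq, map_mul, hwt]
  rw [← Finset.sum_mul, ← Finset.mul_sum, AddChar.sum_eq_zero_of_ne_one hψ1, mul_zero, zero_mul]

lemma EE_rg (b a : ℕ) : EE F (b+a) b = LinearMap.range (inlF b a) := by
  rw [ker_sndF]
  ext x
  rw [LinearMap.mem_ker]
  constructor
  · intro h; ext j; exact h _ (by simp)
  · intro h j hj
    have := congrFun h ⟨j.val - b, by omega⟩
    rw [sndF_a] at this
    refine Eq.trans (congrArg x ?_) this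
    ext; simp; omega

lemma T_good (ψ : AddChar F ℂ) (hψ : ψ.IsPrimitive) (α X : CF F) {a b : ℕ} (hα : Deg α a)
    (W : Submodule F (Fin (b+a) → F)) (hT : TW ψ α X W ≠ 0) : finrank F W = a ∧ W ⊓ EE F (b+a) b = ⊥ := by
  have hf : finrank F W = a := by
    by_contra h
    refine hT (Finset.sum_eq_zero fun u _ => ?_)
    unfold sub
    split_ifs
    · rw [hα _ _ h]; simp
    · simp
  refine ⟨hf, ?_⟩
  by_contra hne
  obtain ⟨x, hx, hx0⟩ := (Submodule.ne_bot_iff _).1 hne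
  have hS : (Finset.univ.filter fun j => x j ≠ 0).Nonempty := by
    by_contra h
    rw [Finset.not_nonempty_iff_eq_empty, Finset.filter_eq_empty_iff] at h
    exact hx0 (funext fun j => not_not.1 (h (Finset.mem_univ j)))
  set i := (Finset.univ.filter fun j => x j ≠ 0).max' hS with hi
  have hi0 : x i ≠ 0 := (Finset.mem_filter.1 (Finset.max'_mem _ hS)).2
  have hi1 : ∀ j, i < j → x j = 0 := fun j hj => by
    by_contra h
    exact absurd (Finset.le_max' _ j (Finset.mem_filter.2 ⟨Finset.mem_univ _, h⟩)) (not_le.2 hj)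
  have hib : i.val < b := by
    by_contra h
    exact hi0 (hx.2 i (not_lt.1 h))
  have key : ∀ k, (hk : i.val + k < b + a) → ∃ w ∈ W, w ∈ EE F (b+a) (i.val+k+1) ∧ w ⟨i.val+k, hk⟩ = 1 := by
    intro k
    induction k with
    | zero =>
      intro hk
      refine ⟨(x i)⁻¹ • x, W.smul_mem _ hx.1, (EE F _ _).smul_mem _ fun j hj => hi1 j (by rw [Fin.lt_def]; omega), ?_⟩
      show (x i)⁻¹ * x i = 1
      rw [inv_mul_cancel₀ hi0]
    | succ k ih =>
      intro hk
      obtain ⟨w, hw, hwE, hwi⟩ := ih (by omega)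
      by_contra hcon
      refine hT (T_bad ψ hψ α X W ⟨i.val+k, by omega⟩ ⟨i.val+(k+1), hk⟩ rfl w hw hwE hwi fun y hy hyE => ?_)
      by_contra hy0
      refine hcon ⟨(y ⟨i.val+(k+1), hk⟩)⁻¹ • y, W.smul_mem _ hy, (EE F _ _).smul_mem _ hyE, ?_⟩
      show (y ⟨i.val+(k+1), hk⟩)⁻¹ * y ⟨i.val+(k+1), hk⟩ = 1
      rw [inv_mul_cancel₀ hy0]
  have key2 : ∀ k, b + k ≤ b + a → EE F (b+a) (b+k) ≤ W ⊔ EE F (b+a) b := by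
    intro k
    induction k with
    | zero => intro _; exact le_sup_right
    | succ k ih =>
      intro hk y hy
      obtain ⟨w, hw, hwE, hwi⟩ := key (b + k - i.val) (by omega)
      have e : i.val + (b + k - i.val) = b + k := by omega
      simp only [e] at hwE hwi
      have h1 : y - y ⟨b+k, by omega⟩ • w ∈ EE F (b+a) (b+k) := fun j hj => by
        by_cases hj' : j = ⟨b+k, by omega⟩
        · rw [hj', Pi.sub_apply, Pi.smul_apply, hwi]; simp
        · have : b + k + 1 ≤ j.val := by
            have : j.val ≠ b + k := fun h => hj' (Fin.ext h)
            omega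
          rw [Pi.sub_apply, Pi.smul_apply, hy j (by omega), hwE j this]; simp
      have := Submodule.add_mem _ (ih (by omega) h1) (Submodule.mem_sup_left (T := EE F (b+a) b) (W.smul_mem (y ⟨b+k, by omega⟩) hw))
      simpa using this
  have h3 : W ⊔ EE F (b+a) b = ⊤ := by
    rw [eq_top_iff]
    exact fun y _ => key2 a le_rfl (fun j hj => absurd hj (by omega))
  have h4 := Submodule.finrank_sup_add_finrank_inf_eq W (EE F (b+a) b)
  rw [h3, finrank_top, finrank_fin, hf, EE_rg, finrank_rg] at h4
  refine hne (Submodule.finrank_eq_zero.1 ?_)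
  rw [EE_rg]; omega

end CT
end

noncomputable section
set_option linter.all false
namespace CT
open Module
attribute [local instance] Classical.propDecidable
variable {F : Type} [Field F] [Fintype F]

def inrF (b a : ℕ) : (Fin a → F) →ₗ[F] (Fin (b+a) → F) where
  toFun x := Fin.addCases (fun _ => 0) x
  map_add' x y := by ext j; refine Fin.addCases (fun i => ?_) (fun i => ?_) j <;> simp
  map_smul' c x := by ext j; refine Fin.addCases (fun i => ?_) (fun i => ?_) j <;> simp

def fstF (b a : ℕ) : (Fin (b+a) → F) →ₗ[F] (Fin b → F) where
  toFun x j := x (Fin.castAdd a j)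
  map_add' x y := rfl
  map_smul' c x := rfl

@[simp] lemma inrF_l {b a : ℕ} (x : Fin a → F) (i : Fin b) : inrF b a x (Fin.castAdd a i) = 0 := by simp [inrF]
@[simp] lemma inrF_r {b a : ℕ} (x : Fin a → F) (i : Fin a) : inrF b a x (Fin.natAdd b i) = x i := by simp [inrF]
@[simp] lemma fstF_a {b a : ℕ} (x : Fin (b+a) → F) (i : Fin b) : fstF b a x i = x (Fin.castAdd a i) := rfl

lemma inrF_inj (b a : ℕ) : Function.Injective (inrF b a : (Fin a → F) →ₗ[F] (Fin (b+a) → F)) := fun x y h =>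
  funext fun i => by rw [← inrF_r (b := b) x i, h, inrF_r]

lemma fstF_surj (b a : ℕ) : Function.Surjective (fstF b a : (Fin (b+a) → F) →ₗ[F] _) := fun y =>
  ⟨Fin.addCases y (fun _ => 0), by ext i; simp⟩

lemma ker_fstF (b a : ℕ) : LinearMap.range (inrF b a : (Fin a → F) →ₗ[F] _) = LinearMap.ker (fstF b a) := by
  ext x
  rw [LinearMap.mem_ker]
  constructor
  · rintro ⟨y, rfl⟩; ext i; simp
  · intro h
    refine ⟨fun i => x (Fin.natAdd b i), ?_⟩
    ext j
    refine Fin.addCases (fun i => ?_) (fun i => ?_) j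
    · rw [inrF_l]; exact (congrFun h i).symm
    · simp

variable (F) in
def W0 (b a : ℕ) : Submodule F (Fin (b+a) → F) := LinearMap.range (inrF b a)

/-- block diagonal -/
def bd {b a : ℕ} (A : Matrix (Fin b) (Fin b) F) (D : Matrix (Fin a) (Fin a) F) : Matrix (Fin (b+a)) (Fin (b+a)) F :=
  Matrix.reindex finSumFinEquiv finSumFinEquiv (Matrix.fromBlocks A 0 0 D)

section
variable {b a : ℕ} (A : Matrix (Fin b) (Fin b) F) (D : Matrix (Fin a) (Fin a) F)
@[simp] lemma bd11 (i j) : bd A D (Fin.castAdd a i) (Fin.castAdd a j) = A i j := by simp [bd]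
@[simp] lemma bd12 (i j) : bd A D (Fin.castAdd a i) (Fin.natAdd b j) = 0 := by simp [bd]
@[simp] lemma bd21 (i j) : bd A D (Fin.natAdd b i) (Fin.castAdd a j) = 0 := by simp [bd]
@[simp] lemma bd22 (i j) : bd A D (Fin.natAdd b i) (Fin.natAdd b j) = D i j := by simp [bd]

lemma bd_up (hA : IsUp A) (hD : IsUp D) : IsUp (bd A D) := by
  intro i j
  refine Fin.addCases (fun i => ?_) (fun i => ?_) i <;> refine Fin.addCases (fun j => ?_) (fun j => ?_) j <;> intro h
  · rw [bd11, hA i j h]; simp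
  · rw [Fin.le_def] at h; simp at h; omega
  · rw [bd21, if_neg (by intro h; have := congrArg Fin.val h; simp at this; omega)]
  · rw [bd22, hD i j (by simpa using h)]; simp

lemma bd_tr : tr1 (bd A D) = tr1 A + tr1 D := by
  simp only [tr1, Fin.sum_univ_add, bd11, bd12, bd21, bd22, ite_self, Finset.sum_const_zero, add_zero, zero_add, Fin.val_castAdd, Fin.val_natAdd]
  congr 1
  refine Finset.sum_congr rfl fun i _ => Finset.sum_congr rfl fun j _ => ?_
  congr 1
  rw [eq_iff_iff]; omega

lemma bd_inr (x : Fin a → F) : bd A D *ᵥ (inrF b a x) = inrF b a (D *ᵥ x) := by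
  ext j
  refine Fin.addCases (fun i => ?_) (fun i => ?_) j
  · simp [Matrix.mulVec, dotProduct, Fin.sum_univ_add]
  · simp [Matrix.mulVec, dotProduct, Fin.sum_univ_add]

lemma bd_fst (x : Fin (b+a) → F) : fstF b a (bd A D *ᵥ x) = A *ᵥ (fstF b a x) := by
  ext i
  simp [Matrix.mulVec, dotProduct, Fin.sum_univ_add]

lemma bd_of {M : Matrix (Fin (b+a)) (Fin (b+a)) F} (hM : IsUp M) (h : ∀ x ∈ W0 F b a, M.mulVecLin x ∈ W0 F b a) :
    M = bd (Matrix.of fun i j => M (Fin.castAdd a i) (Fin.castAdd a j)) (Matrix.of fun i j => M (Fin.natAdd b i) (Fin.natAdd b j)) := by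
  ext i j
  refine Fin.addCases (fun i => ?_) (fun i => ?_) i <;> refine Fin.addCases (fun j => ?_) (fun j => ?_) j
  · simp
  · rw [bd12]
    have := h (Pi.single (Fin.natAdd b j) 1) (by
      rw [W0, ker_fstF, LinearMap.mem_ker]
      ext k; simp only [fstF_a]
      exact Pi.single_eq_of_ne (by intro h; have := congrArg Fin.val h; simp at this; omega) _)
    rw [W0, ker_fstF, LinearMap.mem_ker] at this
    have := congrFun this i
    rw [fstF_a, Matrix.mulVecLin_apply, Matrix.mulVec_single_one] at this
    exact this
  · rw [bd21, hM.low (by rw [Fin.lt_def]; simp; omega)]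
  · simp
end

def bdU {b a : ℕ} (x : UU F b × UU F a) : UU F (b+a) := ⟨mkU _ (bd_up x.1.1.1 x.2.1.1 x.1.2 x.2.2), mkU_mem _ _⟩

lemma bdU_inj {b a : ℕ} : Function.Injective (bdU : UU F b × UU F a → _) := by
  intro x y h
  have h1 : bd x.1.1.1 x.2.1.1 = bd y.1.1.1 y.2.1.1 := congrArg (fun u : UU F (b+a) => u.1.1) h
  refine Prod.ext (Subtype.ext (Units.ext ?_)) (Subtype.ext (Units.ext ?_))
  · ext i j; rw [← bd11 x.1.1.1 x.2.1.1, h1, bd11]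
  · ext i j; rw [← bd22 x.1.1.1 x.2.1.1, h1, bd22]

lemma up_sub {b a : ℕ} {M : Matrix (Fin (b+a)) (Fin (b+a)) F} (hM : IsUp M) :
    IsUp (Matrix.of fun i j => M (Fin.castAdd a i) (Fin.castAdd a j)) ∧ IsUp (Matrix.of fun i j => M (Fin.natAdd b i) (Fin.natAdd b j)) := by
  constructor
  · intro i j h
    rw [Matrix.of_apply, hM _ _ (show Fin.castAdd a j ≤ Fin.castAdd a i from h)]; simp
  · intro i j h
    rw [Matrix.of_apply, hM _ _ (by simpa using h)]; simp

def Stb (b a : ℕ) : Finset (UU F (b+a)) := Finset.univ.filter fun u => ∀ x ∈ W0 F b a, u.1.1.mulVecLin x ∈ W0 F b a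

lemma Stb_eq (b a : ℕ) : (Stb b a : Finset (UU F (b+a))) = Finset.univ.image bdU := by
  ext u
  rw [Stb, Finset.mem_filter, Finset.mem_image]
  constructor
  · rintro ⟨-, h⟩
    have h1 := bd_of u.2 h
    have h2 := up_sub (F := F) u.2
    exact ⟨(⟨mkU _ h2.1, mkU_mem _ _⟩, ⟨mkU _ h2.2, mkU_mem _ _⟩), Finset.mem_univ _, Subtype.ext (Units.ext h1.symm)⟩
  · rintro ⟨x, -, rfl⟩
    refine ⟨Finset.mem_univ _, ?_⟩
    rintro _ ⟨y, rfl⟩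
    exact ⟨_, (bd_inr _ _ y).symm⟩

lemma Stb_card (b a : ℕ) : (Stb b a : Finset (UU F (b+a))).card = Nat.card (UU F b) * Nat.card (UU F a) := by
  rw [Stb_eq, Finset.card_image_of_injective _ bdU_inj, Finset.card_univ, Fintype.card_prod, Nat.card_eq_fintype_card, Nat.card_eq_fintype_card]

lemma TW_0 (ψ : AddChar F ℂ) (α X : CF F) (b a : ℕ) : TW ψ α X (W0 F b a) =
    (∑ u, wt ψ b u * res b X u) * ∑ u, wt ψ a u * res a α u := by
  rw [Finset.sum_mul_sum, ← Fintype.sum_prod_type', TW]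
  rw [← Finset.sum_subset (Finset.subset_univ (Stb b a)), Stb_eq, Finset.sum_image fun x _ y _ h => bdU_inj h]
  · refine Finset.sum_congr rfl fun x _ => ?_
    have h1 : sub α (W0 F b a) (bdU x).1.1.mulVecLin = res a α x.2 :=
      sub_eq α (inrF b a) (inrF_inj b a) rfl _ fun y => bd_inr _ _ y
    have h2 : quo X (W0 F b a) (bdU x).1.1.mulVecLin = res b X x.1 :=
      quo_eq X (fstF b a) (fstF_surj b a) (ker_fstF b a).symm _ fun y => bd_fst _ _ y
    have h3 : wt ψ (b+a) (bdU x) = wt ψ b x.1 * wt ψ a x.2 := by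
      rw [wt_apply, wt_apply, wt_apply, ← AddChar.map_add_eq_mul, ← bd_tr]; rfl
    rw [h1, h2, h3]; ring
  · intro u _ hu
    rw [sub_zero fun h => hu (Finset.mem_filter.2 ⟨Finset.mem_univ _, h⟩)]; simp

def gle {n : ℕ} (u : GL (Fin n) F) : (Fin n → F) ≃ₗ[F] (Fin n → F) :=
  LinearMap.GeneralLinearGroup.toLinearEquiv (Matrix.GeneralLinearGroup.toLin u)

lemma gle_apply {n : ℕ} (u : GL (Fin n) F) (x : Fin n → F) : gle u x = u.1 *ᵥ x := rfl

lemma TW_map (ψ : AddChar F ℂ) (α X : CF F) {n : ℕ} (W : Submodule F (Fin n → F)) (v : UU F n) :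
    TW ψ α X (W.map (gle v.1 : (Fin n → F) →ₗ[F] (Fin n → F))) = TW ψ α X W := by
  symm
  refine Fintype.sum_equiv (MulAut.conj v).toEquiv _ _ fun u => ?_
  have h : ∀ x, gle v.1 (u.1.1.mulVecLin x) = (v * u * v⁻¹).1.1.mulVecLin (gle v.1 x) := fun x => by
    rw [gle_apply, gle_apply, Matrix.mulVecLin_apply, Matrix.mulVecLin_apply, Matrix.mulVec_mulVec, Matrix.mulVec_mulVec]
    show _ = ((v.1 * u.1 * v.1⁻¹).1 * v.1.1) *ᵥ x
    rw [← Units.val_mul, ← Units.val_mul, inv_mul_cancel_right]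
  show _ = wt ψ n (v * u * v⁻¹) * (sub α _ (v * u * v⁻¹).1.1.mulVecLin * quo X _ (v * u * v⁻¹).1.1.mulVecLin)
  rw [sub_map α (gle v.1) _ _ h, quo_map X (gle v.1) _ _ h]
  congr 1
  have hv : wt ψ n v * wt ψ n v⁻¹ = 1 := by rw [← map_mul, mul_inv_cancel, map_one]
  rw [map_mul, map_mul]
  linear_combination -(wt ψ n u) * hv

lemma exists_u {b a : ℕ} (W : Submodule F (Fin (b+a) → F)) (hf : finrank F W = a) (hW : W ⊓ EE F (b+a) b = ⊥) :
    ∃ v : UU F (b+a), (W0 F b a).map (gle v.1 : (Fin (b+a) → F) →ₗ[F] _) = W := by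
  let p : W →ₗ[F] (Fin a → F) := sndF b a ∘ₗ W.subtype
  have hp : Function.Injective p := by
    rw [injective_iff_map_eq_zero]
    intro x hx
    have : x.1 ∈ W ⊓ EE F (b+a) b := ⟨x.2, by rw [EE_rg, ker_sndF]; exact hx⟩
    rw [hW] at this
    exact Subtype.ext this
  let e : W ≃ₗ[F] (Fin a → F) := LinearEquiv.ofInjectiveOfFinrankEq p hp (by rw [hf, finrank_fin])
  have he : ∀ y i, (e.symm y).1 (Fin.natAdd b i) = y i := fun y i => by
    have : p (e.symm y) = y := e.apply_symm_apply y
    exact congrFun this i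
  let T : End F (Fin (b+a) → F) := inlF b a ∘ₗ fstF b a + W.subtype ∘ₗ e.symm.toLinearMap ∘ₗ sndF b a
  have hT : ∀ x, T x = inlF b a (fstF b a x) + (e.symm (sndF b a x)).1 := fun x => rfl
  have hup : IsUp (LinearMap.toMatrix' T) := by
    intro r c
    rw [LinearMap.toMatrix'_apply, hT, Pi.add_apply]
    refine Fin.addCases (fun c => ?_) (fun c => ?_) c
    · intro h
      have : sndF b a (Pi.single (Fin.castAdd a c) (1:F)) = 0 := by
        ext k; rw [sndF_a]; exact Pi.single_eq_of_ne (by intro h; have := congrArg Fin.val h; simp at this; omega) _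
      rw [this, map_zero]
      have h2 : inlF b a (fstF b a (Pi.single (Fin.castAdd a c) (1:F))) = Pi.single (Fin.castAdd a c) 1 := by
        ext k
        refine Fin.addCases (fun k => ?_) (fun k => ?_) k
        · rw [inlF_l]; rfl
        · rw [inlF_r]; exact (congrFun this k).symm
      rw [h2, Pi.single_apply]; simp
    · refine Fin.addCases (fun r => ?_) (fun r => ?_) r
      · intro h; rw [Fin.le_def] at h; simp at h; omega
      · intro h
        rw [inlF_r, he, sndF_a, Pi.single_apply, zero_add]
  refine ⟨⟨mkU _ hup, mkU_mem _ _⟩, ?_⟩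
  have hg : ∀ x, gle (mkU _ hup) x = T x := fun x => by
    rw [gle_apply]
    show LinearMap.toMatrix' T *ᵥ x = T x
    rw [← Matrix.toLin'_apply, Matrix.toLin'_toMatrix']
  have h0 : ∀ y, T (inrF b a y) = (e.symm y).1 := fun y => by
    have h1 : fstF b a (inrF b a y) = 0 := by ext i; simp
    have h2 : sndF b a (inrF b a y) = y := by ext i; simp
    rw [hT, h1, h2, map_zero, zero_add]
  ext x
  constructor
  · rintro ⟨_, ⟨y, rfl⟩, rfl⟩
    show gle (mkU _ hup) (inrF b a y) ∈ W
    rw [hg, h0]; exact Subtype.property _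
  · intro hx
    refine ⟨inrF b a (e ⟨x, hx⟩), ⟨_, rfl⟩, ?_⟩
    show gle (mkU _ hup) _ = _
    rw [hg, h0, LinearEquiv.symm_apply_apply]

theorem dlt_mul (ψ : AddChar F ℂ) (hψ : ψ.IsPrimitive) (α X : CF F) {a b n : ℕ} (hα : Deg α a) (hn : n = a + b) :
    dlt ψ n (res n (mulC α X)) = dlt ψ a (res a α) * dlt ψ b (res b X) := by
  rw [add_comm] at hn
  subst hn
  have h1 : ∑ u : UU F (b+a), wt ψ (b+a) u * res (b+a) (mulC α X) u = ∑ W : Submodule F (Fin (b+a) → F), TW ψ α X W := by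
    simp only [TW]
    rw [Finset.sum_comm]
    refine Finset.sum_congr rfl fun u _ => ?_
    rw [← Finset.mul_sum]; rfl
  let mp : UU F (b+a) → Submodule F (Fin (b+a) → F) := fun u => (W0 F b a).map (gle u.1 : (Fin (b+a) → F) →ₗ[F] _)
  have hmem : ∀ (v u : UU F (b+a)), mp (v * u) = mp v ↔ u ∈ (Stb b a : Finset (UU F (b+a))) := fun v u => by
    have e1 : mp (v * u) = (mp u).map (gle v.1 : (Fin (b+a) → F) →ₗ[F] _) := by
      show Submodule.map _ _ = Submodule.map _ (Submodule.map _ _)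
      rw [← Submodule.map_comp]
      congr 1
      refine LinearMap.ext fun x => ?_
      exact (Matrix.mulVec_mulVec x v.1.1 u.1.1).symm
    rw [e1, (Submodule.map_injective_of_injective (gle v.1).injective).eq_iff, Stb, Finset.mem_filter]
    constructor
    · intro h
      refine ⟨Finset.mem_univ _, fun x hx => ?_⟩
      have : gle u.1 x ∈ mp u := ⟨x, hx, rfl⟩
      rw [h] at this
      exact this
    · rintro ⟨-, h⟩
      refine Submodule.eq_of_le_of_finrank_eq ?_ ?_
      · rintro _ ⟨x, hx, rfl⟩; exact h x hx
      · exact LinearEquiv.finrank_map_eq (gle u.1) _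
  have h2 : ((Stb b a : Finset (UU F (b+a))).card : ℂ) * ∑ W : Submodule F (Fin (b+a) → F), TW ψ α X W =
      Nat.card (UU F (b+a)) * TW ψ α X (W0 F b a) := by
    have h3 : ∑ u : UU F (b+a), TW ψ α X (mp u) = Nat.card (UU F (b+a)) * TW ψ α X (W0 F b a) := by
      rw [Finset.sum_congr rfl fun u _ => TW_map ψ α X (W0 F b a) u, Finset.sum_const, Finset.card_univ, nsmul_eq_mul, Nat.card_eq_fintype_card]
    rw [← h3, ← Finset.sum_fiberwise Finset.univ mp, Finset.mul_sum]
    refine Finset.sum_congr rfl fun W _ => ?_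
    rw [Finset.sum_congr rfl (g := fun _ => TW ψ α X W) (by intro u hu; rw [(Finset.mem_filter.1 hu).2]), Finset.sum_const, nsmul_eq_mul]
    by_cases hT : TW ψ α X W = 0
    · rw [hT, mul_zero, mul_zero]
    · obtain ⟨hf, hd⟩ := T_good ψ hψ α X hα W hT
      obtain ⟨v, rfl⟩ := exists_u W hf hd
      congr 2
      refine Finset.card_bij (fun u _ => v * u) ?_ ?_ ?_
      · intro u hu; rw [Finset.mem_filter]; exact ⟨Finset.mem_univ _, (hmem v u).2 hu⟩
      · intro u _ u' _ h; exact mul_left_cancel h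
      · intro u hu
        refine ⟨v⁻¹ * u, (hmem v _).1 ?_, by simp⟩
        rw [mul_inv_cancel_left]; exact (Finset.mem_filter.1 hu).2
  rw [Stb_card, TW_0] at h2
  simp only [dlt]
  rw [h1]
  have ha := U_ne (F := F) a
  have hb := U_ne (F := F) b
  have hab := U_ne (F := F) (b+a)
  push_cast at h2
  field_simp
  linear_combination h2

lemma dlt_R (ψ : AddChar F ℂ) (hψ : ψ.IsPrimitive) (l : List (Cu F)) :
    ∀ n, dg l = n → dlt ψ n (res n (R l)) = (l.map fun ρ => dlt ψ ρ.m ρ.χ.1).prod := by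
  induction l with
  | nil =>
    rintro n rfl
    have : ∀ x : GL (Fin 0) F, res 0 (R []) x = 1 := fun x => by
      show (oneC : CF F).f (Fin 0 → F) _ = 1
      simp [oneC]
    show (Nat.card (UU F 0) : ℂ)⁻¹ * ∑ u : UU F 0, wt ψ 0 u * res 0 (R []) u = 1
    have hw : ∀ u : UU F 0, wt ψ 0 u = 1 := fun u => by
      have : u = 1 := Subtype.ext (Subsingleton.elim _ _)
      rw [this, map_one]
    simp only [this, hw, mul_one, Finset.sum_const, Finset.card_univ, nsmul_eq_mul, ← Nat.card_eq_fintype_card]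
    exact inv_mul_cancel₀ (U_ne 0)
  | cons ρ l ih =>
    intro n hn
    rw [R, dlt_mul ψ hψ ρ.cf (R l) ofC_deg (hn ▸ rfl : n = ρ.m + dg l), ih _ rfl, Cu.cf, res_ofC (irr_conj _), List.map_cons, List.prod_cons]

end CT
end

noncomputable section
set_option linter.all false
namespace CT
open Module
attribute [local instance] Classical.propDecidable
variable {F : Type} [Field F] [Fintype F]

lemma ivt (f : ℕ → ℕ) (a w : ℕ) (ha : w < f a) : ∀ b, a ≤ b → (∀ i, a ≤ i → i < b → f i ≤ f (i+1) + 1) → f b ≤ w →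
    ∃ c, a ≤ c ∧ c ≤ b ∧ f c = w := by
  intro b
  induction b with
  | zero => intro h _ h2; have : a = 0 := by omega
            subst this; omega
  | succ b ih =>
    intro h hs h2
    by_cases hb : a = b + 1
    · subst hb; omega
    by_cases h3 : f b ≤ w
    · obtain ⟨c, h4, h5, h6⟩ := ih (by omega) (fun i hi hi' => hs i hi (by omega)) h3
      exact ⟨c, h4, by omega, h6⟩
    · have := hs b (by omega) (by omega)
      exact ⟨b+1, by omega, le_rfl, by omega⟩

lemma comb {T : Type} (n : ℕ) (f : ℕ → ℕ) (t : ℕ → T) (hlt : ∀ i, i < n → f i < n)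
    (hinj : ∀ i j, i < n → j < n → f i = f j → i = j)
    (hst : ∀ i, i + 1 < n → f i < f (i+1) ∨ (f i = f (i+1) + 1 ∧ t i = t (i+1))) :
    ∀ k, k < n → f (f k) = k ∧ t (f k) = t k := by
  have hsurj : ∀ k, k < n → ∃ j, j < n ∧ f j = k := by
    intro k hk
    have h1 : Function.Injective (fun i : Fin n => (⟨f i, hlt i i.2⟩ : Fin n)) := fun i j h => by
      ext; exact hinj i j i.2 j.2 (by simpa using h)
    obtain ⟨j, hj⟩ := (Finite.injective_iff_surjective.1 h1) ⟨k, hk⟩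
    exact ⟨j, j.2, by simpa using hj⟩
  intro k
  induction k using Nat.strong_induction_on with
  | _ k ih =>
  intro hk
  rcases lt_trichotomy (f k) k with h | h | h
  · obtain ⟨h1, h2⟩ := ih (f k) h (hlt k hk)
    have h3 := hinj _ _ (hlt _ (hlt _ hk)) hk h1
    exact ⟨h3, by rw [h3] at h2; exact h2.symm⟩
  · rw [h]; exact ⟨h, rfl⟩
  · obtain ⟨j, hj, hjk⟩ := hsurj k hk
    have hjk' : k < j := by
      rcases lt_trichotomy j k with h1 | h1 | h1
      · have := (ih j h1 hj).1
        rw [hjk] at this; omega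
      · subst h1; omega
      · exact h1
    have claim : ∀ s, s ≤ f k - k → k + s ≤ j ∧ f (k+s) + s = f k ∧ t (k+s) = t k := by
      intro s
      induction s with
      | zero => intro _; exact ⟨by omega, rfl, rfl⟩
      | succ s is =>
        intro hs
        obtain ⟨h1, h2, h3⟩ := is (by omega)
        have h4 : k + s ≠ j := by intro h5; rw [h5] at h2; omega
        rcases hst (k+s) (by omega) with h5 | ⟨h5, h6⟩
        · exfalso
          obtain ⟨c, hc1, hc2, hc3⟩ := ivt f (k+s+1) (f (k+s)) h5 j (by omega) (fun i _ hi => by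
            rcases hst i (by omega) with h | ⟨h, _⟩ <;> omega) (by omega)
          have := hinj c (k+s) (by omega) (by omega) hc3
          omega
        · exact ⟨by omega, by show f (k+s+1) + (s+1) = f k; omega, by show t (k+s+1) = _; rw [← h6, h3]⟩
    obtain ⟨h1, h2, h3⟩ := claim (f k - k) le_rfl
    have h4 : k + (f k - k) = f k := by omega
    rw [h4] at h2 h3
    exact ⟨by omega, h3⟩

def mono {n : ℕ} (π : Fin n → Fin n) (t : Fin n → F) : Matrix (Fin n) (Fin n) F :=
  Matrix.of fun r c => if r = π c then t c else 0

lemma comb_fin {n : ℕ} (κ : Fin n → Fin n) (t : Fin n → F) (hκ : Function.Injective κ)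
    (hst : ∀ i j : Fin n, j.val = i.val + 1 → κ i < κ j ∨ ((κ i).val = (κ j).val + 1 ∧ t i = t j)) (k : Fin n) :
    κ (κ k) = k ∧ t (κ k) = t k := by
  have h := comb n (fun i => if h : i < n then κ ⟨i, h⟩ else 0) (fun i => if h : i < n then t ⟨i, h⟩ else 0)
    (fun i hi => by simp [hi]) (fun i j hi hj h => by
      simp only [hi, hj, dif_pos] at h
      have := hκ (Fin.ext h)
      simpa using this) (fun i hi => by
      have hi' : i < n := by omega
      simp only [hi, hi', dif_pos]
      exact hst ⟨i, hi'⟩ ⟨i+1, hi⟩ rfl) k.1 k.2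
  simp only [k.2, dif_pos, (κ k).2] at h
  exact ⟨Fin.ext h.1, h.2⟩

lemma bruhat_step {n : ℕ} (g : GL (Fin n) F) (k : ℕ) (hk : k ≤ n) : ∃ u ∈ UU F n, ∃ v ∈ UU F n,
    ∀ c : Fin n, c.val < k → ∃ r, (u * g * v).1 r c ≠ 0 ∧ (∀ r', r' ≠ r → (u * g * v).1 r' c = 0) ∧
      (∀ c', c' ≠ c → (u * g * v).1 r c' = 0) := by
  induction k with
  | zero => exact ⟨1, one_mem _, 1, one_mem _, fun c hc => by omega⟩
  | succ k ih =>
    obtain ⟨u, hu, v, hv, h⟩ := ih (by omega)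
    set M : GL (Fin n) F := u * g * v with hM
    set c0 : Fin n := ⟨k, hk⟩
    have hne : ∃ r, M.1 r c0 ≠ 0 := by
      by_contra hcon
      push Not at hcon
      have h1 : (M⁻¹.1 * M.1) c0 c0 = 0 := by
        rw [Matrix.mul_apply]; exact Finset.sum_eq_zero fun x _ => by rw [hcon, mul_zero]
      rw [← Units.val_mul, inv_mul_cancel] at h1
      simp at h1
    obtain ⟨i, hi, hmax⟩ : ∃ i, M.1 i c0 ≠ 0 ∧ ∀ r, i < r → M.1 r c0 = 0 := by
      obtain ⟨i, hi, hm⟩ := Finset.exists_max_image (Finset.univ.filter fun r => M.1 r c0 ≠ 0) id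
        ⟨hne.choose, by simpa using hne.choose_spec⟩
      refine ⟨i, by simpa using hi, fun r hr => ?_⟩
      by_contra hc
      exact absurd (hm r (by simpa using hc)) (not_le.2 hr)
    have hrow : ∀ c, c < c0 → M.1 i c = 0 := by
      intro c hc
      obtain ⟨r, h1, h2, h3⟩ := h c hc
      by_cases hir : i = r
      · subst hir
        exact absurd (h3 c0 hc.ne') hi
      · exact h2 i hir
    set x : Fin n → F := fun r => if r = i then 0 else M.1 r c0 / M.1 i c0 with hx
    set y : Fin n → F := fun c => if c = c0 then 0 else M.1 i c / M.1 i c0 with hy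
    let A : Matrix (Fin n) (Fin n) F := Matrix.of fun r c => (if r = c then 1 else 0) - x r * (if c = i then 1 else 0)
    let B : Matrix (Fin n) (Fin n) F := Matrix.of fun r c => (if r = c then 1 else 0) - (if r = c0 then 1 else 0) * y c
    have hA : IsUp A := fun r c hrc => by
      simp only [A, Matrix.of_apply]
      by_cases hc : c = i
      · subst hc
        rcases hrc.eq_or_lt with h1 | h1
        · simp [hx, h1]
        · simp [hx, hmax r h1]
      · simp [hc]
    have hB : IsUp B := fun r c hrc => by
      simp only [B, Matrix.of_apply]
      by_cases hc : r = c0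
      · subst hc
        rcases hrc.eq_or_lt with h1 | h1
        · simp [hy, h1]
        · simp [hy, hrow c h1]
      · simp [hc]
    have e1 : ∀ N : Matrix (Fin n) (Fin n) F, ∀ r c, (A * N) r c = N r c - x r * N i c := fun N r c => by
      simp [A, Matrix.mul_apply, sub_mul, Finset.sum_sub_distrib]
    have e2 : ∀ N : Matrix (Fin n) (Fin n) F, ∀ r c, (N * B) r c = N r c - N r c0 * y c := fun N r c => by
      simp [B, Matrix.mul_apply, mul_sub, Finset.sum_sub_distrib]
    have e3 : ∀ r c, (A * M.1 * B) r c = M.1 r c - x r * M.1 i c - (M.1 r c0 - x r * M.1 i c0) * y c := fun r c => by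
      rw [e2, e1, e1]
    refine ⟨mkU A hA * u, mul_mem (mkU_mem A hA) hu, v * mkU B hB, mul_mem hv (mkU_mem B hB), ?_⟩
    have e4 : (mkU A hA * u * g * (v * mkU B hB)).1 = A * M.1 * B := by
      have : mkU A hA * u * g * (v * mkU B hB) = mkU A hA * M * mkU B hB := by rw [hM]; group
      rw [this]; rfl
    rw [e4]
    have hcol : ∀ r, r ≠ i → M.1 r c0 - x r * M.1 i c0 = 0 := fun r hr => by
      simp only [hx, if_neg hr]; field_simp; ring
    have hxi : x i = 0 := by simp [hx]
    have hyc : y c0 = 0 := by simp [hy]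
    intro c hc
    by_cases hcc : c = c0
    · subst hcc
      refine ⟨i, ?_, fun r' hr' => ?_, fun c' hc' => ?_⟩
      · rw [e3, hxi, hyc]; simpa using hi
      · rw [e3, hcol r' hr']; simp
      · rw [e3, hxi]; simp only [hy, if_neg hc']; field_simp; ring
    · have hc' : c.val < k := by
        have : c.val ≠ k := fun h => hcc (Fin.ext h)
        omega
      obtain ⟨r, h1, h2, h3⟩ := h c hc'
      have hri : r ≠ i := by rintro rfl; exact hi (h3 c0 (Ne.symm hcc))
      have hMi : M.1 i c = 0 := h2 i (Ne.symm hri)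
      have hyc' : y c = 0 := by simp [hy, hMi]
      have hxr : x r = 0 := by simp [hx, h3 c0 (Ne.symm hcc)]
      refine ⟨r, ?_, fun r' hr' => ?_, fun c' hc' => ?_⟩
      · rw [e3, hyc', hMi]; simpa using h1
      · rw [e3, hyc', hMi, h2 r' hr']; simp
      · rw [e3, hxr, h3 c0 (Ne.symm hcc), h3 c' hc']; simp

lemma bruhat {n : ℕ} (g : GL (Fin n) F) : ∃ u ∈ UU F n, ∃ v ∈ UU F n, ∃ (π : Fin n → Fin n) (t : Fin n → F),
    Function.Injective π ∧ (∀ i, t i ≠ 0) ∧ (u * g * v).1 = mono π t := by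
  obtain ⟨u, hu, v, hv, h⟩ := bruhat_step g n le_rfl
  choose π h1 h2 h3 using fun c => h c c.2
  refine ⟨u, hu, v, hv, π, fun c => (u * g * v).1 (π c) c, fun i j hij => ?_, h1, ?_⟩
  · by_contra hne
    have := h3 i j (Ne.symm hne)
    rw [hij] at this
    exact h1 j this
  · ext r c
    simp only [mono, Matrix.of_apply]
    split_ifs with hr
    · rw [hr]
    · exact h2 c r hr

lemma mono_mul {n : ℕ} (π : Fin n → Fin n) (t : Fin n → F) (v : Matrix (Fin n) (Fin n) F) (hπ : Function.Injective π) (k c : Fin n) :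
    (mono π t * v) (π k) c = t k * v k c := by
  rw [Matrix.mul_apply, Finset.sum_eq_single k]
  · simp [mono]
  · intro b _ hb
    simp [mono, hπ.eq_iff, hb.symm]
  · simp

lemma mul_mono {n : ℕ} (π : Fin n → Fin n) (t : Fin n → F) (u : Matrix (Fin n) (Fin n) F) (r c : Fin n) :
    (u * mono π t) r c = u r (π c) * t c := by
  rw [Matrix.mul_apply, Finset.sum_eq_single (π c)]
  · simp [mono]
  · intro b _ hb
    simp [mono, hb]
  · simp

/-- the anti-automorphism -/
def thM {n : ℕ} (M : Matrix (Fin n) (Fin n) F) : Matrix (Fin n) (Fin n) F := Matrix.of fun r c => M c.rev r.rev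

lemma thM_mul {n : ℕ} (M N : Matrix (Fin n) (Fin n) F) : thM (M * N) = thM N * thM M := by
  ext r c
  simp only [thM, Matrix.of_apply, Matrix.mul_apply]
  rw [← Equiv.sum_comp Fin.revPerm]
  exact Finset.sum_congr rfl fun k _ => by simp [mul_comm]

lemma thM_one {n : ℕ} : thM (1 : Matrix (Fin n) (Fin n) F) = 1 := by
  ext r c; simp [thM, Matrix.one_apply, Fin.rev_inj, eq_comm]

lemma thM_thM {n : ℕ} (M : Matrix (Fin n) (Fin n) F) : thM (thM M) = M := by
  ext r c; simp [thM]

def th {n : ℕ} (g : GL (Fin n) F) : GL (Fin n) F :=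
  ⟨thM g.1, thM g⁻¹.1, by rw [← thM_mul, ← Units.val_mul, inv_mul_cancel]; exact thM_one,
    by rw [← thM_mul, ← Units.val_mul, mul_inv_cancel]; exact thM_one⟩

lemma th_val {n : ℕ} (g : GL (Fin n) F) : (th g).1 = thM g.1 := rfl
lemma th_mul {n : ℕ} (g h : GL (Fin n) F) : th (g * h) = th h * th g := Units.ext (thM_mul _ _)
lemma th_th {n : ℕ} (g : GL (Fin n) F) : th (th g) = g := Units.ext (thM_thM _)

lemma th_mem {n : ℕ} {g : GL (Fin n) F} (hg : g ∈ UU F n) : th g ∈ UU F n := by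
  intro i j hij
  show g.1 j.rev i.rev = _
  rw [show g.1 j.rev i.rev = _ from hg j.rev i.rev (Fin.rev_le_rev.2 hij)]
  simp [Fin.rev_inj, eq_comm]

lemma tr1_th {n : ℕ} (M : Matrix (Fin n) (Fin n) F) : tr1 (thM M) = tr1 M := by
  rw [tr1, Finset.sum_comm, tr1, ← Equiv.sum_comp Fin.revPerm]
  refine Finset.sum_congr rfl fun i _ => ?_
  rw [← Equiv.sum_comp Fin.revPerm]
  refine Finset.sum_congr rfl fun j _ => ?_
  simp only [Fin.revPerm_apply, thM, Matrix.of_apply, Fin.rev_rev, Fin.val_rev]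
  congr 1
  apply propext
  have := i.2; have := j.2
  omega

end CT
end

noncomputable section
set_option linter.all false
namespace CT
open Module
attribute [local instance] Classical.propDecidable
variable {F : Type} [Field F] [Fintype F]

section
variable {n : ℕ} (ψ : AddChar F ℂ) (S : IR (GL (Fin n) F))

def We : Module.End ℂ S.V := (Nat.card (UU F n) : ℂ)⁻¹ • ∑ u : UU F n, wt ψ n u • S.ρ u.1

def Fn (k : GL (Fin n) F) : Module.End ℂ S.V := We ψ S * S.ρ k * We ψ S

lemma wt_ne (u : UU F n) : wt ψ n u ≠ 0 := by
  intro h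
  have : wt ψ n (u * u⁻¹) = 1 := by rw [mul_inv_cancel, map_one]
  rw [map_mul, h, zero_mul] at this
  exact zero_ne_one this

lemma We_mul (w : UU F n) : wt ψ n w • (We ψ S * S.ρ w.1) = We ψ S := by
  rw [We, smul_mul_assoc, smul_comm, Finset.sum_mul, Finset.smul_sum]
  conv_rhs => rw [← Equiv.sum_comp (Equiv.mulRight w)]
  congr 1
  refine Finset.sum_congr rfl fun u _ => ?_
  rw [Equiv.coe_mulRight, map_mul, Subgroup.coe_mul, map_mul, smul_mul_assoc, smul_smul, mul_comm]

lemma mul_We (w : UU F n) : wt ψ n w • (S.ρ w.1 * We ψ S) = We ψ S := by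
  rw [We, mul_smul_comm, smul_comm, Finset.mul_sum, Finset.smul_sum]
  conv_rhs => rw [← Equiv.sum_comp (Equiv.mulLeft w)]
  congr 1
  refine Finset.sum_congr rfl fun u _ => ?_
  rw [Equiv.coe_mulLeft, map_mul, Subgroup.coe_mul, map_mul, mul_smul_comm, smul_smul]

lemma We_idem : We ψ S * We ψ S = We ψ S := by
  conv_lhs => enter [1]; rw [We]
  rw [smul_mul_assoc, Finset.sum_mul]
  simp only [smul_mul_assoc, mul_We]
  rw [Finset.sum_const, Finset.card_univ, ← Nat.card_eq_fintype_card, ← Nat.cast_smul_eq_nsmul ℂ, smul_smul,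
    inv_mul_cancel₀ (U_ne n), one_smul]

lemma trace_We : LinearMap.trace ℂ S.V (We ψ S) = dlt ψ n (chr S) := by
  simp [We, dlt, chr, Representation.character]

lemma Fn_l (w : UU F n) (k : GL (Fin n) F) : wt ψ n w • Fn ψ S (w.1 * k) = Fn ψ S k := by
  rw [Fn, map_mul, ← mul_assoc, ← smul_mul_assoc, ← smul_mul_assoc, We_mul, Fn]

lemma Fn_r (w : UU F n) (k : GL (Fin n) F) : wt ψ n w • Fn ψ S (k * w.1) = Fn ψ S k := by
  rw [Fn, map_mul, mul_assoc, mul_assoc, ← mul_smul_comm, ← mul_smul_comm, mul_We, Fn, mul_assoc]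

lemma Fn_wt {k : GL (Fin n) F} (h0 : Fn ψ S k ≠ 0) (u v : UU F n) (h : u.1 * k = k * v.1) : wt ψ n u = wt ψ n v := by
  have h1 := Fn_l ψ S u k
  have h2 := Fn_r ψ S v k
  rw [h] at h1
  have h3 : Fn ψ S (k * v.1) ≠ 0 := fun h => by rw [h, smul_zero] at h1; exact h0 h1.symm
  have h4 : (wt ψ n u - wt ψ n v) • Fn ψ S (k * v.1) = 0 := by rw [sub_smul, h1, h2, sub_self]
  exact sub_eq_zero.1 ((smul_eq_zero.1 h4).resolve_right h3)

/-- elementary matrix -/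
def el (i j : Fin n) (c : F) : Matrix (Fin n) (Fin n) F := Matrix.of fun r s => (if r = s then 1 else 0) + if r = i ∧ s = j then c else 0

lemma el_up {i j : Fin n} (h : i < j) (c : F) : IsUp (el i j c) := fun r s hrs => by
  rw [el, Matrix.of_apply, if_neg (c := r = i ∧ s = j), add_zero]
  rintro ⟨rfl, rfl⟩; exact absurd h (not_lt.2 hrs)

lemma el_tr {i j : Fin n} (h : i < j) (c : F) : tr1 (el i j c) = if j.val = i.val + 1 then c else 0 := by
  rw [tr1, Finset.sum_eq_single i, Finset.sum_eq_single j]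
  · simp [el, h.ne]
  · intro b _ hb
    have : b.val = i.val + 1 → i ≠ b := by rintro h rfl; omega
    split_ifs with h1
    · simp [el, this h1, hb]
    · rfl
  · simp
  · intro b _ hb
    refine Finset.sum_eq_zero fun s _ => ?_
    have : s.val = b.val + 1 → b ≠ s := by rintro h rfl; omega
    split_ifs with h1
    · simp [el, this h1, hb]
    · rfl
  · simp

lemma Fn_step (hψ : ψ.IsPrimitive) {k : GL (Fin n) F} (h0 : Fn ψ S k ≠ 0) (π : Fin n → Fin n) (t : Fin n → F)
    (hπ : Function.Injective π) (ht : ∀ i, t i ≠ 0) (hk : k.1 = mono π t) (i j : Fin n) (hij : j.val = i.val + 1) :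
    π j < π i ∨ ((π j).val = (π i).val + 1 ∧ t i = t j) := by
  by_contra hcon
  push Not at hcon
  obtain ⟨h1, h2⟩ := hcon
  have hlt : i < j := by rw [Fin.lt_def]; omega
  have h1' : π i < π j := lt_of_le_of_ne h1 (fun h => hlt.ne (hπ h))
  set a : F := if (π j).val = (π i).val + 1 then t i / t j else 0 with ha
  have ha1 : 1 - a ≠ 0 := by
    rw [ha]
    split_ifs with h3
    · intro h4
      have h5 : t i / t j = 1 := (sub_eq_zero.1 h4).symm
      rw [div_eq_one_iff_eq (ht j)] at h5
      exact h2 h3 h5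
    · simp
  apply hψ ha1
  ext c
  have h3 := Fn_wt ψ S h0 ⟨_, mkU_mem _ (el_up h1' (c * (t i / t j)))⟩ ⟨_, mkU_mem _ (el_up hlt c)⟩ (by
    apply Units.ext
    show el _ _ _ * k.1 = k.1 * el _ _ _
    rw [hk]
    ext r s
    obtain ⟨r, rfl⟩ := Finite.injective_iff_surjective.1 hπ r
    rw [mono_mul π t _ hπ, mul_mono]
    simp only [el, Matrix.of_apply, hπ.eq_iff]
    by_cases h4 : r = s
    · subst h4
      have : ¬ (r = i ∧ r = j) := by rintro ⟨rfl, rfl⟩; exact lt_irrefl _ hlt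
      simp [this]
    · by_cases h5 : r = i ∧ s = j
      · obtain ⟨rfl, rfl⟩ := h5
        have := ht s
        simp [h4]; field_simp
      · simp [h4, h5])
  rw [wt_apply, wt_apply] at h3
  simp only [mkU_val] at h3
  rw [el_tr h1', el_tr hlt, if_pos hij] at h3
  have h4 : (if (π j).val = (π i).val + 1 then c * (t i / t j) else 0) = a * c := by
    rw [ha]; split_ifs <;> ring
  rw [h4] at h3
  rw [AddChar.mulShift_apply, sub_mul, one_mul, sub_eq_add_neg, AddChar.map_add_eq_mul, ← h3, ← AddChar.map_add_eq_mul,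
    add_neg_cancel, AddChar.map_zero_eq_one, AddChar.one_apply]

lemma th_mono (π : Fin n → Fin n) (t : Fin n → F) (hπ : Function.Injective π)
    (hst : ∀ i j : Fin n, j.val = i.val + 1 → π j < π i ∨ ((π j).val = (π i).val + 1 ∧ t i = t j)) :
    thM (mono π t) = mono π t := by
  have hc := comb_fin (fun i => (π i).rev) t (Fin.rev_injective.comp hπ) (fun i j hij => by
    rcases hst i j hij with h | ⟨h, h'⟩
    · left; exact Fin.rev_lt_rev.2 h
    · right; refine ⟨?_, h'⟩
      have := (π j).2
      simp only [Fin.val_rev]; omega)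
  ext r c
  simp only [thM, mono, Matrix.of_apply]
  have h1 : c.rev = π r.rev ↔ r = π c := by
    constructor
    · intro h
      have := (hc r.rev).1
      rw [← h, Fin.rev_rev] at this
      exact (Fin.rev_injective this).symm
    · intro h
      have := (hc c).1
      rw [← h] at this
      rw [← this, Fin.rev_rev]
  by_cases h : r = π c
  · rw [if_pos (h1.2 h), if_pos h, h]; exact (hc c).2
  · rw [if_neg (fun h' => h (h1.1 h')), if_neg h]

lemma Fn_th' (hψ : ψ.IsPrimitive) (k : GL (Fin n) F) (h0 : Fn ψ S k ≠ 0) : Fn ψ S (th k) = Fn ψ S k := by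
  obtain ⟨u, hu, v, hv, π, t, hπ, ht, h⟩ := bruhat k
  have e1 : Fn ψ S k = (wt ψ n ⟨u, hu⟩ * wt ψ n ⟨v, hv⟩) • Fn ψ S (u * k * v) := by
    rw [mul_smul, Fn_r ψ S ⟨v, hv⟩ (u * k), Fn_l ψ S ⟨u, hu⟩ k]
  have h2 : Fn ψ S (u * k * v) ≠ 0 := fun h => by rw [h, smul_zero] at e1; exact h0 e1
  have h3 : th (u * k * v) = u * k * v := Units.ext (by
    rw [th_val, h]; exact th_mono π t hπ (fun i j hij => Fn_step ψ S hψ h2 π t hπ ht h i j hij))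
  have e2 : th (u * k * v) = th v * th k * th u := by rw [th_mul, th_mul, mul_assoc]
  have e3 : Fn ψ S (th k) = (wt ψ n ⟨th u, th_mem hu⟩ * wt ψ n ⟨th v, th_mem hv⟩) • Fn ψ S (th v * th k * th u) := by
    rw [mul_comm, mul_smul, Fn_r ψ S ⟨th u, th_mem hu⟩ (th v * th k), Fn_l ψ S ⟨th v, th_mem hv⟩ (th k)]
  rw [e3, ← e2, h3, e1]
  simp only [wt_apply, th_val, tr1_th]

lemma Fn_th (hψ : ψ.IsPrimitive) (k : GL (Fin n) F) : Fn ψ S (th k) = Fn ψ S k := by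
  by_cases h0 : Fn ψ S k = 0
  · by_contra h1
    have h2 : Fn ψ S (th k) ≠ 0 := fun h => h1 (by rw [h, h0])
    have := Fn_th' ψ S hψ (th k) h2
    rw [th_th] at this
    exact h1 this.symm
  · exact Fn_th' ψ S hψ k h0

lemma Fn_mul (g h : GL (Fin n) F) : Fn ψ S g * Fn ψ S h = (Nat.card (UU F n) : ℂ)⁻¹ • ∑ u : UU F n, wt ψ n u • Fn ψ S (g * u.1 * h) := by
  have e1 : Fn ψ S g * Fn ψ S h = We ψ S * S.ρ g * We ψ S * S.ρ h * We ψ S := by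
    calc _ = We ψ S * S.ρ g * (We ψ S * We ψ S) * S.ρ h * We ψ S := by simp only [Fn, mul_assoc]
    _ = _ := by rw [We_idem]
  have e2 : We ψ S * S.ρ g * We ψ S = (Nat.card (UU F n) : ℂ)⁻¹ • ∑ u : UU F n, wt ψ n u • (We ψ S * S.ρ g * S.ρ u.1) := by
    conv_lhs => enter [2]; rw [We]
    rw [mul_smul_comm, Finset.mul_sum]
    simp only [mul_smul_comm]
  rw [e1, e2, smul_mul_assoc, smul_mul_assoc, Finset.sum_mul, Finset.sum_mul]
  simp only [smul_mul_assoc, Fn, map_mul, mul_assoc]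

def thU : UU F n ≃ UU F n where
  toFun u := ⟨th u.1, th_mem u.2⟩
  invFun u := ⟨th u.1, th_mem u.2⟩
  left_inv u := Subtype.ext (th_th _)
  right_inv u := Subtype.ext (th_th _)

lemma Fn_comm (hψ : ψ.IsPrimitive) (g h : GL (Fin n) F) : Fn ψ S g * Fn ψ S h = Fn ψ S h * Fn ψ S g := by
  have e : Fn ψ S h * Fn ψ S g = Fn ψ S (th h) * Fn ψ S (th g) := by rw [Fn_th ψ S hψ, Fn_th ψ S hψ]
  rw [e, Fn_mul, Fn_mul]
  conv_rhs => rw [← Equiv.sum_comp thU]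
  congr 1
  refine Finset.sum_congr rfl fun u _ => ?_
  have e1 : th h * (thU u).1 * th g = th (g * u.1 * h) := by
    rw [th_mul, th_mul, mul_assoc]; rfl
  have e2 : wt ψ n (thU u) = wt ψ n u := by
    rw [wt_apply, wt_apply]; congr 1; exact tr1_th _
  rw [e1, e2, Fn_th ψ S hψ]
end

section
variable {G : Type} [Group G] [Fintype G]

lemma schur (S : IR G) (A : Module.End ℂ S.V) : ∑ g, S.ρ g * A * S.ρ g⁻¹ =
    ((Nat.card G : ℂ) / chr S 1 * LinearMap.trace ℂ S.V A) • 1 := by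
  set B := ∑ g, S.ρ g * A * S.ρ g⁻¹ with hB
  have hc : ∀ h, B ∘ₗ S.ρ h = S.ρ h ∘ₗ B := by
    intro h
    change B * S.ρ h = S.ρ h * B
    rw [hB, Finset.sum_mul, Finset.mul_sum, ← Equiv.sum_comp (Equiv.mulLeft h)]
    refine Finset.sum_congr rfl fun g _ => ?_
    simp only [Equiv.coe_mulLeft, map_mul, _root_.mul_inv_rev, mul_assoc]
    rw [← map_mul S.ρ h⁻¹ h, inv_mul_cancel, map_one, mul_one]
  obtain ⟨c, hc'⟩ := (Representation.IsIrreducible.algebraMap_intertwiningMap_bijective_of_isAlgClosed (ρ := S.ρ)).2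
    ⟨B, hc⟩
  have h1 : B = c • 1 := by
    ext v
    exact (DFunLike.congr_fun hc' v).symm
  have h2 : LinearMap.trace ℂ S.V B = Nat.card G * LinearMap.trace ℂ S.V A := by
    rw [hB, map_sum]
    have : ∀ g, LinearMap.trace ℂ S.V (S.ρ g * A * S.ρ g⁻¹) = LinearMap.trace ℂ S.V A := fun g => by
      rw [LinearMap.trace_mul_comm, ← mul_assoc, ← map_mul, inv_mul_cancel, map_one, one_mul]
    simp [this]
  have h3 : LinearMap.trace ℂ S.V 1 = chr S 1 := by simp [chr, Representation.character]
  rw [h1, map_smul, h3, smul_eq_mul] at h2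
  rw [h1, div_mul_eq_mul_div, ← h2, mul_div_cancel_right₀ _ (chr_one_ne S)]

lemma schur_sum (S : IR G) : ∑ g, chr S g • S.ρ g⁻¹ = ((Nat.card G : ℂ) / chr S 1) • 1 := by
  have h := op_scalar S (fun g => chr S g⁻¹) (fun g h => by rw [← chr_conj S g⁻¹ h]; congr 1; group)
  have h2 := ip_self S
  rw [ip, inv_mul_eq_one₀ (card_ne G)] at h2
  rw [h2, ← Equiv.sum_comp (Equiv.inv G)]
  simpa [op, mul_comm] using h
end

section
variable {n : ℕ} (ψ : AddChar F ℂ) (S : IR (GL (Fin n) F))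

lemma mult (hψ : ψ.IsPrimitive) (k : GL (Fin n) F) :
    dlt ψ n (chr S) • Fn ψ S k = LinearMap.trace ℂ S.V (S.ρ k * We ψ S) • We ψ S := by
  set E := We ψ S with hE
  have hi : E * E = E := We_idem ψ S
  have h1 : ∑ g, Fn ψ S g * Fn ψ S (g⁻¹ * k) = ((Nat.card (GL (Fin n) F) : ℂ) / chr S 1) • (dlt ψ n (chr S) • Fn ψ S k) := by
    have : ∀ g, Fn ψ S g * Fn ψ S (g⁻¹ * k) = E * (S.ρ g * E * S.ρ g⁻¹) * (S.ρ k * E) := fun g => by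
      calc _ = E * S.ρ g * (E * E) * S.ρ g⁻¹ * S.ρ k * E := by simp only [Fn, mul_assoc, map_mul]; rfl
      _ = _ := by rw [hi]; simp only [mul_assoc]
    simp only [this]
    rw [← Finset.sum_mul, ← Finset.mul_sum, schur, hE, trace_We, mul_smul_comm, smul_mul_assoc, mul_one, smul_smul]
    simp only [Fn, mul_assoc]
  have h2 : ∑ g, Fn ψ S g * Fn ψ S (g⁻¹ * k) = ((Nat.card (GL (Fin n) F) : ℂ) / chr S 1) • (LinearMap.trace ℂ S.V (S.ρ k * E) • E) := by
    have : ∀ g, Fn ψ S g * Fn ψ S (g⁻¹ * k) = E * (S.ρ g⁻¹ * (S.ρ k * E) * S.ρ g) * E := fun g => by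
      rw [Fn_comm ψ S hψ]
      calc _ = E * S.ρ g⁻¹ * S.ρ k * (E * E) * S.ρ g * E := by simp only [Fn, mul_assoc, map_mul]; rfl
      _ = _ := by rw [hi]; simp only [mul_assoc]
    simp only [this]
    have h3 := schur S (S.ρ k * E)
    rw [← Equiv.sum_comp (Equiv.inv _)] at h3
    simp only [Equiv.inv_apply, inv_inv] at h3
    rw [← Finset.sum_mul, ← Finset.mul_sum, h3, mul_smul_comm, smul_mul_assoc, mul_one, hi, smul_smul]
  rw [h1] at h2
  exact smul_right_injective _ (div_ne_zero (card_ne _) (chr_one_ne S)) h2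

lemma tr_sum : ∑ k, LinearMap.trace ℂ S.V (S.ρ k * We ψ S) • S.ρ k⁻¹ = ((Nat.card (GL (Fin n) F) : ℂ) / chr S 1) • We ψ S := by
  have h1 : ∀ k, LinearMap.trace ℂ S.V (S.ρ k * We ψ S) = (Nat.card (UU F n) : ℂ)⁻¹ * ∑ u : UU F n, wt ψ n u * chr S (k * u.1) := fun k => by
    rw [We, mul_smul_comm, Finset.mul_sum, map_smul, map_sum, smul_eq_mul]
    simp [chr, Representation.character]
  have h2 : ∀ u : UU F n, ∑ k, chr S (k * u.1) • S.ρ k⁻¹ = ((Nat.card (GL (Fin n) F) : ℂ) / chr S 1) • S.ρ u.1 := fun u => by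
    have := congrArg (fun A => S.ρ u.1 * A) (schur_sum S)
    simp only [mul_smul_comm, mul_one, Finset.mul_sum, ← map_mul] at this
    rw [← this]
    conv_rhs => rw [← Equiv.sum_comp (Equiv.mulRight u.1)]
    refine Finset.sum_congr rfl fun k _ => ?_
    simp
  simp only [h1, mul_smul, Finset.sum_smul]
  rw [← Finset.smul_sum, Finset.sum_comm]
  simp only [← Finset.smul_sum, h2]
  simp only [smul_comm _ ((Nat.card (GL (Fin n) F) : ℂ) / chr S 1), ← Finset.smul_sum]
  rfl

lemma dlt_one (hψ : ψ.IsPrimitive) (h0 : dlt ψ n (chr S) ≠ 0) : dlt ψ n (chr S) ^ 2 = 1 := by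
  set E := We ψ S with hE
  set δ := dlt ψ n (chr S)
  set c := ((Nat.card (GL (Fin n) F) : ℂ) / chr S 1) with hc
  have hi : E * E = E := We_idem ψ S
  have h1 : ∑ k, (δ • Fn ψ S k) * (S.ρ k⁻¹ * E) = c • ((δ ^ 2) • E) := by
    have : ∀ k, (δ • Fn ψ S k) * (S.ρ k⁻¹ * E) = δ • (E * (S.ρ k * E * S.ρ k⁻¹) * E) := fun k => by
      rw [smul_mul_assoc]; simp only [Fn, mul_assoc]; rfl
    simp only [this]
    rw [← Finset.smul_sum, ← Finset.sum_mul, ← Finset.mul_sum, schur, hE, trace_We, mul_smul_comm, mul_one, smul_mul_assoc, ← hE, hi,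
      smul_smul, smul_smul]
    congr 1
    show δ * (c * δ) = _
    ring
  have h2 : ∑ k, (δ • Fn ψ S k) * (S.ρ k⁻¹ * E) = c • E := by
    have : ∀ k, (δ • Fn ψ S k) * (S.ρ k⁻¹ * E) = E * (LinearMap.trace ℂ S.V (S.ρ k * E) • S.ρ k⁻¹) * E := fun k => by
      rw [mult ψ S hψ k, smul_mul_assoc, mul_smul_comm, smul_mul_assoc, mul_assoc]
    simp only [this]
    rw [← Finset.sum_mul, ← Finset.mul_sum, hE, tr_sum, mul_smul_comm, smul_mul_assoc, ← hE, hi, hi]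
  rw [h1] at h2
  have h3 := smul_right_injective _ (div_ne_zero (card_ne _) (chr_one_ne S)) h2
  have h4 := congrArg (LinearMap.trace ℂ S.V) h3
  rw [map_smul, hE, trace_We, smul_eq_mul] at h4
  exact mul_right_cancel₀ h0 (by rw [one_mul]; exact h4)

lemma We_zero (h0 : dlt ψ n (chr S) = 0) : We ψ S = 0 :=
  LinearMap.IsIdempotentElem.eq_zero_of_trace_eq_zero (We_idem ψ S) (by rw [trace_We, h0])
end

lemma dlt_01 {n : ℕ} (ψ : AddChar F ℂ) (hψ : ψ.IsPrimitive) (χ : Irr (GL (Fin n) F)) (h0 : dlt ψ n χ.1 ≠ 0) : dlt ψ n χ.1 = 1 := by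
  obtain ⟨k, hk⟩ := dlt_nat χ ψ
  have h := dlt_one ψ (rep χ) hψ (by rw [chr_rep]; exact h0)
  rw [chr_rep, hk] at h
  rw [hk]
  have h1 : k ^ 2 = 1 := by exact_mod_cast h
  have : k = 1 := by simpa using h1
  rw [this, Nat.cast_one]

end CT
end

noncomputable section
set_option linter.all false
namespace CT
open Module
attribute [local instance] Classical.propDecidable
variable {F : Type} [Field F] [Fintype F]

variable (F) in
abbrev Adm (n : ℕ) : Type := {x : (Fin n → Fin n) × (Fin n → F) // Function.Injective x.1 ∧ (∀ i, x.2 i ≠ 0) ∧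
  ∀ i j : Fin n, j.val = i.val + 1 → x.1 i < x.1 j ∨ ((x.1 i).val = (x.1 j).val + 1 ∧ x.2 i = x.2 j)}

instance (n : ℕ) : Finite (Adm F n) := by unfold Adm; infer_instance
instance (n : ℕ) : Fintype (Adm F n) := Fintype.ofFinite _

def ext0 {m : ℕ} (κ : Fin (m+1) → Fin (m+1)) (y : F) : Fin (m+2) := if y = 0 then (κ 0).succ else 0

def extA {m : ℕ} (x : Adm F (m+1)) (y : F) : Adm F (m+2) :=
  ⟨(Fin.cons (ext0 x.1.1 y) (fun i => (ext0 x.1.1 y).succAbove (x.1.1 i)), Fin.cons (if y = 0 then x.1.2 0 else y) x.1.2), by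
    obtain ⟨⟨κ, t⟩, h1, h2, h3⟩ := x
    simp only at h1 h2 h3 ⊢
    set p := ext0 κ y with hp
    refine ⟨?_, ?_, ?_⟩
    · rw [Fin.cons_injective_iff]
      refine ⟨?_, p.succAboveEmb.injective.comp h1⟩
      rintro ⟨i, hi⟩; exact Fin.succAbove_ne _ _ hi
    · intro i
      refine Fin.cases ?_ (fun i => ?_) i
      · simp only [Fin.cons_zero]; split_ifs with h
        · exact h2 0
        · exact h
      · simp only [Fin.cons_succ]; exact h2 i
    · intro i j
      refine Fin.cases ?_ (fun j => ?_) j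
      · intro h; simp at h
      refine Fin.cases ?_ (fun i => ?_) i
      · intro h
        have hj : j = 0 := by ext; simpa using h
        subst hj
        simp only [Fin.cons_succ, Fin.cons_zero]
        by_cases hy : y = 0
        · right
          have : p = (κ 0).succ := by rw [hp, ext0, if_pos hy]
          rw [this, if_pos hy, Fin.succAbove_of_castSucc_lt _ _ (by rw [Fin.lt_def]; simp)]
          simp
        · left
          have : p = 0 := by rw [hp, ext0, if_neg hy]
          rw [this]; simp
      · intro h
        have hij : j.val = i.val + 1 := by simpa using h
        simp only [Fin.cons_succ]
        rcases h3 i j hij with h4 | ⟨h4, h5⟩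
        · left; exact Fin.succAbove_lt_succAbove_iff.2 h4
        · right
          refine ⟨?_, h5⟩
          have hbad : p.val ≠ (κ i).val := by
            by_cases hy : y = 0
            · have : p = (κ 0).succ := by rw [hp, ext0, if_pos hy]
              rw [this, h4]; intro h6
              have h7 : κ 0 = κ j := by ext; simpa using h6
              have := h1 h7
              rw [← this] at hij; simp at hij
            · have : p = 0 := by rw [hp, ext0, if_neg hy]
              rw [this, h4]; simp
          simp only [Fin.succAbove, Fin.lt_def, Fin.val_castSucc]
          split_ifs <;> simp <;> omega⟩

lemma extA_inj {m : ℕ} : Function.Injective (fun a : Adm F (m+1) × F => extA a.1 a.2) := by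
  rintro ⟨x, y⟩ ⟨x', y'⟩ h
  have h0 := congrArg Subtype.val h
  have h1 : Fin.cons (α := fun _ => Fin (m+2)) (ext0 x.1.1 y) (fun i => (ext0 x.1.1 y).succAbove (x.1.1 i)) =
    Fin.cons (ext0 x'.1.1 y') (fun i => (ext0 x'.1.1 y').succAbove (x'.1.1 i)) := congrArg Prod.fst h0
  have h2 : Fin.cons (α := fun _ => F) (if y = 0 then x.1.2 0 else y) x.1.2 = Fin.cons (if y' = 0 then x'.1.2 0 else y') x'.1.2 := congrArg Prod.snd h0
  obtain ⟨h3, h4⟩ := Fin.cons_inj.1 h1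
  obtain ⟨h5, h6⟩ := Fin.cons_inj.1 h2
  rw [h3] at h4
  have h7 : x.1.1 = x'.1.1 := by
    ext i; exact congrArg Fin.val (Fin.succAbove_right_injective (congrFun h4 i))
  have h8 : x = x' := Subtype.ext (Prod.ext h7 h6)
  subst h8
  have : y = y' := by
    unfold ext0 at h3
    by_cases hy : y = 0 <;> by_cases hy' : y' = 0
    · rw [hy, hy']
    · simp [hy, hy', Fin.succ_ne_zero] at h3
    · simp [hy, hy', (Fin.succ_ne_zero _).symm] at h3
    · simpa [hy, hy'] using h5
  rw [this]

lemma card_Adm (m : ℕ) : Fintype.card F ^ m * (Fintype.card F - 1) ≤ Nat.card (Adm F (m+1)) := by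
  induction m with
  | zero =>
    rw [pow_zero, one_mul, ← Fintype.card_units, ← Nat.card_eq_fintype_card]
    refine Nat.card_le_card_of_injective (fun y : Fˣ => (⟨(id, fun _ => y.1), Function.injective_id, fun _ => y.ne_zero, fun i j h => by
      have := i.2; have := j.2; omega⟩ : Adm F 1)) fun a b h => ?_
    have := congrArg (fun x : Adm F 1 => x.1.2 0) h
    exact Units.ext this
  | succ m ih =>
    have h := Nat.card_le_card_of_injective _ (extA_inj (F := F) (m := m))
    rw [Nat.card_prod, Nat.card_eq_fintype_card (α := F)] at h
    calc _ = (Fintype.card F ^ m * (Fintype.card F - 1)) * Fintype.card F := by ring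
    _ ≤ _ := Nat.mul_le_mul_right _ ih
    _ ≤ _ := h

variable {n : ℕ}

def pi (x : Adm F n) (i : Fin n) : Fin n := (x.1.1 i).rev

lemma pi_inj (x : Adm F n) : Function.Injective (pi x) := Fin.rev_injective.comp x.2.1

def nn (x : Adm F n) : GL (Fin n) F :=
  have h : (Matrix.of fun r c => if c = pi x r then (x.1.2 r)⁻¹ else 0 : Matrix (Fin n) (Fin n) F) * mono (pi x) x.1.2 = 1 := by
    ext r c
    rw [mul_mono, Matrix.of_apply, Matrix.one_apply]
    simp only [(pi_inj x).eq_iff]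
    by_cases h : c = r
    · subst h; simp [x.2.2.1 c]
    · simp [h, Ne.symm h]
  ⟨mono (pi x) x.1.2, Matrix.of fun r c => if c = pi x r then (x.1.2 r)⁻¹ else 0, mul_eq_one_comm.1 h, h⟩

lemma nn_val (x : Adm F n) : (nn x).1 = mono (pi x) x.1.2 := rfl

lemma nn_eq {x y : Adm F n} {u v : GL (Fin n) F} (h : u * nn x = nn y * v) (k c : Fin n) :
    u.1 (pi y k) (pi x c) * x.1.2 c = y.1.2 k * v.1 k c := by
  have := congrArg (fun g : GL (Fin n) F => g.1 (pi y k) c) h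
  simp only [Units.val_mul, nn_val] at this
  rwa [mono_mul _ _ _ (pi_inj y), mul_mono] at this

lemma nn_disj {x y : Adm F n} {u v : GL (Fin n) F} (hu : u ∈ UU F n) (hv : v ∈ UU F n) (h : u * nn x = nn y * v) : x = y := by
  have h1 : ∀ k, pi y k ≤ pi x k := fun k => by
    by_contra hc
    have := nn_eq h k k
    rw [IsUp.low hu (not_le.1 hc), IsUp.diag hv, zero_mul, mul_one] at this
    exact y.2.2.1 k this.symm
  have hs : ∀ z : Adm F n, ∑ k, (pi z k).val = ∑ k : Fin n, k.val := fun z =>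
    Equiv.sum_comp (Equiv.ofBijective _ (Finite.injective_iff_bijective.1 (pi_inj z))) (fun k : Fin n => k.val)
  have h2 := (Finset.sum_eq_sum_iff_of_le (s := Finset.univ) (fun k _ => Fin.le_def.1 (h1 k))).1 (by rw [hs, hs])
  have h3 : ∀ k, pi y k = pi x k := fun k => Fin.ext (h2 k (Finset.mem_univ _))
  refine Subtype.ext (Prod.ext (funext fun k => (Fin.rev_injective (h3 k)).symm) (funext fun k => ?_))
  have := nn_eq h k k
  rwa [h3, IsUp.diag hu, IsUp.diag hv, one_mul, mul_one] at this

lemma nn_wt (ψ : AddChar F ℂ) {x : Adm F n} (u v : UU F n) (h : u.1 * nn x = nn x * v.1) : wt ψ n u = wt ψ n v := by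
  rw [wt_apply, wt_apply]
  congr 1
  let e := Equiv.ofBijective _ (Finite.injective_iff_bijective.1 (pi_inj x))
  rw [tr1, tr1, ← Equiv.sum_comp e]
  refine Finset.sum_congr rfl fun k _ => ?_
  rw [← Equiv.sum_comp e]
  refine Finset.sum_congr rfl fun c _ => ?_
  have h1 := nn_eq h k c
  have hk := x.2.2.1 k
  have hc := x.2.2.1 c
  have hlow : ∀ {i j : Fin n}, j < i → u.1.1 i j = 0 := fun h => IsUp.low u.2 h
  have hlow' : ∀ {i j : Fin n}, j < i → v.1.1 i j = 0 := fun h => IsUp.low v.2 h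
  have hpv : ∀ i, (pi x i).val = n - ((x.1.1 i).val + 1) := fun i => Fin.val_rev _
  show (if (pi x c).val = (pi x k).val + 1 then u.1.1 (pi x k) (pi x c) else 0) = _
  have l1 := (x.1.1 k).2
  have l2 := (x.1.1 c).2
  by_cases hck : c.val = k.val + 1
  · rw [if_pos hck]
    rcases x.2.2.2 k c hck with h2 | ⟨h2, h3⟩
    · rw [Fin.lt_def] at h2
      rw [if_neg (by rw [hpv, hpv]; omega)]
      rw [hlow (by rw [Fin.lt_def, hpv, hpv]; omega), zero_mul] at h1
      exact ((mul_eq_zero.1 h1.symm).resolve_left hk).symm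
    · rw [if_pos (by rw [hpv, hpv]; omega)]
      rw [h3, mul_comm] at h1
      exact mul_left_cancel₀ hc h1
  · rw [if_neg hck]
    split_ifs with h2
    · rcases lt_trichotomy c k with h3 | h3 | h3
      · rw [hlow' h3, mul_zero] at h1
        exact (mul_eq_zero.1 h1).resolve_right hc
      · subst h3; omega
      · exfalso
        have hinv := comb_fin x.1.1 x.1.2 x.2.1 x.2.2.2
        rw [hpv, hpv] at h2
        rw [Fin.lt_def] at h3
        rcases x.2.2.2 (x.1.1 c) (x.1.1 k) (by omega) with h4 | ⟨h4, _⟩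
        · rw [(hinv c).1, (hinv k).1, Fin.lt_def] at h4; omega
        · rw [(hinv c).1, (hinv k).1] at h4; omega
    · rfl

def zf (ψ : AddChar F ℂ) (c : Adm F n → ℂ) (g : GL (Fin n) F) : ℂ :=
  ∑ x, c x * ∑ u : UU F n, ∑ v : UU F n, if u.1 * nn x * v.1 = g then wt ψ n u * wt ψ n v else 0

lemma op_zf (ψ : AddChar F ℂ) (c : Adm F n → ℂ) (S : IR (GL (Fin n) F)) :
    op S.ρ (zf ψ c) = ((Nat.card (UU F n) : ℂ) ^ 2) • ∑ x, c x • Fn ψ S (nn x) := by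
  have h1 : op S.ρ (zf ψ c) = ∑ x, c x • ∑ u : UU F n, ∑ v : UU F n, (wt ψ n u * wt ψ n v) • S.ρ (u.1 * nn x * v.1) := by
    simp only [op, zf, Finset.sum_smul, mul_smul]
    rw [Finset.sum_comm]
    refine Finset.sum_congr rfl fun x _ => ?_
    rw [← Finset.smul_sum, Finset.sum_comm]
    congr 1
    refine Finset.sum_congr rfl fun u _ => ?_
    rw [Finset.sum_comm]
    refine Finset.sum_congr rfl fun v _ => ?_
    simp [ite_smul, mul_smul]
  have hU : (Nat.card (UU F n) : ℂ) • We ψ S = ∑ u : UU F n, wt ψ n u • S.ρ u.1 := by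
    rw [We, smul_smul, mul_inv_cancel₀ (U_ne n), one_smul]
  rw [h1, Finset.smul_sum]
  refine Finset.sum_congr rfl fun x _ => ?_
  rw [smul_comm]
  congr 1
  have h2 : (Nat.card (UU F n) : ℂ) ^ 2 • Fn ψ S (nn x) = ((Nat.card (UU F n) : ℂ) • We ψ S) * S.ρ (nn x) * ((Nat.card (UU F n) : ℂ) • We ψ S) := by
    rw [Fn, smul_mul_assoc, smul_mul_assoc, mul_smul_comm, smul_smul, pow_two]
  rw [h2, hU, Finset.sum_mul, Finset.sum_mul]
  refine Finset.sum_congr rfl fun u _ => ?_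
  rw [Finset.mul_sum]
  refine Finset.sum_congr rfl fun v _ => ?_
  rw [map_mul, map_mul, mul_smul_comm, smul_mul_assoc, smul_mul_assoc, smul_smul, mul_comm (wt ψ n u)]

lemma zf_zero (ψ : AddChar F ℂ) (c : Adm F n → ℂ) (h : zf ψ c = 0) : c = 0 := by
  ext s
  have h1 := congrFun h (nn s)
  have h2 : ∀ x, ∀ u v : UU F n, (if u.1 * nn x * v.1 = nn s then wt ψ n u * wt ψ n v else 0) =
      if x = s then (if u.1 * nn x * v.1 = nn s then 1 else 0) else 0 := fun x u v => by
    by_cases h3 : u.1 * nn x * v.1 = nn s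
    · have h4 : u.1 * nn x = nn s * (v⁻¹).1 := by rw [← h3]; simp
      have h5 := nn_disj u.2 (v⁻¹).2 h4
      subst h5
      have h6 := nn_wt ψ u v⁻¹ h4
      rw [if_pos h3, if_pos rfl, if_pos h3, h6, ← map_mul, inv_mul_cancel, map_one]
    · simp [h3]
  simp only [zf, h2] at h1
  rw [Finset.sum_eq_single s] at h1
  · simp only [if_true, Pi.zero_apply] at h1
    refine (mul_eq_zero.1 h1).resolve_right ?_
    have h7 : (∑ u : UU F n, ∑ v : UU F n, if u.1 * nn s * v.1 = nn s then (1:ℕ) else 0) ≠ 0 := by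
      intro h8
      rw [Finset.sum_eq_zero_iff] at h8
      have := h8 1 (Finset.mem_univ _)
      rw [Finset.sum_eq_zero_iff] at this
      have := this 1 (Finset.mem_univ _)
      simp at this
    exact_mod_cast h7
  · intro b _ hb
    simp [hb]
  · simp

def tf (ψ : AddChar F ℂ) (f : GL (Fin n) F → ℂ) (k : GL (Fin n) F) : ℂ :=
  (Nat.card (UU F n) : ℂ)⁻¹ * ∑ u : UU F n, wt ψ n u * f (k * u.1)

lemma tf_eq (ψ : AddChar F ℂ) (S : IR (GL (Fin n) F)) (k : GL (Fin n) F) : LinearMap.trace ℂ S.V (S.ρ k * We ψ S) = tf ψ (chr S) k := by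
  rw [tf, We, mul_smul_comm, Finset.mul_sum, map_smul, map_sum, smul_eq_mul]
  simp [chr, Representation.character]

lemma card_gen (ψ : AddChar F ℂ) (hψ : ψ.IsPrimitive) : Nat.card (Adm F n) ≤ Nat.card {χ : Irr (GL (Fin n) F) // dlt ψ n χ.1 ≠ 0} := by
  by_contra hcon
  push Not at hcon
  let L : (Adm F n → ℂ) →ₗ[ℂ] ({χ : Irr (GL (Fin n) F) // dlt ψ n χ.1 ≠ 0} → ℂ) :=
    { toFun := fun c χ => ∑ x, c x * tf ψ χ.1.1 (nn x)
      map_add' := fun c d => by ext χ; simp [add_mul, Finset.sum_add_distrib]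
      map_smul' := fun a c => by ext χ; simp [Finset.mul_sum, mul_assoc] }
  have hL : LinearMap.ker L ≠ ⊥ := LinearMap.ker_ne_bot_of_finrank_lt (by
    rw [Module.finrank_fintype_fun_eq_card, Module.finrank_fintype_fun_eq_card, ← Nat.card_eq_fintype_card, ← Nat.card_eq_fintype_card]
    exact hcon)
  obtain ⟨c, hc, hc0⟩ := Submodule.exists_mem_ne_zero_of_ne_bot hL
  apply hc0
  apply zf_zero ψ
  by_contra hz
  obtain ⟨S, hS⟩ := exists_op_ne _ hz
  apply hS
  rw [op_zf]
  suffices ∑ x, c x • Fn ψ S (nn x) = 0 by rw [this, smul_zero]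
  by_cases h0 : dlt ψ n (chr S) = 0
  · refine Finset.sum_eq_zero fun x _ => ?_
    rw [Fn, We_zero ψ S h0, mul_zero, smul_zero]
  · have h1 : dlt ψ n (chr S) • ∑ x, c x • Fn ψ S (nn x) = 0 := by
      rw [Finset.smul_sum]
      have h2 : ∀ x, dlt ψ n (chr S) • c x • Fn ψ S (nn x) = (c x * tf ψ (chr S) (nn x)) • We ψ S := fun x => by
        rw [smul_comm, mult ψ S hψ, tf_eq, smul_smul]
      simp only [h2, ← Finset.sum_smul]
      have h3 : ∑ x, c x * tf ψ (chr S) (nn x) = 0 := congrFun (LinearMap.mem_ker.1 hc) ⟨ofIR S, h0⟩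
      rw [h3, zero_smul]
    exact (smul_eq_zero.1 h1).resolve_left h0

end CT
end

noncomputable section
set_option linter.all false
namespace CT
open Module
attribute [local instance] Classical.propDecidable
variable {F : Type} [Field F] [Fintype F]

lemma dlt_sum (ψ : AddChar F ℂ) (n : ℕ) (l : List (Cu F)) :
    dlt ψ n (res n (R l)) = ∑ X : Irr (GL (Fin n) F), mu n l X * dlt ψ n X.1 := by
  conv_lhs => rw [expand (res n (R l)) (res_class n (R l))]
  simp only [dlt, Finset.mul_sum]
  rw [Finset.sum_comm]
  refine Finset.sum_congr rfl fun X _ => Finset.sum_congr rfl fun u _ => ?_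
  rw [mu]; ring

lemma gen_uniq (ψ : AddChar F ℂ) (hψ : ψ.IsPrimitive) {n : ℕ} {l : List (Cu F)} (h : dg l = n) (χ : Irr (GL (Fin n) F))
    (h1 : mu n l χ ≠ 0) (h2 : dlt ψ n χ.1 ≠ 0) : (∀ ρ ∈ l, dlt ψ ρ.m ρ.χ.1 ≠ 0) ∧
    ∀ χ' : Irr (GL (Fin n) F), mu n l χ' ≠ 0 → dlt ψ n χ'.1 ≠ 0 → χ = χ' := by
  choose a ha using mu_nat (F := F) h
  choose d hd using fun X : Irr (GL (Fin n) F) => dlt_nat X ψ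
  have hs := dlt_sum ψ n l
  rw [dlt_R ψ hψ l n h] at hs
  simp only [ha, hd] at hs
  have hpos : ∀ X, mu n l X ≠ 0 → dlt ψ n X.1 ≠ 0 → 1 ≤ a X * d X := fun X e1 e2 => by
    rw [ha] at e1; rw [hd] at e2
    have e1 : a X ≠ 0 := by exact_mod_cast e1
    have e2 : d X ≠ 0 := by exact_mod_cast e2
    exact Nat.one_le_iff_ne_zero.2 (mul_ne_zero e1 e2)
  have hge : a χ * d χ ≤ ∑ X, a X * d X := Finset.single_le_sum (f := fun X => a X * d X) (fun _ _ => Nat.zero_le _) (Finset.mem_univ χ)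
  have hP : (l.map fun ρ => dlt ψ ρ.m ρ.χ.1).prod ≠ 0 := by
    rw [hs]
    have : (∑ X, a X * d X : ℕ) ≠ 0 := by have := hpos χ h1 h2; omega
    exact_mod_cast this
  have hne : ∀ ρ ∈ l, dlt ψ ρ.m ρ.χ.1 ≠ 0 := fun ρ hρ h0 => hP (List.prod_eq_zero (List.mem_map.2 ⟨ρ, hρ, h0⟩))
  refine ⟨hne, fun χ' e1 e2 => ?_⟩
  by_contra hc
  have hP1 : (l.map fun ρ => dlt ψ ρ.m ρ.χ.1).prod = 1 := List.prod_eq_one fun x hx => by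
    obtain ⟨ρ, hρ, rfl⟩ := List.mem_map.1 hx
    exact dlt_01 ψ hψ _ (hne ρ hρ)
  rw [hP1] at hs
  have hs' : 1 = ∑ X, a X * d X := by exact_mod_cast hs
  have h3 : ∑ X ∈ {χ, χ'}, a X * d X ≤ ∑ X, a X * d X := Finset.sum_le_sum_of_subset (Finset.subset_univ _)
  rw [Finset.sum_pair hc] at h3
  have := hpos χ h1 h2
  have := hpos χ' e1 e2
  omega

lemma gen_le (ψ : AddChar F ℂ) (hψ : ψ.IsPrimitive) (n : ℕ) : Nat.card {χ : Irr (GL (Fin n) F) // dlt ψ n χ.1 ≠ 0} ≤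
    Nat.card {χ : Irr (GL (Fin n) F) // χ.1 (JJ n) ≠ 0} := by
  choose l hl hm using occurs (F := F) n
  have h1 : ∀ χ : {χ : Irr (GL (Fin n) F) // dlt ψ n χ.1 ≠ 0}, ∃ X : Irr (GL (Fin n) F), X.1 (JJ n) ≠ 0 ∧ mu n (l χ.1) X ≠ 0 := fun χ => by
    have h2 := eps_R ψ hψ (l χ.1) (gen_uniq ψ hψ (hl χ.1) χ.1 (hm χ.1) χ.2).1 n (hl χ.1)
    by_contra hc
    push Not at hc
    apply h2
    rw [expand (res n (R (l χ.1))) (res_class n _)]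
    refine Finset.sum_eq_zero fun X _ => ?_
    by_cases h3 : X.1 (JJ n) = 0
    · rw [h3, mul_zero]
    · have := hc X h3
      rw [mu] at this
      rw [this, zero_mul]
  choose f hf hf' using h1
  refine Nat.card_le_card_of_injective (fun χ => (⟨f χ, hf χ⟩ : {χ : Irr (GL (Fin n) F) // χ.1 (JJ n) ≠ 0})) fun χ χ' he => ?_
  have he' : f χ = f χ' := congrArg Subtype.val he
  have hm1 : (l χ.1 : Multiset (Cu F)) = l χ'.1 := by
    by_contra hne
    rcases disj (hl _) (hl _) hne (f χ) with h | h
    · exact hf' χ h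
    · rw [he'] at h; exact hf' χ' h
  have h4 := perm_mu (hl _) (hl _) hm1 χ'.1
  exact Subtype.ext ((gen_uniq ψ hψ (hl χ.1) χ.1 (hm χ.1) χ.2).2 χ'.1 (by rw [h4]; exact hm _) χ'.2)

theorem final (p : ℕ) (hp : p.Prime) [CharP F p] (m : ℕ) :
    Nat.card {χ : GL (Fin (m+1)) F → ℂ // IsIrrChar _ χ ∧ ¬ NatDvdAlg p (χ 1)} = Fintype.card F ^ m * (Fintype.card F - 1) := by
  obtain ⟨ψ, hψ⟩ : ∃ ψ : AddChar F ℂ, ψ.IsPrimitive := by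
    obtain ⟨ψ, h⟩ := AddChar.exists_apply_ne_zero.2 (one_ne_zero (α := F))
    exact ⟨ψ, AddChar.IsPrimitive.of_ne_one (by rintro rfl; simp at h)⟩
  choose a ha using fun X : Irr (GL (Fin (m+1)) F) => eps_int ψ hψ X
  have hcol := col_orth (JJ (m+1) : GL (Fin (m+1)) F)
  simp only [fun X : Irr (GL (Fin (m+1)) F) => J_inv (irr_conj X), ha] at hcol
  have hcol' : ∑ X, a X * a X = (Nat.card (Subgroup.centralizer {(JJ (m+1) : GL (Fin (m+1)) F)}) : ℤ) := by exact_mod_cast hcol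
  have hb := card_cent (F := F) m
  have hJ : (Nat.card {χ : Irr (GL (Fin (m+1)) F) // χ.1 (JJ (m+1)) ≠ 0} : ℤ) = ∑ X : Irr (GL (Fin (m+1)) F), if a X ≠ 0 then 1 else 0 := by
    rw [Finset.sum_boole, Nat.card_eq_fintype_card, Fintype.card_subtype]
    simp [ha]
  have hlow := (card_Adm (F := F) m).trans ((card_gen ψ hψ).trans (gen_le ψ hψ (m+1)))
  have hle : ∀ X, (if a X ≠ 0 then 1 else 0 : ℤ) ≤ a X * a X := fun X => by
    split_ifs with h
    · have : 0 < a X * a X := mul_self_pos.2 h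
      omega
    · exact mul_self_nonneg _
  have hsum : ∑ X, (if a X ≠ 0 then 1 else 0 : ℤ) = ∑ X, a X * a X := by
    refine le_antisymm (Finset.sum_le_sum fun X _ => hle X) ?_
    rw [← hJ, hcol']
    exact_mod_cast hb.trans hlow
  have heq := (Finset.sum_eq_sum_iff_of_le (fun X _ => hle X)).1 hsum
  obtain ⟨k, hk⟩ : ∃ k, m + 1 ≤ p ^ k := ⟨m+1, (Nat.lt_pow_self hp.one_lt).le⟩
  have hiff : ∀ X : Irr (GL (Fin (m+1)) F), ¬ NatDvdAlg p (X.1 1) ↔ X.1 (JJ (m+1)) ≠ 0 := fun X => by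
    rw [natDvd_iff X p k hp _ (J_pow p k (m+1) hp hk) (a X) (ha X), ha X]
    have h1 := heq X (Finset.mem_univ _)
    by_cases h0 : a X = 0
    · simp [h0]
    · rw [if_pos h0] at h1
      have h2 : ¬ (p : ℤ) ∣ a X := fun h => by
        have h3 : (p : ℤ) ∣ 1 := by rw [h1]; exact h.mul_right _
        have h4 := Int.natCast_dvd_natCast.1 (by simpa using h3 : (p : ℤ) ∣ ((1 : ℕ) : ℤ))
        exact hp.one_lt.ne' (Nat.dvd_one.1 h4)
      simp [h0, h2]
  have hcard : Nat.card {χ : GL (Fin (m+1)) F → ℂ // IsIrrChar _ χ ∧ ¬ NatDvdAlg p (χ 1)} =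
      Nat.card {χ : Irr (GL (Fin (m+1)) F) // χ.1 (JJ (m+1)) ≠ 0} :=
    Nat.card_congr
      { toFun := fun x => ⟨⟨x.1, x.2.1⟩, (hiff ⟨x.1, x.2.1⟩).1 x.2.2⟩
        invFun := fun x => ⟨x.1.1, x.1.2, (hiff x.1).2 x.2⟩
        left_inv := fun x => rfl
        right_inv := fun x => rfl }
  rw [hcard]
  refine le_antisymm ?_ hlow
  have : (Nat.card {χ : Irr (GL (Fin (m+1)) F) // χ.1 (JJ (m+1)) ≠ 0} : ℤ) = Nat.card (Subgroup.centralizer {(JJ (m+1) : GL (Fin (m+1)) F)}) := by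
    rw [hJ, hsum, hcol']
  have h' : Nat.card {χ : Irr (GL (Fin (m+1)) F) // χ.1 (JJ (m+1)) ≠ 0} = Nat.card (Subgroup.centralizer {(JJ (m+1) : GL (Fin (m+1)) F)}) := by
    exact_mod_cast this
  rw [h']
  exact hb

end CT
end


theorem card_characters_of_degree_coprime_to_p
    (p : ℕ) (hp : p.Prime) (e : ℕ) (he : 0 < e) (q : ℕ) (hq : q = p ^ e)
    (F : Type) [Field F] [Fintype F] (hFq : Fintype.card F = q)
    (n : ℕ) (hn : 0 < n) :
    Nat.card {χ : GL (Fin n) F → ℂ // IsIrrChar _ χ ∧ ¬ NatDvdAlg p (χ 1)} =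
      q ^ n - q ^ (n - 1) := by
  obtain ⟨m, rfl⟩ : ∃ m, n = m + 1 := ⟨n - 1, by omega⟩
  have hc : CharP F p := by
    obtain ⟨r, hr⟩ := CharP.exists F
    obtain ⟨k, hr', hk⟩ := FiniteField.card F r
    have h1 : r ∣ p ^ e := by
      rw [← hq, ← hFq, hk]; exact dvd_pow_self _ k.ne_zero
    have h2 : r = p := (Nat.prime_dvd_prime_iff_eq hr' hp).1 (hr'.dvd_of_dvd_pow h1)
    exact h2 ▸ hr
  rw [CT.final p hp m, hFq, Nat.add_sub_cancel, pow_succ, Nat.mul_sub, mul_one]
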